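/- Let k ⊂ ℂ be an imaginary quadratic field, let n ≥ 1, let L₁, …, Lₙ ⊂ ℂ be quadratic extensions of k, and let L₁′, …, Lₙ′ be their images under complex conjugation. Assume the compositum L of L₁, …, Lₙ, L₁′, …, Lₙ′ satisfies [L : k] = 2^{2n}. Let 𝒫 be the set of rational primes p such that p splits in k and every prime ideal of O_k lying above p is nonsplit in every extension L_i/k (1 ≤ i ≤ n). Then there is a positive constant C (depending on k and the L_i) such that the number of squarefree positive integers d ≤ X all of whose prime factors lie in 𝒫 is asymptotic to C·X/(log X)^{1 − 1/2^{2n+1}} as X → ∞. -/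

import Mathlib

open NumberField Filter

/-- The image of an intermediate field of `ℂ/ℚ` under complex conjugation. -/
noncomputable def conjField (L : IntermediateField ℚ ℂ) : IntermediateField ℚ ℂ :=
  L.map (RingHom.toRatAlgHom (starRingEnd ℂ))

/-- A nonzero prime ideal `𝔭` of `O_k` *splits* in an extension `L/k`
(given by `h : k ≤ L`) if `𝔭 O_L` is a product of two distinct prime ideals of `O_L`. -/
def SplitsIn (k L : IntermediateField ℚ ℂ) (h : k ≤ L) (𝔭 : Ideal (𝓞 ↥k)) : Prop :=
  ∃ P Q : Ideal (𝓞 ↥L), P ≠ Q ∧ P.IsPrime ∧ Q.IsPrime ∧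
    Ideal.map (RingOfIntegers.mapRingHom (IntermediateField.inclusion h)) 𝔭 = P * Q

/-- A rational prime `p` *splits* in the number field `k` if `p O_k` is a product of
two distinct prime ideals of `O_k`. -/
def RatPrimeSplitsIn (k : IntermediateField ℚ ℂ) (p : ℕ) : Prop :=
  ∃ P Q : Ideal (𝓞 ↥k), P ≠ Q ∧ P.IsPrime ∧ Q.IsPrime ∧
    Ideal.span {(p : 𝓞 ↥k)} = P * Q

namespace IdealCount

/-- The tent function `max 0 (1 - |x|)`, whose integer translates form a partition of unity. -/
noncomputable def tent (x : ℝ) : ℝ := max 0 (1 - |x|)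

lemma tent_nonneg (x : ℝ) : 0 ≤ tent x := le_max_left _ _

lemma tent_le_one (x : ℝ) : tent x ≤ 1 := max_le zero_le_one (by linarith [abs_nonneg x])

lemma abs_tent_sub_le (x y : ℝ) : |tent x - tent y| ≤ |x - y| := by
  unfold tent
  refine (abs_max_sub_max_le_max _ _ _ _).trans ?_
  rw [sub_self, abs_zero, max_eq_right (abs_nonneg _), abs_sub_comm x y,
    show 1 - |x| - (1 - |y|) = |y| - |x| by ring]
  exact abs_abs_sub_abs_le _ _

lemma abs_lt_one_of_tent_ne_zero {x : ℝ} (h : tent x ≠ 0) : |x| < 1 := by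
  contrapose! h
  exact max_eq_left (by linarith)

lemma tent_add_int_eq_zero {x : ℝ} (h0 : 0 ≤ x) (h1 : x < 1) {m : ℤ}
    (hm : m ∉ ({0, -1} : Finset ℤ)) : tent (x + m) = 0 := by
  refine max_eq_left ?_
  simp only [Finset.mem_insert, Finset.mem_singleton, not_or] at hm
  rcases lt_or_gt_of_ne hm.1 with h | h
  · have : (m : ℝ) ≤ -2 := by exact_mod_cast (by omega : m ≤ -2)
    rw [abs_of_neg (by linarith)]; linarith
  · have : (1 : ℝ) ≤ m := by exact_mod_cast h
    rw [abs_of_pos (by linarith)]; linarith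

lemma sum_tent_add_int {x : ℝ} (h0 : 0 ≤ x) (h1 : x < 1) :
    ∑ m ∈ ({0, -1} : Finset ℤ), tent (x + m) = 1 := by
  rw [Finset.sum_pair (by norm_num)]
  simp only [Int.cast_zero, add_zero, Int.cast_neg, Int.cast_one, tent]
  rw [abs_of_nonneg h0, abs_of_nonpos (by linarith), max_eq_right (by linarith),
    max_eq_right (by linarith)]
  ring

lemma tsum_prod_tent {ι : Type*} [Fintype ι] {x : ι → ℝ} (h0 : ∀ i, 0 ≤ x i)
    (h1 : ∀ i, x i < 1) :
    ∑' m : ι → ℤ, ENNReal.ofReal (∏ i, tent (x i + m i)) = 1 := by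
  classical
  rw [tsum_eq_sum (s := Fintype.piFinset fun _ : ι ↦ ({0, -1} : Finset ℤ)) ?_]
  · rw [← ENNReal.ofReal_sum_of_nonneg (fun m _ ↦ Finset.prod_nonneg fun i _ ↦ tent_nonneg _),
      ← Finset.prod_univ_sum (fun _ ↦ ({0, -1} : Finset ℤ)) (fun i m ↦ tent (x i + m))]
    rw [Finset.prod_congr rfl fun i _ ↦ sum_tent_add_int (h0 i) (h1 i), Finset.prod_const_one,
      ENNReal.ofReal_one]
  · intro m hm
    simp only [Fintype.mem_piFinset, not_forall] at hm
    obtain ⟨i, hi⟩ := hm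
    rw [Finset.prod_eq_zero (Finset.mem_univ i) (tent_add_int_eq_zero (h0 i) (h1 i) hi),
      ENNReal.ofReal_zero]

lemma abs_prod_sub_prod_le {ι : Type*} (s : Finset ι) {a b : ι → ℝ}
    (ha0 : ∀ i, 0 ≤ a i) (ha : ∀ i, a i ≤ 1) (hb0 : ∀ i, 0 ≤ b i) (hb : ∀ i, b i ≤ 1) :
    |∏ i ∈ s, a i - ∏ i ∈ s, b i| ≤ ∑ i ∈ s, |a i - b i| := by
  classical
  induction s using Finset.induction_on with
  | empty => simp
  | insert j s hj ih =>
    rw [Finset.prod_insert hj, Finset.prod_insert hj, Finset.sum_insert hj]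
    have hB : |∏ i ∈ s, b i| ≤ 1 := by
      rw [abs_of_nonneg (Finset.prod_nonneg fun i _ ↦ hb0 i)]
      exact Finset.prod_le_one (fun i _ ↦ hb0 i) fun i _ ↦ hb i
    calc |a j * ∏ i ∈ s, a i - b j * ∏ i ∈ s, b i|
        = |(a j - b j) * ∏ i ∈ s, b i + a j * (∏ i ∈ s, a i - ∏ i ∈ s, b i)| := by ring_nf
      _ ≤ |a j - b j| * |∏ i ∈ s, b i| + |a j| * |∏ i ∈ s, a i - ∏ i ∈ s, b i| := by
        rw [← abs_mul, ← abs_mul]; exact abs_add_le _ _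
      _ ≤ |a j - b j| * 1 + 1 * ∑ i ∈ s, |a i - b i| := by
        have : |a j| ≤ 1 := by rw [abs_of_nonneg (ha0 j)]; exact ha j
        gcongr
      _ = _ := by ring

open NumberField.mixedEmbedding NumberField.Units NumberField.Units.dirichletUnitTheorem
open fundamentalCone

variable (K : Type*) [Field K] [NumberField K]

open scoped Classical in
/-- The coordinates of `logMap x` with respect to the basis of the unit lattice. -/
noncomputable def coord (x : mixedSpace K) : Fin (rank K) → ℝ :=
  ((basisUnitLattice K).ofZLatticeBasis ℝ _).equivFun (logMap x)

open Classical in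
/-- A weight on the mixed space whose translates by the units modulo torsion sum to `1`. -/
noncomputable def weight (x : mixedSpace K) : ℝ :=
  if mixedEmbedding.norm x = 0 then 0 else ∏ i, tent (coord K x i)

/-- The unit with prescribed exponents on the fundamental system. -/
noncomputable def unitOf (m : Fin (rank K) → ℤ) : (𝓞 K)ˣ := ∏ i, fundSystem K i ^ m i

variable {K}

open scoped Classical in
lemma coord_unitOf_smul (m : Fin (rank K) → ℤ) {x : mixedSpace K}
    (hx : mixedEmbedding.norm x ≠ 0) :
    coord K (unitOf K m • x) = coord K x + fun i ↦ (m i : ℝ) := by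
  have h : logEmbedding K (Additive.ofMul (unitOf K m)) =
      ∑ i, (m i : ℝ) • (basisUnitLattice K).ofZLatticeBasis ℝ _ i := by
    rw [unitOf, ofMul_prod, map_sum]
    refine Finset.sum_congr rfl fun i _ ↦ ?_
    rw [ofMul_zpow, map_zsmul, logEmbedding_fundSystem, Module.Basis.ofZLatticeBasis_apply,
      Int.cast_smul_eq_zsmul]
  rw [coord, logMap_unit_smul _ hx, map_add, add_comm, h, ← coord]
  congr 1
  ext i
  simp [Finsupp.single_apply]

open scoped Classical in
lemma mem_fundamentalCone_iff {x : mixedSpace K} :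
    x ∈ fundamentalCone K ↔ (∀ i, coord K x i ∈ Set.Ico (0 : ℝ) 1) ∧ mixedEmbedding.norm x ≠ 0 := by
  rw [fundamentalCone, Set.mem_sdiff, Set.mem_preimage, ZSpan.mem_fundamentalDomain]
  simp [coord]

lemma weight_nonneg (x : mixedSpace K) : 0 ≤ weight K x := by
  unfold weight; split_ifs
  · rfl
  · exact Finset.prod_nonneg fun i _ ↦ tent_nonneg _

lemma weight_le_one (x : mixedSpace K) : weight K x ≤ 1 := by
  unfold weight; split_ifs
  · exact zero_le_one
  · exact Finset.prod_le_one (fun i _ ↦ tent_nonneg _) fun i _ ↦ tent_le_one _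

lemma tsum_weight_unitOf_smul {x : mixedSpace K} (hx : x ∈ fundamentalCone K) :
    ∑' m, ENNReal.ofReal (weight K (unitOf K m • x)) = 1 := by
  obtain ⟨h1, h2⟩ := mem_fundamentalCone_iff.mp hx
  rw [← tsum_prod_tent (fun i ↦ (h1 i).1) (fun i ↦ (h1 i).2)]
  refine tsum_congr fun m ↦ ?_
  rw [weight, norm_unit_smul, if_neg h2, coord_unitOf_smul m h2]
  simp

open nonZeroDivisors in
lemma unit_smul_mem_idealLattice (J : (Ideal (𝓞 K))⁰) (u : (𝓞 K)ˣ) {x : mixedSpace K}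
    (hx : x ∈ mixedEmbedding.idealLattice K (FractionalIdeal.mk0 K J)) :
    u • x ∈ mixedEmbedding.idealLattice K (FractionalIdeal.mk0 K J) := by
  rw [mem_idealLattice] at hx ⊢
  obtain ⟨y, hy, rfl⟩ := hx
  refine ⟨(u : 𝓞 K) • y, Submodule.smul_mem (_ : Submodule (𝓞 K) K) _ hy, ?_⟩
  rw [unitSMul_smul, Algebra.smul_def, map_mul]

open nonZeroDivisors in
/-- The weighted sum over the nonzero points of an ideal lattice counts the points of the lattice
in the fundamental cone. -/
lemma tsum_weight_eq_encard (J : (Ideal (𝓞 K))⁰) (t : ℝ) :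
    ∑' x : mixedEmbedding.idealLattice K (FractionalIdeal.mk0 K J),
      Set.indicator {x : mixedSpace K | mixedEmbedding.norm x ≤ t}
        (fun x ↦ ENNReal.ofReal (weight K x)) (x : mixedSpace K) =
      ENat.card {a : idealSet K J // mixedEmbedding.norm (a : mixedSpace K) ≤ t} := by
  let A := {a : idealSet K J // mixedEmbedding.norm (a : mixedSpace K) ≤ t}
  let g : A × (Fin (rank K) → ℤ) → mixedEmbedding.idealLattice K (FractionalIdeal.mk0 K J) :=
    fun p ↦ ⟨unitOf K p.2 • (p.1.1 : mixedSpace K), unit_smul_mem_idealLattice J _ p.1.1.2.2⟩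
  have hg : Function.Injective g := by
    rintro ⟨a, m⟩ ⟨b, l⟩ h
    have h : unitOf K m • (a.1 : mixedSpace K) = unitOf K l • (b.1 : mixedSpace K) :=
      congrArg Subtype.val h
    obtain ⟨ha, ha0⟩ := mem_fundamentalCone_iff.mp a.1.2.1
    obtain ⟨hb, hb0⟩ := mem_fundamentalCone_iff.mp b.1.2.1
    have hc := congrArg (coord K) h
    rw [coord_unitOf_smul m ha0, coord_unitOf_smul l hb0] at hc
    have hml : m = l := by
      ext i
      have := congrFun hc i
      simp only [Pi.add_apply] at this
      have h1 := ha i; have h2 := hb i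
      have h3 : (m i : ℝ) < l i + 1 := by linarith [h1.1, h2.2]
      have h4 : (l i : ℝ) < m i + 1 := by linarith [h1.2, h2.1]
      have h5 : m i < l i + 1 := by exact_mod_cast h3
      have h6 : l i < m i + 1 := by exact_mod_cast h4
      omega
    subst hml
    have := congrArg ((unitOf K m)⁻¹ • ·) h
    simp only [inv_smul_smul] at this
    exact Prod.ext (Subtype.ext (Subtype.ext this)) rfl
  rw [← hg.tsum_eq, ENNReal.tsum_prod']
  · rw [← ENNReal.tsum_one]
    refine tsum_congr fun a ↦ ?_
    rw [← tsum_weight_unitOf_smul a.1.2.1]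
    refine tsum_congr fun m ↦ ?_
    rw [Set.indicator_of_mem]
    simpa [g, norm_unit_smul] using a.2
  · intro x hx
    rw [Function.mem_support] at hx
    have hxt : mixedEmbedding.norm (x : mixedSpace K) ≤ t := by
      by_contra h
      exact hx (by rw [Set.indicator_of_notMem]; exact h)
    have hx0 : mixedEmbedding.norm (x : mixedSpace K) ≠ 0 := by
      intro h
      apply hx
      rw [Set.indicator_of_mem (by exact hxt), weight, if_pos h, ENNReal.ofReal_zero]
    let m : Fin (rank K) → ℤ := fun i ↦ ⌊coord K (x : mixedSpace K) i⌋
    have hinv : unitOf K (-m) = (unitOf K m)⁻¹ := by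
      simp [unitOf]
    have hmem : unitOf K (-m) • (x : mixedSpace K) ∈ fundamentalCone K := by
      rw [mem_fundamentalCone_iff, norm_unit_smul, coord_unitOf_smul _ hx0]
      refine ⟨fun i ↦ ?_, hx0⟩
      simp only [Pi.add_apply, Pi.neg_apply, Int.cast_neg, m, ← sub_eq_add_neg]
      exact ⟨Int.fract_nonneg _, Int.fract_lt_one _⟩
    refine ⟨⟨⟨⟨unitOf K (-m) • (x : mixedSpace K), hmem, unit_smul_mem_idealLattice J _ x.2⟩, ?_⟩,
      m⟩, ?_⟩
    · simpa [norm_unit_smul] using hxt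
    · apply Subtype.ext
      change unitOf K m • (unitOf K (-m) • (x : mixedSpace K)) = x
      rw [hinv, smul_inv_smul]

end IdealCount

namespace IdealCount

open NumberField.mixedEmbedding NumberField.Units NumberField.Units.dirichletUnitTheorem
open NumberField.InfinitePlace
open fundamentalCone

section geometry

open scoped Classical

variable {K : Type*} [Field K] [NumberField K]

lemma log_norm_eq_sum {x : mixedSpace K} (hx : mixedEmbedding.norm x ≠ 0) :
    Real.log (mixedEmbedding.norm x) = ∑ w, (mult w : ℝ) * Real.log (normAtPlace w x) := by
  rw [mixedEmbedding.norm_apply, Real.log_prod]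
  · simp [Real.log_pow]
  · intro w _
    exact pow_ne_zero _ (mixedEmbedding.norm_ne_zero_iff.mp hx w)

lemma finrank_pos_real : 0 < (Module.finrank ℚ K : ℝ) := by exact_mod_cast Module.finrank_pos

omit [NumberField K] in
lemma one_le_mult_real (w : InfinitePlace K) : (1 : ℝ) ≤ mult w := by
  exact_mod_cast one_le_mult

lemma sum_mult_real : ∑ w : InfinitePlace K, (mult w : ℝ) = (Module.finrank ℚ K : ℝ) := by
  exact_mod_cast sum_mult_eq (K := K)

lemma sum_mult_log_sub_eq_zero {x : mixedSpace K} (hx : mixedEmbedding.norm x ≠ 0) :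
    ∑ w, (mult w : ℝ) * (Real.log (normAtPlace w x) -
      Real.log (mixedEmbedding.norm x) * ((Module.finrank ℚ K : ℝ))⁻¹) = 0 := by
  simp_rw [mul_sub]
  rw [Finset.sum_sub_distrib, ← Finset.sum_mul, ← log_norm_eq_sum hx, sum_mult_real]
  field_simp [finrank_pos_real (K := K).ne']
  simp

lemma abs_log_sub_le_of_abs_logMap_le {x : mixedSpace K} (hx : mixedEmbedding.norm x ≠ 0) {B : ℝ}
    (hB : ∀ w, |logMap x w| ≤ B) (w : InfinitePlace K) :
    |Real.log (normAtPlace w x) - Real.log (mixedEmbedding.norm x) * ((Module.finrank ℚ K : ℝ))⁻¹| ≤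
      (1 + Fintype.card (InfinitePlace K)) * |B| := by
  set g : InfinitePlace K → ℝ := fun w ↦ (mult w : ℝ) * (Real.log (normAtPlace w x) -
      Real.log (mixedEmbedding.norm x) * ((Module.finrank ℚ K : ℝ))⁻¹) with hg
  have key : ∀ w, |g w| ≤ (1 + Fintype.card (InfinitePlace K)) * |B| := by
    intro w
    have h1 : ∀ w, w ≠ w₀ → |g w| ≤ |B| := fun w hw ↦ (hB ⟨w, hw⟩).trans (le_abs_self B)
    by_cases hw : w = w₀
    · have h2 : g w₀ = - ∑ w ∈ Finset.univ.erase w₀, g w := by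
        rw [eq_neg_iff_add_eq_zero, Finset.add_sum_erase _ _ (Finset.mem_univ _)]
        exact sum_mult_log_sub_eq_zero hx
      rw [hw, h2, abs_neg]
      refine (Finset.abs_sum_le_sum_abs _ _).trans ?_
      refine (Finset.sum_le_sum fun i hi ↦ h1 i (Finset.ne_of_mem_erase hi)).trans ?_
      rw [Finset.sum_const, nsmul_eq_mul]
      gcongr
      have : (Finset.univ.erase (w₀ : InfinitePlace K)).card ≤ Fintype.card (InfinitePlace K) :=
        Finset.card_le_univ _
      have : ((Finset.univ.erase (w₀ : InfinitePlace K)).card : ℝ) ≤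
        Fintype.card (InfinitePlace K) := by exact_mod_cast this
      linarith
    · refine (h1 w hw).trans ?_
      have : (0 : ℝ) ≤ Fintype.card (InfinitePlace K) := by positivity
      nlinarith [abs_nonneg B]
  refine le_trans ?_ (key w)
  rw [hg, abs_mul, abs_of_nonneg (by linarith [one_le_mult_real w] : (0 : ℝ) ≤ mult w)]
  exact le_mul_of_one_le_left (abs_nonneg _) (one_le_mult_real w)

lemma norm_ne_zero_of_weight_ne_zero {x : mixedSpace K} (h : weight K x ≠ 0) :
    mixedEmbedding.norm x ≠ 0 := by
  intro h0
  exact h (by rw [weight, if_pos h0])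

lemma weight_eq {x : mixedSpace K} (h : mixedEmbedding.norm x ≠ 0) :
    weight K x = ∏ i, tent (coord K x i) := by
  rw [weight, if_neg h]

variable (K) in
lemma exists_abs_logMap_le : ∃ B : ℝ, ∀ x : mixedSpace K, weight K x ≠ 0 →
    ∀ w, |logMap x w| ≤ B := by
  let b := (basisUnitLattice K).ofZLatticeBasis ℝ _
  refine ⟨∑ i, ‖b i‖, fun x hx w ↦ ?_⟩
  have h0 := norm_ne_zero_of_weight_ne_zero hx
  rw [weight_eq h0, Finset.prod_ne_zero_iff] at hx
  have h1 : logMap x = ∑ i, coord K x i • b i := (b.sum_equivFun (logMap x)).symm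
  rw [h1, Finset.sum_apply]
  refine (Finset.abs_sum_le_sum_abs _ _).trans (Finset.sum_le_sum fun i _ ↦ ?_)
  rw [Pi.smul_apply, smul_eq_mul, abs_mul]
  calc |coord K x i| * |b i w| ≤ 1 * ‖b i‖ := by
        gcongr
        · exact (abs_lt_one_of_tent_ne_zero (hx i (Finset.mem_univ i))).le
        · exact norm_le_pi_norm (b i) w
    _ = _ := one_mul _

lemma normAtPlace_le_norm (w : InfinitePlace K) (x : mixedSpace K) : normAtPlace w x ≤ ‖x‖ := by
  rw [norm_eq_sup'_normAtPlace]
  exact Finset.le_sup' (fun w ↦ normAtPlace w x) (Finset.mem_univ w)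

lemma exists_normAtPlace_eq_norm (x : mixedSpace K) : ∃ w, ‖x‖ = normAtPlace w x := by
  rw [norm_eq_sup'_normAtPlace]
  obtain ⟨w, -, hw⟩ := Finset.exists_mem_eq_sup' Finset.univ_nonempty fun w ↦ normAtPlace w x
  exact ⟨w, hw⟩

lemma normAtPlace_sub_le (w : InfinitePlace K) (x y : mixedSpace K) :
    normAtPlace w x - normAtPlace w y ≤ ‖x - y‖ := by
  have := normAtPlace_add_le w (x - y) y
  rw [sub_add_cancel] at this
  linarith [normAtPlace_le_norm w (x - y)]

variable (K) in
/-- The cone of points all of whose coordinates are comparable to the norm. -/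
def cone (c : ℝ) : Set (mixedSpace K) := {x | ∀ w, c * ‖x‖ ≤ normAtPlace w x}

variable (K) in
lemma exists_cone : ∃ c : ℝ, 0 < c ∧ ∀ x : mixedSpace K, weight K x ≠ 0 → x ∈ cone K c := by
  obtain ⟨B, hB⟩ := exists_abs_logMap_le K
  set B' := (1 + Fintype.card (InfinitePlace K)) * |B|
  refine ⟨Real.exp (-(2 * B')), Real.exp_pos _, fun x hx w ↦ ?_⟩
  have h0 := norm_ne_zero_of_weight_ne_zero hx
  have hpos : ∀ w, 0 < normAtPlace w x := fun w ↦
    lt_of_le_of_ne (normAtPlace_nonneg _ _) (mixedEmbedding.norm_ne_zero_iff.mp h0 w).symm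
  obtain ⟨v, hv⟩ := exists_normAtPlace_eq_norm x
  have h1 := abs_le.mp (abs_log_sub_le_of_abs_logMap_le h0 (hB x hx) w)
  have h2 := abs_le.mp (abs_log_sub_le_of_abs_logMap_le h0 (hB x hx) v)
  rw [hv, ← Real.exp_log (hpos v), ← Real.exp_log (hpos w), ← Real.exp_add]
  gcongr
  linarith [h1.1, h2.2]

lemma abs_log_sub_log_le {m a b : ℝ} (hm : 0 < m) (ha : m ≤ a) (hb : m ≤ b) :
    |Real.log a - Real.log b| ≤ |a - b| / m := by
  have ha0 := hm.trans_le ha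
  have hb0 := hm.trans_le hb
  rw [abs_le]
  constructor
  · have h1 : Real.log b - Real.log a ≤ (b - a) / a := by
      rw [← Real.log_div hb0.ne' ha0.ne']
      refine (Real.log_le_sub_one_of_pos (div_pos hb0 ha0)).trans_eq ?_
      field_simp
    have h2 : (b - a) / a ≤ |a - b| / m := by
      rw [abs_sub_comm]
      gcongr
      exact le_abs_self _
    linarith
  · have h1 : Real.log a - Real.log b ≤ (a - b) / b := by
      rw [← Real.log_div ha0.ne' hb0.ne']
      refine (Real.log_le_sub_one_of_pos (div_pos ha0 hb0)).trans_eq ?_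
      field_simp
    have h2 : (a - b) / b ≤ |a - b| / m := by
      gcongr
      exact le_abs_self _
    linarith

variable (K) in
/-- Comparison of the norm and the weight at nearby points. -/
lemma exists_weight_comparison {D : ℝ} (hD : 0 ≤ D) :
    ∃ c R C : ℝ, 0 < c ∧ 0 < R ∧ 0 < C ∧ ∀ x y : mixedSpace K, ‖x - y‖ ≤ D → R ≤ ‖y‖ →
      (weight K x ≠ 0 ∨ weight K y ≠ 0) →
      y ∈ cone K c ∧ 0 < mixedEmbedding.norm x ∧ 0 < mixedEmbedding.norm y ∧
      |Real.log (mixedEmbedding.norm x) - Real.log (mixedEmbedding.norm y)| ≤ C / ‖y‖ ∧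
      |weight K x - weight K y| ≤ C / ‖y‖ := by
  obtain ⟨c, hc, hcone⟩ := exists_cone K
  have hc1 : c / 2 < c := by linarith
  set f := LinearMap.toContinuousLinearMap
    ((basisUnitLattice K).ofZLatticeBasis ℝ _).equivFun.toLinearMap with hf
  set C1 := 4 * D / c
  have hC1 : 0 ≤ C1 := by positivity
  have hd := finrank_pos_real (K := K)
  refine ⟨c / 2, max 1 (4 * D * (1 + c⁻¹)),
    1 + (Module.finrank ℚ K : ℝ) * C1 + (Fintype.card (Fin (rank K))) * (‖f‖ *
        ((Module.finrank ℚ K : ℝ) * (2 * C1))), by positivity,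
    by positivity, by positivity, fun x y hxy hR hor ↦ ?_⟩
  have hy0 : 0 < ‖y‖ := (lt_max_of_lt_left one_pos).trans_le hR
  have hyD : 4 * D ≤ ‖y‖ * 1 := by
    have : 4 * D * (1 + c⁻¹) ≤ ‖y‖ := (le_max_right _ _).trans hR
    have : 0 ≤ D * c⁻¹ := by positivity
    nlinarith
  have hyDc : 4 * D ≤ c * ‖y‖ := by
    have h1 : 4 * D * (1 + c⁻¹) ≤ ‖y‖ := (le_max_right _ _).trans hR
    have h2 : c * (4 * D * (1 + c⁻¹)) ≤ c * ‖y‖ := by gcongr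
    have h3 : c * (4 * D * (1 + c⁻¹)) = 4 * D * c + 4 * D := by field_simp
    have : 0 ≤ 4 * D * c := by positivity
    linarith
  have hsub : ∀ w, |normAtPlace w x - normAtPlace w y| ≤ D := fun w ↦ by
    rw [abs_le]
    have h1 := normAtPlace_sub_le w x y
    have h2 := normAtPlace_sub_le w y x
    rw [norm_sub_rev] at h2
    constructor <;> linarith
  have hycone : y ∈ cone K (c / 2) := by
    intro w
    rcases hor with h | h
    · have h1 := hcone x h w
      have h2 : ‖y‖ - D ≤ ‖x‖ := by
        have := norm_sub_norm_le y x
        rw [norm_sub_rev] at this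
        linarith
      have h3 := abs_le.mp (hsub w)
      have hcl : c ≤ 1 := by
        obtain ⟨v, hv⟩ := exists_normAtPlace_eq_norm x
        have hx0 : 0 < ‖x‖ := by linarith
        have := hcone x h v
        rw [← hv] at this
        nlinarith
      nlinarith [h3.2, hc, h2]
    · have := hcone y h w
      nlinarith
  have hmy : ∀ w, c / 4 * ‖y‖ ≤ normAtPlace w y := fun w ↦ by
    have := hycone w
    nlinarith
  have hmx : ∀ w, c / 4 * ‖y‖ ≤ normAtPlace w x := fun w ↦ by
    have h1 := hycone w
    have h2 := abs_le.mp (hsub w)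
    nlinarith [h2.1]
  have hm : 0 < c / 4 * ‖y‖ := by positivity
  have hNx : 0 < mixedEmbedding.norm x := by
    rw [mixedEmbedding.norm_apply]
    exact Finset.prod_pos fun w _ ↦ pow_pos (hm.trans_le (hmx w)) _
  have hNy : 0 < mixedEmbedding.norm y := by
    rw [mixedEmbedding.norm_apply]
    exact Finset.prod_pos fun w _ ↦ pow_pos (hm.trans_le (hmy w)) _
  have hlog : ∀ w, |Real.log (normAtPlace w x) - Real.log (normAtPlace w y)| ≤ C1 / ‖y‖ := by
    intro w
    refine (abs_log_sub_log_le hm (hmx w) (hmy w)).trans ?_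
    rw [div_le_div_iff₀ hm hy0]
    have : C1 * (c / 4 * ‖y‖) = D * ‖y‖ := by simp only [C1]; field_simp
    rw [this]
    exact mul_le_mul_of_nonneg_right (hsub w) hy0.le
  have hlogN : |Real.log (mixedEmbedding.norm x) - Real.log (mixedEmbedding.norm y)| ≤
      (Module.finrank ℚ K : ℝ) * (C1 / ‖y‖) := by
    rw [log_norm_eq_sum hNx.ne', log_norm_eq_sum hNy.ne', ← Finset.sum_sub_distrib,
      ← sum_mult_real, Finset.sum_mul]
    refine (Finset.abs_sum_le_sum_abs _ _).trans (Finset.sum_le_sum fun w _ ↦ ?_)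
    rw [← mul_sub, abs_mul, abs_of_nonneg (by linarith [one_le_mult_real w])]
    gcongr
    exact hlog w
  have hmult : ∀ w : InfinitePlace K, (mult w : ℝ) ≤ (Module.finrank ℚ K : ℝ) := fun w ↦ by
    rw [← sum_mult_real]
    exact Finset.single_le_sum (f := fun w : InfinitePlace K ↦ (mult w : ℝ))
      (fun w _ ↦ by linarith [one_le_mult_real w]) (Finset.mem_univ w)
  have hmap : ‖logMap x - logMap y‖ ≤ (Module.finrank ℚ K : ℝ) * (2 * (C1 / ‖y‖)) := by
    rw [pi_norm_le_iff_of_nonneg (by positivity)]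
    intro w
    rw [Pi.sub_apply, logMap_apply, logMap_apply, ← mul_sub, Real.norm_eq_abs, abs_mul,
      abs_of_nonneg (by linarith [one_le_mult_real w.1])]
    gcongr
    · exact_mod_cast hmult w.1
    · rw [sub_sub_sub_comm, ← sub_mul]
      refine (abs_sub _ _).trans ?_
      rw [abs_mul, abs_of_nonneg (by positivity : (0 : ℝ) ≤ ((Module.finrank ℚ K : ℝ))⁻¹)]
      have : |Real.log (mixedEmbedding.norm x) - Real.log (mixedEmbedding.norm y)| *
          ((Module.finrank ℚ K : ℝ))⁻¹ ≤
          C1 / ‖y‖ := by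
        rw [← div_eq_mul_inv, div_le_iff₀ hd, mul_comm]
        exact hlogN
      linarith [hlog w.1]
  have hcoord : ∀ i, |coord K x i - coord K y i| ≤ ‖f‖ * ((Module.finrank ℚ K : ℝ) * (2 *
      (C1 / ‖y‖))) := by
    intro i
    have h1 : coord K x - coord K y = f (logMap x - logMap y) := by
      rw [map_sub]; rfl
    rw [← Pi.sub_apply, h1]
    refine (norm_le_pi_norm (f (logMap x - logMap y)) i).trans ?_
    refine (f.le_opNorm _).trans ?_
    gcongr
  refine ⟨hycone, hNx, hNy, hlogN.trans ?_, ?_⟩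
  · rw [← mul_div_assoc]
    gcongr
    have : 0 ≤ (Fintype.card (Fin (rank K))) * (‖f‖ * ((Module.finrank ℚ K : ℝ) * (2 * C1))) :=
        by positivity
    linarith
  · rw [weight_eq hNx.ne', weight_eq hNy.ne']
    refine (abs_prod_sub_prod_le _ (fun i ↦ tent_nonneg _) (fun i ↦ tent_le_one _)
      (fun i ↦ tent_nonneg _) (fun i ↦ tent_le_one _)).trans ?_
    refine (Finset.sum_le_sum fun i _ ↦ (abs_tent_sub_le _ _).trans (hcoord i)).trans ?_
    rw [Finset.sum_const, nsmul_eq_mul, Finset.card_univ]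
    have h2 : 0 ≤ 1 + (Module.finrank ℚ K : ℝ) * C1 := by positivity
    calc (Fintype.card (Fin (rank K))) * (‖f‖ * ((Module.finrank ℚ K : ℝ) * (2 * (C1 / ‖y‖))))
        = (Fintype.card (Fin (rank K))) * (‖f‖ * ((Module.finrank ℚ K : ℝ) * (2 * C1))) / ‖y‖ :=
            by ring
      _ ≤ _ := by gcongr; linarith

end geometry

end IdealCount

namespace IdealCount

section cell

open MeasureTheory
open scoped ENNReal

/-- Comparison of a sum over a lattice with an integral. -/
lemma tsum_lattice_comparison {E : Type*} [NormedAddCommGroup E] [MeasurableSpace E] [BorelSpace E]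
    {μ : Measure E} {Λ : AddSubgroup E} [Countable Λ] [VAddInvariantMeasure Λ E μ]
    [MeasurableVAdd Λ E] {F : Set E}
    (hF : IsAddFundamentalDomain Λ F μ) (hFm : MeasurableSet F) {D : ℝ}
    (hD : ∀ z ∈ F, ‖z‖ ≤ D) {H Err : E → ℝ≥0∞} (hH : Measurable H)
    (h1 : ∀ x y, ‖x - y‖ ≤ D → H x ≤ H y + Err y) (h2 : ∀ x y, ‖x - y‖ ≤ D → H y ≤ H x + Err y) :
    (∑' a : Λ, H a) * μ F ≤ ∫⁻ x, H x ∂μ + ∫⁻ x, Err x ∂μ ∧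
      ∫⁻ x, H x ∂μ ≤ (∑' a : Λ, H a) * μ F + ∫⁻ x, Err x ∂μ := by
  have hs : (∑' a : Λ, H a) * μ F = ∑' a : Λ, ∫⁻ x in F, H a ∂μ := by
    simp_rw [setLIntegral_const]
    rw [ENNReal.tsum_mul_right]
  have hn : ∀ (a : Λ), ∀ z ∈ F, ‖(a : E) - (a +ᵥ z)‖ ≤ D := by
    intro a z hz
    rw [AddSubgroup.vadd_def, vadd_eq_add, sub_add_cancel_left, norm_neg]
    exact hD z hz
  have hm : ∀ a : Λ, Measurable fun x : E ↦ a +ᵥ x := fun a ↦ measurable_const_vadd a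
  rw [hF.lintegral_eq_tsum'' H, hF.lintegral_eq_tsum'' Err, hs, ← ENNReal.tsum_add,
    ← ENNReal.tsum_add]
  constructor
  · refine ENNReal.tsum_le_tsum fun a ↦ ?_
    rw [← lintegral_add_left (f := fun x ↦ H (a +ᵥ x)) (hH.comp (hm a))]
    exact setLIntegral_mono' hFm fun z hz ↦ h1 _ _ (hn a z hz)
  · refine ENNReal.tsum_le_tsum fun a ↦ ?_
    rw [← lintegral_add_left measurable_const]
    exact setLIntegral_mono' hFm fun z hz ↦ h2 _ _ (hn a z hz)

lemma lintegral_comp_inv_smul {E : Type*} [NormedAddCommGroup E] [NormedSpace ℝ E]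
    [FiniteDimensional ℝ E] [MeasurableSpace E] [BorelSpace E] (μ : Measure E)
    [μ.IsAddHaarMeasure] {r : ℝ} (hr : 0 < r) {f : E → ℝ≥0∞} (hf : Measurable f) :
    ∫⁻ x, f (r⁻¹ • x) ∂μ = ENNReal.ofReal (r ^ Module.finrank ℝ E) * ∫⁻ x, f x ∂μ := by
  rw [← lintegral_map hf (measurable_const_smul r⁻¹),
    Measure.map_addHaar_smul μ (inv_ne_zero hr.ne'), lintegral_smul_measure]
  rw [inv_pow, inv_inv, abs_of_pos (pow_pos hr _), smul_eq_mul]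

end cell

open NumberField.mixedEmbedding NumberField.Units NumberField.Units.dirichletUnitTheorem
open NumberField.InfinitePlace
open fundamentalCone MeasureTheory
open scoped Classical ENNReal nonZeroDivisors

section

variable {K : Type*} [Field K] [NumberField K]

variable (K) in
/-- The weight cut off at norm `t`. -/
noncomputable def cutWeight (t : ℝ) : mixedSpace K → ℝ≥0∞ :=
  Set.indicator {x : mixedSpace K | mixedEmbedding.norm x ≤ t} fun x ↦ ENNReal.ofReal (weight K x)

variable (K) in
lemma measurable_coord : Measurable (coord K) := by
  have h1 : Measurable (logMap : mixedSpace K → _) := by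
    unfold logMap
    refine measurable_pi_iff.mpr fun w ↦ measurable_const.mul ?_
    exact (continuous_normAtPlace _).measurable.log.sub <|
      (mixedEmbedding.continuous_norm _).measurable.log.mul measurable_const
  exact (LinearMap.continuous_of_finiteDimensional
    ((basisUnitLattice K).ofZLatticeBasis ℝ _).equivFun.toLinearMap).measurable.comp h1

lemma measurable_tent : Measurable tent := by
  unfold tent
  fun_prop

variable (K) in
lemma measurable_weight : Measurable (weight K) := by
  have : weight K = fun x ↦ if mixedEmbedding.norm x = 0 then 0 else ∏ i, tent (coord K x i) := by
    ext x; simp only [weight]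
  rw [this]
  refine Measurable.ite
    (measurableSet_eq_fun (mixedEmbedding.continuous_norm K).measurable measurable_const)
    measurable_const ?_
  exact Finset.measurable_prod _ fun i _ ↦
    measurable_tent.comp ((measurable_pi_apply i).comp (measurable_coord K))

lemma measurableSet_norm_le (t : ℝ) :
    MeasurableSet {x : mixedSpace K | mixedEmbedding.norm x ≤ t} :=
  measurableSet_le (mixedEmbedding.continuous_norm K).measurable measurable_const

variable (K) in
lemma measurable_cutWeight (t : ℝ) : Measurable (cutWeight K t) :=
  (measurable_weight K).ennreal_ofReal.indicator (measurableSet_norm_le t)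

lemma weight_smul {r : ℝ} (hr : r ≠ 0) (x : mixedSpace K) : weight K (r • x) = weight K x := by
  by_cases hx : mixedEmbedding.norm x = 0
  · rw [weight, weight, if_pos hx, if_pos (by rw [mixedEmbedding.norm_smul, hx, mul_zero])]
  · have : mixedEmbedding.norm (r • x) ≠ 0 := by
      rw [mixedEmbedding.norm_smul]
      exact mul_ne_zero (pow_ne_zero _ (abs_ne_zero.mpr hr)) hx
    rw [weight_eq hx, weight_eq this, coord, logMap_real_smul hx hr, coord]

variable (K) in
/-- The part of the cone where the norm is at most `t`. -/
def cutCone (c t : ℝ) : Set (mixedSpace K) := cone K c ∩ {x | mixedEmbedding.norm x ≤ t}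

variable (K) in
lemma measurableSet_cutCone (c t : ℝ) : MeasurableSet (cutCone K c t) := by
  refine MeasurableSet.inter ?_ (measurableSet_norm_le t)
  have : cone K c = ⋂ w, {x : mixedSpace K | c * ‖x‖ ≤ normAtPlace w x} := by
    ext x; simp [cone]
  rw [this]
  exact MeasurableSet.iInter fun w ↦ measurableSet_le (measurable_norm.const_mul c)
    (continuous_normAtPlace w).measurable

lemma norm_inv_smul_le {r t : ℝ} (hr : 0 < r) (x : mixedSpace K) :
    mixedEmbedding.norm (r⁻¹ • x) ≤ t ↔
      mixedEmbedding.norm x ≤ r ^ Module.finrank ℚ K * t := by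
  rw [mixedEmbedding.norm_smul, abs_of_pos (inv_pos.mpr hr), inv_pow,
      inv_mul_le_iff₀ (pow_pos hr _)]

lemma cutWeight_inv_smul {r t : ℝ} (hr : 0 < r) (x : mixedSpace K) :
    cutWeight K t (r⁻¹ • x) = cutWeight K (r ^ Module.finrank ℚ K * t) x := by
  simp only [cutWeight, Set.indicator, Set.mem_ofPred_eq, norm_inv_smul_le hr,
    weight_smul (inv_ne_zero hr.ne')]

lemma inv_smul_mem_cutCone {c r t : ℝ} (hr : 0 < r) (x : mixedSpace K) :
    r⁻¹ • x ∈ cutCone K c t ↔ x ∈ cutCone K c (r ^ Module.finrank ℚ K * t) := by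
  simp only [cutCone, Set.mem_inter_iff, Set.mem_ofPred_eq, norm_inv_smul_le hr, cone]
  refine and_congr_left fun _ ↦ forall_congr' fun w ↦ ?_
  rw [normAtPlace_smul, _root_.norm_smul, Real.norm_eq_abs, mul_left_comm]
  exact mul_le_mul_iff_right₀ (abs_pos.mpr (inv_ne_zero hr.ne'))

lemma exists_pow_eq {t : ℝ} (ht : 0 < t) : ∃ r, 0 < r ∧ r ^ Module.finrank ℚ K = t :=
  ⟨t ^ ((Module.finrank ℚ K : ℝ))⁻¹, Real.rpow_pos_of_pos ht _, by
    rw [← Real.rpow_natCast, ← Real.rpow_mul ht.le, inv_mul_cancel₀ finrank_pos_real.ne',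
      Real.rpow_one]⟩

lemma lintegral_cutWeight {t : ℝ} (ht : 0 < t) :
    ∫⁻ x, cutWeight K t x = ENNReal.ofReal t * ∫⁻ x, cutWeight K 1 x := by
  obtain ⟨r, hr, rfl⟩ := exists_pow_eq (K := K) ht
  have := lintegral_comp_inv_smul volume hr (measurable_cutWeight K 1)
  rw [mixedEmbedding.finrank] at this
  rw [← this]
  simp_rw [cutWeight_inv_smul hr, mul_one]

lemma volume_cutCone (c : ℝ) {t : ℝ} (ht : 0 < t) :
    volume (cutCone K c t) = ENNReal.ofReal t * volume (cutCone K c 1) := by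
  obtain ⟨r, hr, rfl⟩ := exists_pow_eq (K := K) ht
  rw [← lintegral_indicator_one (measurableSet_cutCone K c _),
    ← lintegral_indicator_one (measurableSet_cutCone K c _)]
  have := lintegral_comp_inv_smul volume hr
    (measurable_one.indicator (measurableSet_cutCone K c 1) : Measurable
      (Set.indicator (cutCone K c 1) (1 : mixedSpace K → ℝ≥0∞)))
  rw [mixedEmbedding.finrank] at this
  rw [← this]
  refine lintegral_congr fun x ↦ ?_
  simp only [Set.indicator, inv_smul_mem_cutCone hr, mul_one]
  rfl

lemma volume_cutCone_ne_top {c : ℝ} (hc : 0 < c) : volume (cutCone K c 1) ≠ ∞ := by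
  refine (Bornology.IsBounded.measure_lt_top (isBounded_iff_forall_norm_le.mpr
    ⟨c⁻¹, fun x hx ↦ ?_⟩)).ne
  obtain ⟨h1, h2⟩ := hx
  rw [Set.mem_ofPred_eq, mixedEmbedding.norm_apply] at h2
  have h3 : (c * ‖x‖) ^ Module.finrank ℚ K ≤ 1 := by
    refine le_trans ?_ h2
    rw [← sum_mult_eq, ← Finset.prod_pow_eq_pow_sum]
    exact Finset.prod_le_prod (fun w _ ↦ by positivity) fun w _ ↦
      pow_le_pow_left₀ (by positivity) (h1 w) _
  have h4 : c * ‖x‖ ≤ 1 := by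
    by_contra! h
    exact absurd h3 (not_le.mpr (one_lt_pow₀ h Module.finrank_pos.ne'))
  rw [← one_div, le_div_iff₀ hc]
  linarith

variable (K) in
lemma lintegral_cutWeight_one_ne_top : ∫⁻ x, cutWeight K 1 x ≠ ∞ := by
  obtain ⟨c, hc, h⟩ := exists_cone K
  refine ne_top_of_le_ne_top (volume_cutCone_ne_top (K := K) hc) ?_
  rw [← lintegral_indicator_one (measurableSet_cutCone K c _)]
  refine lintegral_mono fun x ↦ ?_
  by_cases hx : mixedEmbedding.norm x ≤ 1
  · by_cases h0 : weight K x = 0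
    · rw [cutWeight, Set.indicator_of_mem (by exact hx), h0, ENNReal.ofReal_zero]
      exact zero_le
    · rw [cutWeight, Set.indicator_of_mem (by exact hx), Set.indicator_of_mem (s :=
        cutCone K c 1) ⟨h x h0, hx⟩]
      exact ENNReal.ofReal_le_one.mpr (weight_le_one x)
  · rw [cutWeight, Set.indicator_of_notMem (by exact hx)]
    exact zero_le

variable (K) in
/-- The error term in the comparison of `cutWeight` at nearby points. -/
noncomputable def errWeight (c S C t : ℝ) : mixedSpace K → ℝ≥0∞ :=
  (Metric.closedBall 0 S).indicator 1 +
    (cutCone K c t).indicator (fun _ ↦ ENNReal.ofReal (C / S)) +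
    (cutCone K c (t * Real.exp (C / S)) \ cutCone K c (t * Real.exp (-(2 * (C / S))))).indicator 1

lemma cutWeight_le_one (t : ℝ) (x : mixedSpace K) : cutWeight K t x ≤ 1 :=
  (Set.indicator_le_self _ _ x).trans (ENNReal.ofReal_le_one.mpr (weight_le_one x))

lemma cutWeight_eq_zero_of_weight {t : ℝ} {x : mixedSpace K} (h : weight K x = 0) :
    cutWeight K t x = 0 := by
  simp [cutWeight, Set.indicator, h]

lemma cutWeight_of_le {t : ℝ} {x : mixedSpace K} (h : mixedEmbedding.norm x ≤ t) :
    cutWeight K t x = ENNReal.ofReal (weight K x) :=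
  Set.indicator_of_mem (by exact h) _

lemma cutWeight_of_lt {t : ℝ} {x : mixedSpace K} (h : t < mixedEmbedding.norm x) :
    cutWeight K t x = 0 :=
  Set.indicator_of_notMem (by exact not_le.mpr h) _

variable (K) in
lemma exists_cutWeight_comparison {D : ℝ} (hD : 0 ≤ D) :
    ∃ c R C : ℝ, 0 < c ∧ 0 < R ∧ 0 < C ∧ ∀ S, R ≤ S → ∀ t, 0 < t → ∀ x y : mixedSpace K,
      ‖x - y‖ ≤ D → cutWeight K t x ≤ cutWeight K t y + errWeight K c S C t y ∧
        cutWeight K t y ≤ cutWeight K t x + errWeight K c S C t y := by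
  obtain ⟨c, R, C, hc, hR, hC, h⟩ := exists_weight_comparison K hD
  refine ⟨c, R, C, hc, hR, hC, fun S hS t ht x y hxy ↦ ?_⟩
  have hS0 : 0 < S := hR.trans_le hS
  have hδ : 0 < C / S := by positivity
  have of_one : 1 ≤ errWeight K c S C t y →
      cutWeight K t x ≤ cutWeight K t y + errWeight K c S C t y ∧
        cutWeight K t y ≤ cutWeight K t x + errWeight K c S C t y := fun h1 ↦
    ⟨(cutWeight_le_one t x).trans (h1.trans le_add_self),
      (cutWeight_le_one t y).trans (h1.trans le_add_self)⟩
  by_cases hyS : ‖y‖ ≤ S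
  · apply of_one
    rw [errWeight, Pi.add_apply, Pi.add_apply, Set.indicator_of_mem (by simpa using hyS), add_assoc]
    exact le_self_add
  push Not at hyS
  by_cases hw : weight K x ≠ 0 ∨ weight K y ≠ 0
  swap
  · push Not at hw
    rw [cutWeight_eq_zero_of_weight hw.1, cutWeight_eq_zero_of_weight hw.2]
    exact ⟨zero_le, zero_le⟩
  obtain ⟨h1, h2, h3, h4, h5⟩ := h x y hxy (hS.trans hyS.le) hw
  have hCS : C / ‖y‖ ≤ C / S := by gcongr
  replace h4 := abs_le.mp (h4.trans hCS)
  replace h5 := abs_le.mp (h5.trans hCS)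
  by_cases hx : mixedEmbedding.norm x ≤ t <;> by_cases hy : mixedEmbedding.norm y ≤ t
  · have : ENNReal.ofReal (C / S) ≤ errWeight K c S C t y := by
      rw [errWeight, Pi.add_apply, Pi.add_apply, Set.indicator_of_mem (s := cutCone K c t) ⟨h1, hy⟩]
      exact le_add_self.trans le_self_add
    rw [cutWeight_of_le hx, cutWeight_of_le hy]
    constructor
    · refine le_trans ?_ (add_le_add_right this _)
      rw [← ENNReal.ofReal_add (weight_nonneg _) hδ.le]
      exact ENNReal.ofReal_le_ofReal (by linarith)
    · refine le_trans ?_ (add_le_add_right this _)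
      rw [← ENNReal.ofReal_add (weight_nonneg _) hδ.le]
      exact ENNReal.ofReal_le_ofReal (by linarith)
  · apply of_one
    push Not at hy
    rw [errWeight, Pi.add_apply, Set.indicator_of_mem (s := _ \ _)]
    · exact le_add_self
    have hl := Real.log_le_log h2 hx
    refine ⟨⟨h1, ?_⟩, fun h' ↦ ?_⟩
    · rw [Set.mem_ofPred_eq, ← Real.log_le_log_iff h3 (by positivity),
        Real.log_mul ht.ne' (Real.exp_ne_zero _), Real.log_exp]
      linarith
    · have h'' := h'.2
      rw [Set.mem_ofPred_eq] at h''
      have : t * Real.exp (-(2 * (C / S))) ≤ t * 1 := by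
        gcongr
        exact Real.exp_le_one_iff.mpr (by linarith)
      linarith
  · apply of_one
    push Not at hx
    rw [errWeight, Pi.add_apply, Set.indicator_of_mem (s := _ \ _)]
    · exact le_add_self
    have hl := Real.log_le_log ht hx.le
    refine ⟨⟨h1, ?_⟩, fun h' ↦ ?_⟩
    · refine hy.trans ?_
      exact le_mul_of_one_le_right ht.le (Real.one_le_exp hδ.le)
    · have h'' := h'.2
      rw [Set.mem_ofPred_eq, ← Real.log_le_log_iff h3 (by positivity),
        Real.log_mul ht.ne' (Real.exp_ne_zero _), Real.log_exp] at h''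
      linarith
  · push Not at hx hy
    rw [cutWeight_of_lt hx, cutWeight_of_lt hy]
    exact ⟨zero_le, zero_le⟩

lemma lintegral_errWeight {c S C t : ℝ} (hc : 0 < c) (hS : 0 < S) (hC : 0 < C) (ht : 0 < t) :
    ∫⁻ x, errWeight K c S C t x ≤ ENNReal.ofReal
      (S ^ Module.finrank ℚ K * (volume (Metric.ball (0 : mixedSpace K) 1)).toReal +
        t * (C / S) * (volume (cutCone K c 1)).toReal * (Real.exp (C / S) + 3)) := by
  have hδ : 0 < C / S := by positivity
  set δ := C / S with hδ_def
  have hV := volume_cutCone_ne_top (K := K) hc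
  have hB : volume (Metric.ball (0 : mixedSpace K) 1) ≠ ∞ := Metric.isBounded_ball.measure_lt_top.ne
  set V := volume (cutCone K c 1)
  have hvol : ∀ {s : ℝ}, 0 < s → volume (cutCone K c s) = ENNReal.ofReal (s * V.toReal) := by
    intro s hs
    rw [volume_cutCone c hs, ENNReal.ofReal_mul hs.le, ENNReal.ofReal_toReal hV]
  have hexp : Real.exp δ ≤ 1 + δ * Real.exp δ := by
    have := Real.add_one_le_exp (-δ)
    have h2 : Real.exp δ * Real.exp (-δ) = 1 := by rw [← Real.exp_add]; simp
    nlinarith [Real.exp_pos δ]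
  have hexp2 : 1 - 2 * δ ≤ Real.exp (-(2 * δ)) := by linarith [Real.add_one_le_exp (-(2 * δ))]
  have e1 : ∫⁻ x, (Metric.closedBall (0 : mixedSpace K) S).indicator 1 x =
      ENNReal.ofReal (S ^ Module.finrank ℚ K *
          (volume (Metric.ball (0 : mixedSpace K) 1)).toReal) := by
    rw [lintegral_indicator_one Metric.isClosed_closedBall.measurableSet,
      Measure.addHaar_closedBall _ _ hS.le, mixedEmbedding.finrank,
      ENNReal.ofReal_mul (by positivity), ENNReal.ofReal_toReal hB]
  have e2 : ∫⁻ x, (cutCone K c t).indicator (fun _ ↦ ENNReal.ofReal δ) x =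
      ENNReal.ofReal (δ * (t * V.toReal)) := by
    rw [lintegral_indicator_const (measurableSet_cutCone K c t), hvol ht,
      ENNReal.ofReal_mul hδ.le]
  have e3 : ∫⁻ x, (cutCone K c (t * Real.exp δ) \ cutCone K c (t * Real.exp (-(2 *
      δ)))).indicator 1 x
      ≤ ENNReal.ofReal (t * V.toReal * (δ * Real.exp δ + 2 * δ)) := by
    rw [lintegral_indicator_one ((measurableSet_cutCone K c _).diff (measurableSet_cutCone K c _)),
      measure_sdiff _ (measurableSet_cutCone K c _).nullMeasurableSet, hvol (by positivity),
      hvol (by positivity)]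
    · rw [← ENNReal.ofReal_sub _ (by positivity)]
      apply ENNReal.ofReal_le_ofReal
      have : 0 ≤ t * V.toReal := by positivity
      nlinarith
    · rw [hvol (by positivity)]
      exact ENNReal.ofReal_ne_top
    · rintro x ⟨hx1, hx2⟩
      refine ⟨hx1, ?_⟩
      change mixedEmbedding.norm x ≤ _
      refine le_trans hx2 ?_
      gcongr
      linarith
  simp only [errWeight, Pi.add_apply]
  rw [lintegral_add_left, lintegral_add_left, e1, e2]
  · refine (add_le_add_right e3 _).trans ?_
    rw [← ENNReal.ofReal_add (by positivity) (by positivity),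
      ← ENNReal.ofReal_add (by positivity) (by positivity)]
    apply ENNReal.ofReal_le_ofReal
    apply le_of_eq
    ring
  · exact measurable_one.indicator Metric.isClosed_closedBall.measurableSet
  · exact (measurable_one.indicator Metric.isClosed_closedBall.measurableSet).add
      (measurable_const.indicator (measurableSet_cutCone K c t))

end

end IdealCount

namespace IdealCount

open NumberField.mixedEmbedding NumberField.Units NumberField.Units.dirichletUnitTheorem
open NumberField.InfinitePlace
open fundamentalCone MeasureTheory
open scoped Classical ENNReal nonZeroDivisors

section

variable {K : Type*} [Field K] [NumberField K]

lemma exists_abs_card_idealSet_sub_le (J : (Ideal (𝓞 K))⁰) : ∃ κ C : ℝ, ∀ t : ℝ, 1 ≤ t →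
    |(Nat.card {a : idealSet K J // mixedEmbedding.norm (a : mixedSpace K) ≤ t} : ℝ) - κ * t| ≤
      C * t ^ (1 - 1 / (2 * (Module.finrank ℚ K : ℝ))) := by
  have hd := finrank_pos_real (K := K)
  have hd1 : 1 ≤ (Module.finrank ℚ K : ℝ) := by exact_mod_cast Module.finrank_pos (R := ℚ) (M := K)
  set I := FractionalIdeal.mk0 K J
  let Λ := (mixedEmbedding.idealLattice K I).toAddSubgroup
  let F := ZSpan.fundamentalDomain (fractionalIdealLatticeBasis K I)
  have hF : IsAddFundamentalDomain Λ F := fundamentalDomain_idealLattice K I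
  have hFm : MeasurableSet F := ZSpan.fundamentalDomain_measurableSet _
  have hF0 : volume F ≠ 0 := ZSpan.measure_fundamentalDomain_ne_zero _
  have hFt : volume F ≠ ∞ := (ZSpan.fundamentalDomain_isBounded _).measure_lt_top.ne
  obtain ⟨D, hD⟩ := isBounded_iff_forall_norm_le.mp
    (ZSpan.fundamentalDomain_isBounded (fractionalIdealLatticeBasis K I))
  have hD' : ∀ z ∈ F, ‖z‖ ≤ |D| := fun z hz ↦ (hD z hz).trans (le_abs_self D)
  obtain ⟨c, R, C, hc, hR, hC, hcomp⟩ := exists_cutWeight_comparison K (abs_nonneg D)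
  have : Countable Λ :=
    inferInstanceAs (Countable (mixedEmbedding.idealLattice K I))
  set A := fun t : ℝ ↦
    (Nat.card {a : idealSet K J // mixedEmbedding.norm (a : mixedSpace K) ≤ t} : ℝ)
  set V := (∫⁻ x, cutWeight K 1 x).toReal
  set B := (volume (Metric.ball (0 : mixedSpace K) 1)).toReal
  set W := (volume (cutCone K c 1)).toReal
  set v := (volume F).toReal
  have hv : 0 < v := ENNReal.toReal_pos hF0 hFt
  have hW : 0 ≤ W := ENNReal.toReal_nonneg
  have hB : 0 ≤ B := ENNReal.toReal_nonneg
  set M := R ^ Module.finrank ℚ K * B + C / R * W * (Real.exp (C / R) + 3)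
  refine ⟨V / v, M / v, fun t ht ↦ ?_⟩
  have ht0 : 0 < t := by linarith
  set S := R * t ^ (1 / (2 * (Module.finrank ℚ K : ℝ)))
  have hS1 : 1 ≤ t ^ (1 / (2 * (Module.finrank ℚ K : ℝ))) := Real.one_le_rpow ht (by positivity)
  have hRS : R ≤ S := le_mul_of_one_le_right hR.le hS1
  have hS : 0 < S := by positivity
  obtain ⟨h1, h2⟩ := tsum_lattice_comparison hF hFm hD' (measurable_cutWeight K t)
    (fun x y h ↦ (hcomp S hRS t ht0 x y h).1) (fun x y h ↦ (hcomp S hRS t ht0 x y h).2)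
  have hsum : ∑' a : Λ, cutWeight K t a = _ := tsum_weight_eq_encard J t
  have hE : (S ^ Module.finrank ℚ K * B + t * (C / S) * W * (Real.exp (C / S) + 3)) ≤
      M * t ^ (1 - 1 / (2 * (Module.finrank ℚ K : ℝ))) := by
    have e1 : S ^ Module.finrank ℚ K ≤ R ^ Module.finrank ℚ K * t ^ (1 - 1 / (2 *
        (Module.finrank ℚ K : ℝ))) := by
      rw [mul_pow, ← Real.rpow_natCast (t ^ _), ← Real.rpow_mul ht0.le]
      gcongr
      field_simp
      linarith
    have e2 : t * (C / S) = C / R * t ^ (1 - 1 / (2 * (Module.finrank ℚ K : ℝ))) := by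
      rw [Real.rpow_sub ht0, Real.rpow_one]
      simp only [S]
      field_simp
    have e3 : Real.exp (C / S) ≤ Real.exp (C / R) := by gcongr
    rw [e2]
    calc _ ≤ R ^ Module.finrank ℚ K * t ^ (1 - 1 / (2 * (Module.finrank ℚ K : ℝ))) * B +
          C / R * t ^ (1 - 1 / (2 * (Module.finrank ℚ K : ℝ))) * W * (Real.exp (C / R) + 3) :=
              by gcongr
      _ = _ := by simp only [M]; ring
  have hErr := (lintegral_errWeight (K := K) hc hS hC ht0).trans (ENNReal.ofReal_le_ofReal hE)
  have hM : 0 ≤ M * t ^ (1 - 1 / (2 * (Module.finrank ℚ K : ℝ))) := by positivity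
  have hV := lintegral_cutWeight_one_ne_top K
  have hVt : ∫⁻ x, cutWeight K t x = ENNReal.ofReal (V * t) := by
    rw [lintegral_cutWeight ht0, mul_comm V, ENNReal.ofReal_mul ht0.le, ENNReal.ofReal_toReal hV]
  have hV0 : 0 ≤ V := ENNReal.toReal_nonneg
  rw [hsum, hVt] at h1 h2
  replace h1 := h1.trans (add_le_add_right hErr _)
  replace h2 := h2.trans (add_le_add_right hErr _)
  rw [← ENNReal.ofReal_add (by positivity) hM] at h1
  set N := ENat.card {a : idealSet K J // mixedEmbedding.norm (a : mixedSpace K) ≤ t} with hN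
  have hNt : N ≠ ⊤ := by
    intro h
    rw [h, ENat.toENNReal_top, ENNReal.top_mul hF0, top_le_iff] at h1
    exact ENNReal.ofReal_ne_top h1
  have hNA : (N : ℝ≥0∞) * volume F = ENNReal.ofReal (A t * v) := by
    have h3 : (Nat.card {a : idealSet K J // mixedEmbedding.norm (a : mixedSpace K) ≤ t} : ℕ∞) =
        N := by
      rw [Nat.card, Cardinal.toNat]
      exact ENat.natCast_toNat hNt
    rw [ENNReal.ofReal_mul (by positivity), ENNReal.ofReal_toReal hFt, ← h3]
    simp [A]
  have hA : 0 ≤ A t := by positivity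
  rw [hNA] at h1 h2
  rw [← ENNReal.ofReal_add (by positivity) hM] at h2
  rw [ENNReal.ofReal_le_ofReal_iff (by positivity)] at h1 h2
  have : |A t * v - V * t| ≤ M * t ^ (1 - 1 / (2 * (Module.finrank ℚ K : ℝ))) := by
    rw [abs_le]; constructor <;> linarith
  calc |A t - V / v * t| = |A t * v - V * t| / v := by
        rw [← abs_of_pos hv, ← abs_div, abs_of_pos hv]
        congr 1
        field_simp
    _ ≤ M * t ^ (1 - 1 / (2 * (Module.finrank ℚ K : ℝ))) / v := by gcongr
    _ = _ := by ring

lemma card_class_eq {C : ClassGroup (𝓞 K)} {J : (Ideal (𝓞 K))⁰} (hJ : ClassGroup.mk0 J = C⁻¹)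
    (s : ℝ) :
    Nat.card {I : (Ideal (𝓞 K))⁰ // Ideal.absNorm (I : Ideal (𝓞 K)) ≤ s ∧ ClassGroup.mk0 I = C}
      = Nat.card {I : (Ideal (𝓞 K))⁰ // (J : Ideal (𝓞 K)) ∣ I ∧
        Submodule.IsPrincipal (I : Ideal (𝓞 K)) ∧
        Ideal.absNorm (I : Ideal (𝓞 K)) ≤ s * Ideal.absNorm (J : Ideal (𝓞 K))} := by
  simp_rw [← nonZeroDivisors_dvd_iff_dvd_coe]
  refine Nat.card_congr ?_
  refine ((Equiv.dvd J).subtypeEquiv fun I ↦ ?_).trans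
    (Equiv.subtypeSubtypeEquivSubtypeInter (fun I : (Ideal (𝓞 K))⁰ ↦ J ∣ I) _)
  rw [← ClassGroup.mk0_eq_one_iff (SetLike.coe_mem _)]
  simp_rw [Equiv.dvd_apply, Submonoid.coe_mul, ← Submonoid.mul_def, _root_.map_mul, hJ,
    inv_mul_eq_one, Nat.cast_mul, mul_comm s, eq_comm, and_comm, and_congr_left_iff]
  exact fun _ ↦
    (mul_le_mul_iff_of_pos_left (Nat.cast_pos.mpr (Ideal.absNorm_pos_of_nonZeroDivisors J))).symm

lemma exists_abs_card_class_sub_le (C : ClassGroup (𝓞 K)) : ∃ κ M : ℝ, ∀ t : ℝ, 1 ≤ t →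
    |(Nat.card {I : (Ideal (𝓞 K))⁰ // Ideal.absNorm (I : Ideal (𝓞 K)) ≤ t ∧
      ClassGroup.mk0 I = C} : ℝ) - κ * t| ≤ M * t ^ (1 - 1 / (2 * (Module.finrank ℚ K : ℝ))) := by
  obtain ⟨J, hJ⟩ := ClassGroup.mk0_surjective C⁻¹
  obtain ⟨κ, M, h⟩ := exists_abs_card_idealSet_sub_le J
  set q : ℝ := ((Ideal.absNorm (J : Ideal (𝓞 K)) : ℕ) : ℝ) with hqdef
  have hq : 1 ≤ q := by
    have := Ideal.absNorm_pos_of_nonZeroDivisors J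
    rw [hqdef]
    exact_mod_cast this
  set w : ℝ := ((torsionOrder K : ℕ) : ℝ)
  have hw : 0 < w := Nat.cast_pos.mpr (torsionOrder_pos K)
  refine ⟨κ * q / w, M * q ^ (1 - 1 / (2 * (Module.finrank ℚ K : ℝ))) / w, fun t ht ↦ ?_⟩
  rw [card_class_eq hJ]
  have h1 := h (t * q) (one_le_mul_of_one_le_of_one_le ht hq)
  rw [← card_isPrincipal_dvd_norm_le, Nat.cast_mul, Real.mul_rpow (by linarith) (by linarith)] at h1
  generalize ((Nat.card {I : (Ideal (𝓞 K))⁰ // _} : ℕ) : ℝ) = A at h1 ⊢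
  calc |A - κ * q / w * t| = |A * w - κ * (t * q)| / w := by
        rw [← abs_of_pos hw, ← abs_div, abs_of_pos hw]
        congr 1
        field_simp
    _ ≤ M * (t ^ (1 - 1 / (2 * (Module.finrank ℚ K : ℝ))) * q ^ (1 - 1 / (2 *
        (Module.finrank ℚ K : ℝ)))) / w := by gcongr
    _ = _ := by ring

variable (K) in
/-- The number of nonzero ideals of norm at most `t`, up to a power saving. -/
theorem exists_abs_card_ideal_sub_le : ∃ κ M : ℝ, 0 < κ ∧ ∀ t : ℝ, 1 ≤ t →
    |(Nat.card {I : (Ideal (𝓞 K))⁰ // Ideal.absNorm (I : Ideal (𝓞 K)) ≤ t} : ℝ) - κ * t| ≤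
      M * t ^ (1 - 1 / (2 * (Module.finrank ℚ K : ℝ))) := by
  have hd := finrank_pos_real (K := K)
  choose κ M h using exists_abs_card_class_sub_le (K := K)
  have hsum : ∀ t : ℝ, 1 ≤ t →
    (Nat.card {I : (Ideal (𝓞 K))⁰ // Ideal.absNorm (I : Ideal (𝓞 K)) ≤ t} : ℝ) =
      ∑ C, (Nat.card {I : (Ideal (𝓞 K))⁰ // Ideal.absNorm (I : Ideal (𝓞 K)) ≤ t ∧
      ClassGroup.mk0 I = C} : ℝ) := by
    intro s hs
    have : Fintype {I : (Ideal (𝓞 K))⁰ // Ideal.absNorm (I : Ideal (𝓞 K)) ≤ s} := by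
      simp_rw [← Nat.le_floor_iff (zero_le_one.trans hs)]
      refine @Fintype.ofFinite _ (Ideal.finite_setOfPred_absNorm_le₀ ⌊s⌋₊)
    let e := fun C : ClassGroup (𝓞 K) ↦ Equiv.subtypeSubtypeEquivSubtypeInter
      (fun I : (Ideal (𝓞 K))⁰ ↦ (Ideal.absNorm I.1 : ℝ) ≤ s) (fun I ↦ ClassGroup.mk0 I = C)
    simp_rw [← Nat.card_congr (e _), Nat.card_eq_fintype_card, Fintype.subtype_card]
    rw [Fintype.card, Finset.card_eq_sum_card_fiberwise (f := fun I ↦ ClassGroup.mk0 I.1)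
      (t := Finset.univ) (fun _ _ ↦ Finset.mem_univ _), Nat.cast_sum]
  have hb : ∀ t : ℝ, 1 ≤ t →
    |(Nat.card {I : (Ideal (𝓞 K))⁰ // Ideal.absNorm (I : Ideal (𝓞 K)) ≤ t} : ℝ) -
      (∑ C, κ C) * t| ≤ (∑ C, M C) * t ^ (1 - 1 / (2 * (Module.finrank ℚ K : ℝ))) := by
    intro t ht
    rw [hsum t ht, Finset.sum_mul, Finset.sum_mul, ← Finset.sum_sub_distrib]
    exact (Finset.abs_sum_le_sum_abs _ _).trans (Finset.sum_le_sum fun C _ ↦ h C t ht)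
  refine ⟨∑ C, κ C, ∑ C, M C, ?_, hb⟩
  have hlim := NumberField.Ideal.tendsto_norm_le_div_atTop₀ K
  refine lt_of_lt_of_eq ?_ (tendsto_nhds_unique hlim ?_)
  · have h1 := regulator_pos K
    have h2 : 0 < classNumber K := classNumber_pos K
    have h3 : discr K ≠ 0 := discr_ne_zero K
    have h4 := torsionOrder_pos K
    positivity
  · rw [tendsto_iff_norm_sub_tendsto_zero]
    refine squeeze_zero' (Eventually.of_forall fun _ ↦ norm_nonneg _)
      (g := fun t ↦ (∑ C, M C) * t ^ (-(1 / (2 * (Module.finrank ℚ K : ℝ))))) ?_ ?_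
    · filter_upwards [eventually_ge_atTop 1] with t ht
      have ht0 : 0 < t := by linarith
      rw [Real.norm_eq_abs, div_sub' ht0.ne', abs_div, abs_of_pos ht0, div_le_iff₀ ht0, mul_comm t]
      refine (hb t ht).trans_eq ?_
      rw [sub_eq_neg_add, Real.rpow_add ht0, Real.rpow_one, mul_assoc]
    · rw [← mul_zero (∑ C, M C)]
      exact (tendsto_rpow_neg_atTop (by positivity)).const_mul _

end

end IdealCount

section

open MeasureTheory Set Topology

namespace WienerIkehara

/-- The Fejér kernel, up to normalisation. -/
noncomputable def fejer (v : ℝ) : ℝ := Real.sinc (v / 2) ^ 2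

lemma fejer_nonneg (v : ℝ) : 0 ≤ fejer v := sq_nonneg _

lemma continuous_fejer : Continuous fejer := by
  have := Real.continuous_sinc
  unfold fejer
  fun_prop

lemma fejer_zero : fejer 0 = 1 := by simp [fejer]

lemma fejer_le (v : ℝ) : fejer v ≤ 8 * (1 + v ^ 2)⁻¹ := by
  have h1 := abs_le.mp (Real.abs_sinc_le_one (v / 2))
  have h2 : fejer v ≤ 1 := by unfold fejer; nlinarith
  rw [← div_eq_mul_inv, le_div_iff₀ (by positivity)]
  rcases eq_or_ne v 0 with rfl | hv
  · nlinarith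
  have h3 : fejer v * v ^ 2 ≤ 4 := by
    have h4 := Real.sin_sq_le_one (v / 2)
    rw [fejer, Real.sinc_of_ne_zero (by positivity)]
    field_simp
    nlinarith
  linarith

lemma integrable_fejer : Integrable fejer := by
  refine ((integrable_inv_one_add_sq).const_mul 8).mono' continuous_fejer.aestronglyMeasurable
    (ae_of_all _ fun v ↦ ?_)
  rw [Real.norm_of_nonneg (fejer_nonneg v)]
  exact fejer_le v

lemma integral_fejer_pos : 0 < ∫ v, fejer v := by
  refine (integral_pos_iff_support_of_nonneg fejer_nonneg integrable_fejer).mpr ?_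
  exact (continuous_fejer.isOpen_support).measure_pos _ ⟨0, by simp [fejer_zero]⟩

lemma fejer_eq_integral (v : ℝ) : fejer v = ∫ t in (0 : ℝ)..1, 2 * (1 - t) * Real.cos (t * v) := by
  rcases eq_or_ne v 0 with rfl | hv
  · rw [fejer_zero]
    simp only [mul_zero, Real.cos_zero, mul_one, intervalIntegral.integral_const_mul]
    rw [intervalIntegral.integral_sub (by simp) (by simp), integral_id]
    norm_num
  have hderiv : ∀ t ∈ uIcc (0 : ℝ) 1, HasDerivAt
      (fun t ↦ 2 * (1 - t) * Real.sin (t * v) / v - 2 * Real.cos (t * v) / v ^ 2)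
      (2 * (1 - t) * Real.cos (t * v)) t := by
    intro t _
    have e1 : HasDerivAt (fun t ↦ t * v) v t := hasDerivAt_mul_const v
    have e2 : HasDerivAt (fun t : ℝ ↦ 2 * (1 - t)) (-2) t := by
      simpa using ((hasDerivAt_id t).const_sub 1).const_mul 2
    refine (((e2.mul e1.sin).div_const v).sub
      ((e1.cos.const_mul 2).div_const (v ^ 2))).congr_deriv ?_
    field_simp
    ring
  rw [intervalIntegral.integral_eq_sub_of_hasDerivAt hderiv
    (Continuous.intervalIntegrable (by fun_prop) _ _), fejer,
    Real.sinc_of_ne_zero (by positivity), div_pow, Real.sin_sq_eq_half_sub]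
  simp only [mul_div_cancel₀ v two_ne_zero]
  simp
  field_simp
  ring

lemma integrable_of_tendsto_laplace {f : ℝ → ℝ} (hf0 : ∀ u, 0 ≤ f u)
    (hInt : ∀ δ > 0, IntegrableOn (fun u ↦ f u * Real.exp (-(δ * u))) (Ioi 0)) {J : ℝ}
    (hJ : Tendsto (fun δ ↦ ∫ u in Ioi 0, f u * Real.exp (-(δ * u))) (𝓝[>] 0) (𝓝 J)) :
    IntegrableOn f (Ioi 0) ∧ ∫ u in Ioi 0, f u = J := by
  have hs : Tendsto (fun n : ℕ ↦ (1 : ℝ) / (n + 1)) atTop (𝓝[>] 0) :=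
    tendsto_nhdsWithin_iff.mpr ⟨tendsto_one_div_add_atTop_nhds_zero_nat,
      Eventually.of_forall fun n ↦ mem_Ioi.mpr (by positivity)⟩
  have hlim : ∀ u, Tendsto (fun δ ↦ f u * Real.exp (-(δ * u))) (𝓝[>] 0) (𝓝 (f u)) := by
    intro u
    have : Continuous fun δ : ℝ ↦ f u * Real.exp (-(δ * u)) := by fun_prop
    simpa using this.continuousWithinAt (s := Ioi 0) (x := 0) |>.tendsto
  have hfi : IntegrableOn f (Ioi 0) := by
    refine integrable_of_tendsto (G := fun n u ↦ f u * Real.exp (-(1 / (n + 1 : ℝ) * u)))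
      (ae_of_all _ fun u ↦ (hlim u).comp hs)
      (fun n ↦ (hInt _ (by positivity)).aestronglyMeasurable) ?_
    have : ∀ n : ℕ, ∫⁻ u in Ioi 0, ‖f u * Real.exp (-(1 / (n + 1 : ℝ) * u))‖ₑ =
        ENNReal.ofReal (∫ u in Ioi 0, f u * Real.exp (-(1 / (n + 1 : ℝ) * u))) := by
      intro n
      rw [ofReal_integral_eq_lintegral_ofReal (hInt _ (by positivity))
        (ae_of_all _ fun u ↦ mul_nonneg (hf0 u) (Real.exp_pos _).le)]
      refine lintegral_congr fun u ↦ ?_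
      rw [Real.enorm_of_nonneg (mul_nonneg (hf0 u) (Real.exp_pos _).le)]
    simp_rw [this]
    have hl := ((ENNReal.continuous_ofReal.tendsto J).comp (hJ.comp hs)).liminf_eq
    simp only [Function.comp_def] at hl
    rw [hl]
    exact ENNReal.ofReal_ne_top
  refine ⟨hfi, tendsto_nhds_unique ?_ hJ⟩
  refine tendsto_integral_filter_of_dominated_convergence f ?_ ?_ hfi (ae_of_all _ hlim)
  · filter_upwards [self_mem_nhdsWithin] with δ hδ using (hInt δ hδ).aestronglyMeasurable
  · filter_upwards [self_mem_nhdsWithin] with δ hδ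
    filter_upwards [ae_restrict_mem measurableSet_Ioi] with u hu
    rw [Real.norm_of_nonneg (mul_nonneg (hf0 u) (Real.exp_pos _).le)]
    exact mul_le_of_le_one_right (hf0 u)
      (Real.exp_le_one_iff.mpr (neg_nonpos.mpr (mul_pos hδ hu).le))

end WienerIkehara

end

section

open MeasureTheory Set Topology

namespace WienerIkehara

section

variable {S : ℝ → ℝ} {A : ℝ} {G : ℂ → ℂ}

lemma integrableOn_shift
    (hInt : ∀ σ : ℝ, 1 < σ → IntegrableOn (fun u ↦ S u * Real.exp (-(σ * u))) (Ioi 0))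
    {δ : ℝ} (hδ : 0 < δ) :
    IntegrableOn (fun u ↦ S u * Real.exp (-u) * Real.exp (-(δ * u))) (Ioi 0) := by
  refine (hInt (1 + δ) (by linarith)).congr_fun (fun u _ ↦ ?_) measurableSet_Ioi
  simp only
  rw [mul_assoc, ← Real.exp_add]
  ring_nf

lemma integral_shift_cos
    (hInt : ∀ σ : ℝ, 1 < σ → IntegrableOn (fun u ↦ S u * Real.exp (-(σ * u))) (Ioi 0))
    (hL : ∀ z : ℂ, 1 < z.re →
      ∫ u in Ioi (0 : ℝ), (S u : ℂ) * Complex.exp (-(z * u)) = A / (z - 1) + G z)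
    {δ : ℝ} (hδ : 0 < δ) (τ y : ℝ) :
    ∫ u in Ioi (0 : ℝ), (S u * Real.exp (-u) - A) * Real.exp (-(δ * u)) * Real.cos (τ * (y - u)) =
      (Complex.exp (Complex.I * (τ * y)) * G (1 + δ + Complex.I * τ)).re := by
  have hw : (δ + Complex.I * τ : ℂ) ≠ 0 := by
    intro h
    have := congrArg Complex.re h
    simp at this
    exact hδ.ne' this
  have h1 := hL (1 + δ + Complex.I * τ) (by simp [hδ])
  have hA : ∫ u in Ioi (0 : ℝ), (A : ℂ) * Complex.exp (-((δ + Complex.I * τ) * u)) =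
      A / (δ + Complex.I * τ) := by
    have := integral_exp_mul_complex_Ioi (a := -(δ + Complex.I * τ)) (by simpa using hδ) 0
    simp only [Complex.ofReal_zero, mul_zero, Complex.exp_zero] at this
    rw [integral_const_mul]
    simp_rw [← neg_mul]
    rw [this]
    field_simp
  have hiA : IntegrableOn (fun u : ℝ ↦ (A : ℂ) * Complex.exp (-((δ + Complex.I * τ) * u)))
      (Ioi 0) := by
    simp_rw [← neg_mul]
    exact (integrableOn_exp_mul_complex_Ioi (by simpa using hδ) 0).const_mul _
  have hiS : IntegrableOn (fun u : ℝ ↦ (S u : ℂ) * Complex.exp (-((1 + δ + Complex.I * τ) * u)))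
      (Ioi 0) := by
    have h := hInt (1 + δ) (by linarith)
    have h' := h.ofReal (𝕜 := ℂ)
    refine (h'.mul_bdd (c := 1) (g := fun u : ℝ ↦ Complex.exp (-(Complex.I * τ * u)))
      (by fun_prop) (ae_of_all _ fun u ↦ ?_)).congr (ae_of_all _ fun u ↦ ?_)
    · rw [Complex.norm_exp]; simp
    · simp only [RCLike.ofReal_mul, Complex.coe_algebraMap, Complex.ofReal_exp]
      push_cast
      rw [mul_assoc, ← Complex.exp_add]
      ring_nf
  have h2 : ∫ u in Ioi (0 : ℝ), ((S u : ℂ) * Complex.exp (-((1 + δ + Complex.I * τ) * u)) -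
      (A : ℂ) * Complex.exp (-((δ + Complex.I * τ) * u))) = G (1 + δ + Complex.I * τ) := by
    rw [integral_sub hiS hiA, h1, hA]
    ring
  rw [← h2, ← integral_const_mul]
  have hi : IntegrableOn (fun u : ℝ ↦ Complex.exp (Complex.I * (τ * y)) *
      ((S u : ℂ) * Complex.exp (-((1 + δ + Complex.I * τ) * u)) -
        A * Complex.exp (-((δ + Complex.I * τ) * u)))) (Ioi 0) := (hiS.sub hiA).const_mul _
  rw [← RCLike.re_eq_complex_re, ← integral_re hi]
  refine integral_congr_ae (ae_of_all _ fun u ↦ ?_)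
  simp only
  have e : Complex.exp (Complex.I * (τ * y)) *
      ((S u : ℂ) * Complex.exp (-((1 + δ + Complex.I * τ) * u)) -
        A * Complex.exp (-((δ + Complex.I * τ) * u))) =
      (((S u * Real.exp (-u) - A) * Real.exp (-(δ * u)) : ℝ) : ℂ) *
        Complex.exp ((τ * (y - u) : ℝ) * Complex.I) := by
    push_cast
    have e1 : Complex.exp (-((1 + δ + Complex.I * τ) * u)) =
      Complex.exp (-u) * Complex.exp (-((δ + Complex.I * τ) * u)) := by
      rw [← Complex.exp_add]; ring_nf
    have e2 : Complex.exp (-(δ * u)) * Complex.exp (τ * (y - u) * Complex.I) =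
      Complex.exp (Complex.I * (τ * y)) * Complex.exp (-((δ + Complex.I * τ) * u)) := by
      rw [← Complex.exp_add, ← Complex.exp_add]; ring_nf
    rw [e1, mul_assoc _ (Complex.exp (-(δ * u))), e2]
    ring
  rw [e, RCLike.re_eq_complex_re, Complex.re_ofReal_mul, Complex.exp_ofReal_mul_I_re]

lemma fejer_identity
    (hInt : ∀ σ : ℝ, 1 < σ → IntegrableOn (fun u ↦ S u * Real.exp (-(σ * u))) (Ioi 0))
    (hL : ∀ z : ℂ, 1 < z.re →
      ∫ u in Ioi (0 : ℝ), (S u : ℂ) * Complex.exp (-(z * u)) = A / (z - 1) + G z)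
    {δ : ℝ} (hδ : 0 < δ) (l y : ℝ) :
    ∫ u in Ioi (0 : ℝ), (S u * Real.exp (-u) - A) * Real.exp (-(δ * u)) * fejer (l * (y - u)) =
      ∫ t in (0 : ℝ)..1, 2 * (1 - t) *
        (Complex.exp (Complex.I * ((t * l : ℝ) * y)) * G (1 + δ + Complex.I * (t * l : ℝ))).re := by
  simp_rw [← integral_shift_cos hInt hL hδ, ← integral_const_mul]
  rw [intervalIntegral_integral_swap]
  · refine integral_congr_ae (ae_of_all _ fun u ↦ ?_)
    simp only
    rw [fejer_eq_integral, ← intervalIntegral.integral_const_mul]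
    congr 1
    ext t
    rw [show t * (l * (y - u)) = t * l * (y - u) by ring]
    ring
  · have h1 : IntegrableOn (fun u ↦ (S u * Real.exp (-u) - A) * Real.exp (-(δ * u))) (Ioi 0) := by
      simp_rw [sub_mul]
      refine (integrableOn_shift hInt hδ).sub (Integrable.const_mul ?_ _)
      simp_rw [← neg_mul]
      exact integrableOn_exp_mul_Ioi (by linarith) 0
    have h2 : Integrable (fun t : ℝ ↦ 2 * (1 - t)) (volume.restrict (uIoc 0 1)) :=
      (Continuous.integrableOn_uIoc (by fun_prop))
    refine ((h2.mul_prod h1).mul_bdd (c := 1)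
      (g := fun p : ℝ × ℝ ↦ Real.cos (p.1 * l * (y - p.2))) (by fun_prop)
      (ae_of_all _ fun p ↦ by simpa using Real.abs_cos_le_one _)).congr (ae_of_all _ fun p ↦ ?_)
    simp only [Function.uncurry]
    ring

end

end WienerIkehara

end

section

open MeasureTheory Set Topology

namespace WienerIkehara

section

variable {S : ℝ → ℝ} {A : ℝ} {G : ℂ → ℂ}

lemma tendsto_boundary (hG : ContinuousOn G {z | 1 ≤ z.re}) (l y : ℝ) :
    Tendsto (fun δ : ℝ ↦ ∫ t in (0 : ℝ)..1, 2 * (1 - t) *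
        (Complex.exp (Complex.I * ((t * l : ℝ) * y)) * G (1 + δ + Complex.I * (t * l : ℝ))).re)
      (𝓝[>] 0) (𝓝 (∫ t in (0 : ℝ)..1, 2 * (1 - t) *
        (Complex.exp (Complex.I * ((t * l : ℝ) * y)) * G (1 + Complex.I * (t * l : ℝ))).re)) := by
  have hc : ContinuousOn (fun p : ℝ × ℝ ↦ 2 * (1 - p.2) *
      (Complex.exp (Complex.I * ((p.2 * l : ℝ) * y)) *
        G (1 + p.1 + Complex.I * (p.2 * l : ℝ))).re) (Ici 0 ×ˢ univ) := by
    refine ContinuousOn.mul (by fun_prop) (Complex.continuous_re.comp_continuousOn ?_)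
    refine ContinuousOn.mul (by fun_prop) (hG.comp (by fun_prop) ?_)
    rintro ⟨d, t⟩ ⟨hd, -⟩
    simpa using hd
  obtain ⟨B, hB⟩ := (isCompact_Icc.prod isCompact_Icc).exists_bound_of_continuousOn
    (hc.mono (prod_mono (Icc_subset_Ici_self : Icc (0 : ℝ) 1 ⊆ Ici 0) (subset_univ (Icc
        (0 : ℝ) 1))))
  have h0 : ∀ t : ℝ, (G (1 + Complex.I * (t * l : ℝ))) =
    G (1 + (0 : ℝ) + Complex.I * (t * l : ℝ)) := by simp
  simp_rw [h0]
  refine intervalIntegral.tendsto_integral_filter_of_dominated_convergence (fun _ ↦ B) ?_ ?_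
    (by simp) ?_
  · filter_upwards [self_mem_nhdsWithin] with δ hδ
    refine ContinuousOn.aestronglyMeasurable ?_ measurableSet_uIoc
    exact hc.comp (f := fun t ↦ (δ, t)) (by fun_prop) fun t _ ↦
      ⟨mem_Ici.mpr (le_of_lt hδ), mem_univ _⟩
  · filter_upwards [self_mem_nhdsWithin, nhdsWithin_le_nhds (Iio_mem_nhds one_pos)] with δ hδ hδ1
    refine ae_of_all _ fun t ht ↦ ?_
    rw [uIoc_of_le zero_le_one] at ht
    exact hB (δ, t) ⟨⟨le_of_lt hδ, le_of_lt hδ1⟩, ht.1.le, ht.2⟩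
  · refine ae_of_all _ fun t _ ↦ ?_
    have h1 := hc (0, t) ⟨mem_Ici.mpr le_rfl, mem_univ _⟩
    refine h1.tendsto.comp (f := fun δ ↦ (δ, t)) (x := 𝓝[>] (0 : ℝ))
      (tendsto_nhdsWithin_iff.mpr ⟨?_, ?_⟩)
    · exact ((continuous_id.prodMk continuous_const).tendsto (0 : ℝ)).mono_left nhdsWithin_le_nhds
    · filter_upwards [self_mem_nhdsWithin] with δ hδ using
        ⟨mem_Ici.mpr (le_of_lt hδ), mem_univ _⟩

lemma tendsto_boundary_atTop (hG : ContinuousOn G {z | 1 ≤ z.re}) {l : ℝ} (hl : 0 < l) :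
    Tendsto (fun y : ℝ ↦ ∫ t in (0 : ℝ)..1, 2 * (1 - t) *
        (Complex.exp (Complex.I * ((t * l : ℝ) * y)) * G (1 + Complex.I * (t * l : ℝ))).re)
      atTop (𝓝 0) := by
  have hcG : Continuous fun t : ℝ ↦ G (1 + Complex.I * (t * l : ℝ)) :=
    hG.comp_continuous (by fun_prop) fun t ↦ by simp
  set f : ℝ → ℂ := (Ioc 0 1).indicator fun t : ℝ ↦ 2 * (1 - t) * G (1 + Complex.I * (t * l : ℝ))
  have h := Real.tendsto_integral_exp_smul_cocompact f
  have hw : Tendsto (fun y : ℝ ↦ -(l / (2 * Real.pi)) * y) atTop (cocompact ℝ) := by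
    refine Tendsto.mono_right ?_ atBot_le_cocompact
    exact tendsto_id.const_mul_atTop_of_neg (neg_neg_of_pos (by positivity))
  have h2 := (Complex.continuous_re.tendsto 0).comp (h.comp hw)
  simp only [Complex.zero_re] at h2
  refine h2.congr fun y ↦ ?_
  simp only [Function.comp_apply]
  have e : ∀ v : ℝ, Real.fourierChar (-(v * (-(l / (2 * Real.pi)) * y))) • f v =
      (Ioc 0 1).indicator (fun t : ℝ ↦ 2 * (1 - t) *
        (Complex.exp (Complex.I * ((t * l : ℝ) * y)) * G (1 + Complex.I * (t * l : ℝ)))) v := by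
    intro v
    simp only [f, indicator]
    split_ifs
    · rw [Circle.smul_def, Real.fourierChar_apply, smul_eq_mul]
      have : (2 * Real.pi * (-(v * (-(l / (2 * Real.pi)) * y))) : ℝ) = v * l * y := by
        field_simp
      rw [this]
      push_cast
      ring_nf
    · simp
  simp_rw [e]
  rw [integral_indicator measurableSet_Ioc, ← intervalIntegral.integral_of_le zero_le_one,
    ← RCLike.re_eq_complex_re, ← intervalIntegral.intervalIntegral_re]
  · refine intervalIntegral.integral_congr fun t _ ↦ ?_
    rw [RCLike.re_eq_complex_re, ← Complex.re_ofReal_mul]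
    push_cast
    rfl
  · refine Continuous.intervalIntegrable ?_ _ _
    exact Continuous.mul (by fun_prop) (Continuous.mul (by fun_prop) hcG)

lemma tendsto_integral_fejer_Ioi {l : ℝ} (hl : 0 < l) :
    Tendsto (fun y : ℝ ↦ ∫ u in Ioi (0 : ℝ), fejer (l * (y - u))) atTop
      (𝓝 ((∫ v, fejer v) / l)) := by
  have h : Integrable fun v ↦ fejer (l * v) := integrable_fejer.comp_mul_left' hl.ne'
  have h1 := (aecover_Iio (μ := volume) (b :=
      fun y : ℝ ↦ y) tendsto_id).integral_tendsto_of_countably_generated h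
  rw [Measure.integral_comp_mul_left, abs_of_pos (by positivity), smul_eq_mul, inv_mul_eq_div] at h1
  refine h1.congr fun y ↦ ?_
  rw [← integral_indicator measurableSet_Iio, ← integral_indicator measurableSet_Ioi,
    ← integral_sub_left_eq_self _ volume y]
  refine integral_congr_ae (ae_of_all _ fun u ↦ ?_)
  simp [indicator]

/-- The smoothed form of the Wiener–Ikehara theorem. -/
lemma tendsto_integral_mul_fejer (hS : ∀ u, 0 ≤ S u) (hG : ContinuousOn G {z | 1 ≤ z.re})
    (hInt : ∀ σ : ℝ, 1 < σ → IntegrableOn (fun u ↦ S u * Real.exp (-(σ * u))) (Ioi 0))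
    (hL : ∀ z : ℂ, 1 < z.re →
      ∫ u in Ioi (0 : ℝ), (S u : ℂ) * Complex.exp (-(z * u)) = A / (z - 1) + G z)
    {l : ℝ} (hl : 0 < l) :
    (∀ y, IntegrableOn (fun u ↦ S u * Real.exp (-u) * fejer (l * (y - u))) (Ioi 0)) ∧
    Tendsto (fun y ↦ ∫ u in Ioi (0 : ℝ), S u * Real.exp (-u) * fejer (l * (y - u))) atTop
      (𝓝 (A * ((∫ v, fejer v) / l))) := by
  set J := fun y : ℝ ↦ ∫ t in (0 : ℝ)..1, 2 * (1 - t) *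
        (Complex.exp (Complex.I * ((t * l : ℝ) * y)) * G (1 + Complex.I * (t * l : ℝ))).re
  have hfe : ∀ y, Continuous fun u ↦ fejer (l * (y - u)) := fun y ↦
    continuous_fejer.comp (by fun_prop)
  have hfi : ∀ y, Integrable fun u ↦ fejer (l * (y - u)) := fun y ↦
    (integrable_fejer.comp_mul_left' hl.ne').comp_sub_left y
  have hfb : ∀ y u, ‖fejer (l * (y - u))‖ ≤ 8 := fun y u ↦ by
    rw [Real.norm_of_nonneg (fejer_nonneg _)]
    refine (fejer_le _).trans (mul_le_of_le_one_right (by norm_num) (inv_le_one_of_one_le₀ ?_))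
    nlinarith [sq_nonneg (l * (y - u))]
  have key : ∀ y, IntegrableOn (fun u ↦ S u * Real.exp (-u) * fejer (l * (y - u))) (Ioi 0) ∧
      ∫ u in Ioi (0 : ℝ), S u * Real.exp (-u) * fejer (l * (y - u)) =
        J y + A * ∫ u in Ioi (0 : ℝ), fejer (l * (y - u)) := by
    intro y
    have hi1 : ∀ δ > 0, IntegrableOn
        (fun u ↦ S u * Real.exp (-u) * fejer (l * (y - u)) * Real.exp (-(δ * u))) (Ioi 0) := by
      intro δ hδ
      refine ((integrableOn_shift hInt hδ).mul_bdd (c := 8) (hfe y).aestronglyMeasurable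
        (ae_of_all _ (hfb y))).congr (ae_of_all _ fun u ↦ ?_)
      simp only
      ring
    have hi2 : ∀ δ > 0, IntegrableOn
        (fun u ↦ fejer (l * (y - u)) * Real.exp (-(δ * u))) (Ioi 0) := by
      intro δ hδ
      refine (hfi y).integrableOn.mul_bdd (c := 1) (by fun_prop) ?_
      filter_upwards [ae_restrict_mem measurableSet_Ioi] with u hu
      rw [Real.norm_of_nonneg (Real.exp_pos _).le]
      exact Real.exp_le_one_iff.mpr (neg_nonpos.mpr (mul_pos hδ hu).le)
    have hlim2 : Tendsto (fun δ : ℝ ↦ ∫ u in Ioi 0, fejer (l * (y - u)) * Real.exp (-(δ * u)))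
        (𝓝[>] 0) (𝓝 (∫ u in Ioi 0, fejer (l * (y - u)))) := by
      refine tendsto_integral_filter_of_dominated_convergence (fun u ↦ fejer (l * (y - u)))
        ?_ ?_ (hfi y).integrableOn (ae_of_all _ fun u ↦ ?_)
      · filter_upwards [self_mem_nhdsWithin] with δ hδ using (hi2 δ hδ).aestronglyMeasurable
      · filter_upwards [self_mem_nhdsWithin] with δ hδ
        filter_upwards [ae_restrict_mem measurableSet_Ioi] with u hu
        rw [Real.norm_of_nonneg (mul_nonneg (fejer_nonneg _) (Real.exp_pos _).le)]
        exact mul_le_of_le_one_right (fejer_nonneg _)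
          (Real.exp_le_one_iff.mpr (neg_nonpos.mpr (mul_pos hδ hu).le))
      · have : Continuous fun δ : ℝ ↦ fejer (l * (y - u)) * Real.exp (-(δ * u)) := by fun_prop
        simpa using this.continuousWithinAt (s := Ioi 0) (x := 0) |>.tendsto
    refine integrable_of_tendsto_laplace
      (fun u ↦ mul_nonneg (mul_nonneg (hS u) (Real.exp_pos _).le) (fejer_nonneg _)) hi1 ?_
    refine ((tendsto_boundary hG l y).add (hlim2.const_mul A)).congr' ?_
    filter_upwards [self_mem_nhdsWithin] with δ hδ
    rw [← fejer_identity hInt hL hδ, ← integral_const_mul, ← integral_add]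
    · refine integral_congr_ae (ae_of_all _ fun u ↦ ?_)
      simp only
      ring
    · refine ((hi1 δ hδ).sub ((hi2 δ hδ).const_mul A)).congr (ae_of_all _ fun u ↦ ?_)
      simp only [Pi.sub_apply]
      ring
    · exact (hi2 δ hδ).const_mul A
  refine ⟨fun y ↦ (key y).1, ?_⟩
  simp_rw [fun y ↦ (key y).2]
  rw [← zero_add (A * _)]
  exact (tendsto_boundary_atTop hG hl).add ((tendsto_integral_fejer_Ioi hl).const_mul A)

end

end WienerIkehara

end

section

open MeasureTheory Set Topology

namespace WienerIkehara

section

variable {S : ℝ → ℝ} {A : ℝ} {G : ℂ → ℂ}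

lemma exists_fejer_tail {ρ : ℝ} (hρ : 0 < ρ) : ∃ R > 0,
    (∫ v, fejer v) - ρ < ∫ v in Icc (-R) R, fejer v := by
  have h := (aecover_Icc (μ := volume) (a := fun y : ℝ ↦ -y) (b := fun y ↦ y)
    tendsto_neg_atTop_atBot tendsto_id).integral_tendsto_of_countably_generated integrable_fejer
  obtain ⟨R, h1, h2⟩ := ((h.eventually (lt_mem_nhds (sub_lt_self _ hρ))).and
    (eventually_gt_atTop 0)).exists
  exact ⟨R, h2, h1⟩

lemma setIntegral_window {l ε y : ℝ} (hl : 0 < l) :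
    ∫ u in Icc (y - ε) (y + ε), fejer (l * (y - u)) =
      (∫ v in Icc (-(l * ε)) (l * ε), fejer v) / l := by
  rw [← integral_indicator measurableSet_Icc, ← integral_indicator measurableSet_Icc,
    ← integral_sub_left_eq_self _ volume y]
  have := Measure.integral_comp_mul_left
    ((Icc (-(l * ε)) (l * ε)).indicator fejer) l
  rw [abs_of_pos (by positivity), smul_eq_mul, inv_mul_eq_div] at this
  rw [← this]
  refine integral_congr_ae (ae_of_all _ fun v ↦ ?_)
  simp only [indicator, sub_sub_cancel, mem_Icc]
  refine if_congr ?_ rfl rfl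
  rw [← mul_neg, mul_le_mul_iff_right₀ hl, mul_le_mul_iff_right₀ hl]
  constructor <;> rintro ⟨h1, h2⟩ <;> constructor <;> linarith

variable (hS : ∀ u, 0 ≤ S u) (hmono : Monotone S) (hG : ContinuousOn G {z | 1 ≤ z.re})
    (hInt : ∀ σ : ℝ, 1 < σ → IntegrableOn (fun u ↦ S u * Real.exp (-(σ * u))) (Ioi 0))
    (hL : ∀ z : ℂ, 1 < z.re →
      ∫ u in Ioi (0 : ℝ), (S u : ℂ) * Complex.exp (-(z * u)) = A / (z - 1) + G z)

include hS hmono hG hInt hL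

lemma eventually_upper {ε : ℝ} (hε : 0 < ε) (hεκ : ε < ∫ v, fejer v) :
    ∀ᶠ y in atTop, S y * Real.exp (-y) ≤
      Real.exp (2 * ε) * (A * (∫ v, fejer v) + ε) / ((∫ v, fejer v) - ε) := by
  set κ := ∫ v, fejer v
  obtain ⟨R, hR, hRκ⟩ := exists_fejer_tail hε
  set l := R / ε
  have hl : 0 < l := by positivity
  obtain ⟨hi, hlim⟩ := tendsto_integral_mul_fejer hS hG hInt hL hl
  have hlt : A * (κ / l) < (A * κ + ε) / l := by
    rw [← mul_div_assoc]; gcongr; linarith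
  have ev := (hlim.comp (tendsto_atTop_add_const_right _ ε tendsto_id)).eventually_lt_const hlt
  filter_upwards [ev, eventually_gt_atTop 0] with y hy hy0
  simp only [Function.comp_apply, id] at hy
  have h1 : ∫ u in Icc (y + ε - ε) (y + ε + ε), S y * Real.exp (-y) * Real.exp (-(2 * ε)) *
      fejer (l * (y + ε - u)) ≤
      ∫ u in Ioi (0 : ℝ), S u * Real.exp (-u) * fejer (l * (y + ε - u)) := by
    have hsub : Icc (y + ε - ε) (y + ε + ε) ⊆ Ioi (0 : ℝ) := fun u hu ↦ by
      have := hu.1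
      simp only [mem_Ioi]; linarith
    refine le_trans (setIntegral_mono_on ?_ ((hi (y + ε)).mono_set hsub) measurableSet_Icc ?_)
      (setIntegral_mono_set (hi (y + ε)) (ae_of_all _ fun u ↦
        mul_nonneg (mul_nonneg (hS u) (Real.exp_pos _).le) (fejer_nonneg _)) hsub.eventuallyLE)
    · exact (((integrable_fejer.comp_mul_left' hl.ne').comp_sub_left _).const_mul _).integrableOn
    · intro u hu
      have h2 : S y ≤ S u := hmono (by have := hu.1; linarith)
      have h3 : Real.exp (-y) * Real.exp (-(2 * ε)) ≤ Real.exp (-u) := by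
        rw [← Real.exp_add]
        gcongr
        have := hu.2; linarith
      rw [mul_assoc (S y)]
      refine mul_le_mul_of_nonneg_right ?_ (fejer_nonneg _)
      exact mul_le_mul h2 h3 (by positivity) (hS u)
  rw [integral_const_mul, setIntegral_window hl, show l * ε = R by simp only [l]; field_simp] at h1
  have h4 := h1.trans_lt hy
  have hH : 0 ≤ S y * Real.exp (-y) := mul_nonneg (hS y) (Real.exp_pos _).le
  have h5 : S y * Real.exp (-y) * Real.exp (-(2 * ε)) * (κ - ε) ≤ A * κ + ε := by
    have h6 : S y * Real.exp (-y) * Real.exp (-(2 * ε)) * (κ - ε) ≤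
      S y * Real.exp (-y) * Real.exp (-(2 * ε)) * (∫ v in Icc (-R) R, fejer v) := by gcongr
    rw [← mul_div_assoc, div_lt_div_iff_of_pos_right hl] at h4
    linarith
  rw [le_div_iff₀ (by linarith)]
  calc S y * Real.exp (-y) * (κ - ε) =
        Real.exp (2 * ε) * (S y * Real.exp (-y) * Real.exp (-(2 * ε)) * (κ - ε)) := by
        rw [Real.exp_neg (2 * ε)]
        field_simp
    _ ≤ _ := mul_le_mul_of_nonneg_left h5 (Real.exp_pos _).le

lemma exists_bound : ∃ B, 0 ≤ B ∧ ∀ u ∈ Ioi (0 : ℝ), S u * Real.exp (-u) ≤ B := by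
  have hκ := integral_fejer_pos
  obtain ⟨Y, hY⟩ := eventually_atTop.mp (eventually_upper hS hmono hG hInt hL
    (half_pos hκ) (half_lt_self hκ))
  refine ⟨max (S Y) (Real.exp (2 * ((∫ v, fejer v) / 2)) * (A * (∫ v, fejer v) +
    (∫ v, fejer v) / 2) / ((∫ v, fejer v) - (∫ v, fejer v) / 2)),
    le_max_of_le_left (hS Y), fun u hu ↦ ?_⟩
  rcases le_total Y u with h | h
  · exact le_max_of_le_right (hY u h)
  · refine le_max_of_le_left ?_
    refine (mul_le_of_le_one_right (hS u) ?_).trans (hmono h)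
    exact Real.exp_le_one_iff.mpr (neg_nonpos.mpr (le_of_lt hu))

lemma eventually_lower {B : ℝ} (hB0 : 0 ≤ B) (hB : ∀ u ∈ Ioi (0 : ℝ), S u * Real.exp (-u) ≤ B)
    {ε : ℝ} (hε : 0 < ε) :
    ∀ᶠ y in atTop, Real.exp (-(2 * ε)) * (A * (∫ v, fejer v) - ε - B * ε) / (∫ v, fejer v) ≤
      S y * Real.exp (-y) := by
  have hκ := integral_fejer_pos
  obtain ⟨R, hR, hRκ⟩ := exists_fejer_tail hε
  set l := R / ε
  have hl : 0 < l := by positivity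
  obtain ⟨hi, hlim⟩ := tendsto_integral_mul_fejer hS hG hInt hL hl
  have hlt : (A * (∫ v, fejer v) - ε) / l < A * ((∫ v, fejer v) / l) := by
    rw [← mul_div_assoc]; gcongr; linarith
  have ev := (hlim.comp (tendsto_atTop_add_const_right _ (-ε) tendsto_id)).eventually_const_lt hlt
  filter_upwards [ev, eventually_gt_atTop (2 * ε)] with y hy hy0
  simp only [Function.comp_apply, id, ← sub_eq_add_neg] at hy
  set x := y - ε with hx
  set W := Icc (x - ε) (x + ε)
  have hfi : Integrable fun u ↦ fejer (l * (x - u)) :=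
    (integrable_fejer.comp_mul_left' hl.ne').comp_sub_left _
  have hW : W ⊆ Ioi (0 : ℝ) := fun u hu ↦ by
    have := hu.1
    simp only [mem_Ioi]; linarith
  have htot : ∫ u, fejer (l * (x - u)) = (∫ v, fejer v) / l := by
    rw [integral_sub_left_eq_self (fun u ↦ fejer (l * u)) volume x,
      Measure.integral_comp_mul_left, abs_of_pos (by positivity), smul_eq_mul, inv_mul_eq_div]
  have hwin := setIntegral_window (y := x) (ε := ε) hl
  rw [show l * ε = R by simp only [l]; field_simp] at hwin
  have h1 : ∫ u in W, S u * Real.exp (-u) * fejer (l * (x - u)) ≤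
      S y * Real.exp (-y) * Real.exp (2 * ε) * ((∫ v, fejer v) / l) := by
    calc _ ≤ ∫ u in W, S y * Real.exp (-y) * Real.exp (2 * ε) * fejer (l * (x - u)) := by
          refine setIntegral_mono_on ((hi x).mono_set hW) (hfi.const_mul _).integrableOn
            measurableSet_Icc fun u hu ↦ ?_
          have h2 : S u ≤ S y := hmono (by have := hu.2; linarith)
          have h3 : Real.exp (-u) ≤ Real.exp (-y) * Real.exp (2 * ε) := by
            rw [← Real.exp_add]
            gcongr
            have := hu.1; linarith
          rw [mul_assoc (S y)]
          refine mul_le_mul_of_nonneg_right ?_ (fejer_nonneg _)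
          exact mul_le_mul h2 h3 (by positivity) (hS y)
      _ ≤ _ := by
          have := hS y
          rw [integral_const_mul, ← htot]
          exact mul_le_mul_of_nonneg_left
            (setIntegral_le_integral hfi (ae_of_all _ fun u ↦ fejer_nonneg _)) (by positivity)
  have h2 : ∫ u in Ioi 0 \ W, S u * Real.exp (-u) * fejer (l * (x - u)) ≤ B * (ε / l) := by
    calc _ ≤ ∫ u in Ioi 0 \ W, B * fejer (l * (x - u)) := by
          refine setIntegral_mono_on ((hi x).mono_set sdiff_subset) (hfi.const_mul _).integrableOn
            (measurableSet_Ioi.diff measurableSet_Icc) fun u hu ↦ ?_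
          exact mul_le_mul_of_nonneg_right (hB u hu.1) (fejer_nonneg _)
      _ ≤ _ := by
          rw [integral_const_mul]
          gcongr
          calc _ ≤ ∫ u in Wᶜ, fejer (l * (x - u)) :=
                setIntegral_mono_set hfi.integrableOn (ae_of_all _ fun u ↦ fejer_nonneg _)
                  (LE.le.eventuallyLE fun u hu ↦ hu.2)
            _ ≤ _ := by
              have := integral_add_compl (measurableSet_Icc : MeasurableSet W) hfi
              rw [htot, hwin] at this
              have h3 : (∫ v, fejer v) / l - (∫ v in Icc (-R) R, fejer v) / l ≤ ε / l := by
                rw [← sub_div]; gcongr; linarith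
              linarith
  have h3 := integral_inter_add_sdiff measurableSet_Icc (hi x) (s := Ioi 0) (t := W)
  rw [inter_eq_right.mpr hW] at h3
  rw [← h3] at hy
  have h4 := hy.trans_le (add_le_add h1 h2)
  rw [← mul_div_assoc, ← mul_div_assoc, ← add_div, div_lt_div_iff_of_pos_right hl] at h4
  rw [div_le_iff₀ hκ]
  calc _ ≤ Real.exp (-(2 * ε)) * (S y * Real.exp (-y) * Real.exp (2 * ε) * ∫ v, fejer v) :=
        mul_le_mul_of_nonneg_left (by linarith) (Real.exp_pos _).le
    _ = _ := by
        rw [Real.exp_neg (2 * ε)]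
        field_simp

/-- The **Wiener–Ikehara theorem**, for the Laplace transform of a monotone function. -/
theorem tendsto_of_laplace : Tendsto (fun y ↦ S y * Real.exp (-y)) atTop (𝓝 A) := by
  have hκ := integral_fejer_pos
  obtain ⟨B, hB0, hB⟩ := exists_bound hS hmono hG hInt hL
  have cont (f : ℝ → ℝ) (h0 : f 0 = A) (hf : ContinuousAt f 0) : Tendsto f (𝓝[>] 0) (𝓝 A) :=
    h0 ▸ hf.tendsto.mono_left nhdsWithin_le_nhds
  refine tendsto_order.mpr ⟨fun a ha ↦ ?_, fun a ha ↦ ?_⟩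
  · have h := cont (fun ε ↦ Real.exp (-(2 * ε)) * (A * (∫ v, fejer v) - ε - B * ε) /
      (∫ v, fejer v)) (by simp; field_simp) (by fun_prop)
    obtain ⟨ε, h1, h2⟩ := ((h.eventually_const_lt ha).and self_mem_nhdsWithin).exists
    filter_upwards [eventually_lower hS hmono hG hInt hL hB0 hB h2] with y hy using h1.trans_le hy
  · have h := cont (fun ε ↦ Real.exp (2 * ε) * (A * (∫ v, fejer v) + ε) / ((∫ v, fejer v) - ε))
      (by simp; field_simp) (by fun_prop (disch := simpa using hκ.ne'))
    obtain ⟨ε, ⟨h1, h2⟩, h3⟩ := (((h.eventually_lt_const ha).and self_mem_nhdsWithin).and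
      (nhdsWithin_le_nhds (Iio_mem_nhds hκ))).exists
    filter_upwards [eventually_upper hS hmono hG hInt hL h2 h3] with y hy using hy.trans_lt h1

end

end WienerIkehara

end

section

open MeasureTheory Set Topology

namespace Karamata

section

variable (w u : ℕ → ℝ) (τ : ℝ)

/-- The rescaled exponential sum `s ^ τ * ∑ w d * e ^ (-s u d) * g (e ^ (-s u d))`. -/
noncomputable def expSum (g : ℝ → ℝ) (s : ℝ) : ℝ :=
  s ^ τ * ∑' d, w d * Real.exp (-(s * u d)) * g (Real.exp (-(s * u d)))

/-- The limiting functional of `expSum`. -/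
noncomputable def gammaInt (g : ℝ → ℝ) : ℝ :=
  ∫ v in Ioi (0 : ℝ), v ^ (τ - 1) * Real.exp (-v) * g (Real.exp (-v))

variable {w u τ}
variable (hw : ∀ d, 0 ≤ w d) (hu : ∀ d, 0 ≤ u d) (hτ : 0 < τ)
  (hsum : ∀ s > 0, Summable fun d ↦ w d * Real.exp (-(s * u d)))

include hw hu hsum in
lemma summable_expSum {g : ℝ → ℝ} {B : ℝ} (hB : ∀ x ∈ Icc (0 : ℝ) 1, |g x| ≤ B) {s : ℝ}
    (hs : 0 < s) :
    Summable fun d ↦ w d * Real.exp (-(s * u d)) * g (Real.exp (-(s * u d))) := by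
  refine Summable.of_norm_bounded ((hsum s hs).mul_right B) fun d ↦ ?_
  rw [norm_mul, Real.norm_of_nonneg (mul_nonneg (hw d) (Real.exp_pos _).le)]
  refine mul_le_mul_of_nonneg_left (hB _ ⟨(Real.exp_pos _).le, ?_⟩)
    (mul_nonneg (hw d) (Real.exp_pos _).le)
  exact Real.exp_le_one_iff.mpr (neg_nonpos.mpr (mul_nonneg hs.le (hu d)))

include hw hu hsum in
lemma expSum_mono {g₁ g₂ : ℝ → ℝ} {B : ℝ} (h1 : ∀ x ∈ Icc (0 : ℝ) 1, |g₁ x| ≤ B)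
    (h2 : ∀ x ∈ Icc (0 : ℝ) 1, |g₂ x| ≤ B) (h : ∀ x ∈ Icc (0 : ℝ) 1, g₁ x ≤ g₂ x) {s : ℝ}
    (hs : 0 < s) : expSum w u τ g₁ s ≤ expSum w u τ g₂ s := by
  refine mul_le_mul_of_nonneg_left ?_ (Real.rpow_nonneg hs.le _)
  refine Summable.tsum_le_tsum (fun d ↦ ?_) (summable_expSum hw hu hsum h1 hs)
    (summable_expSum hw hu hsum h2 hs)
  refine mul_le_mul_of_nonneg_left (h _ ⟨(Real.exp_pos _).le, ?_⟩)
    (mul_nonneg (hw d) (Real.exp_pos _).le)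
  exact Real.exp_le_one_iff.mpr (neg_nonpos.mpr (mul_nonneg hs.le (hu d)))

include hτ in
lemma integrable_gamma : IntegrableOn (fun v : ℝ ↦ v ^ (τ - 1) * Real.exp (-v)) (Ioi 0) := by
  simpa [mul_comm] using Real.GammaIntegral_convergent hτ

include hτ in
lemma integrable_gammaInt {g : ℝ → ℝ} (hg : Measurable g) {B : ℝ}
    (hB : ∀ x ∈ Icc (0 : ℝ) 1, |g x| ≤ B) :
    IntegrableOn (fun v ↦ v ^ (τ - 1) * Real.exp (-v) * g (Real.exp (-v))) (Ioi 0) := by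
  refine (integrable_gamma hτ).mul_bdd (c := B)
    (hg.comp (by fun_prop)).aestronglyMeasurable ?_
  filter_upwards [ae_restrict_mem measurableSet_Ioi] with v hv
  exact hB _ ⟨(Real.exp_pos _).le, Real.exp_le_one_iff.mpr (neg_nonpos.mpr (le_of_lt hv))⟩

include hτ in
lemma gammaInt_mono {g₁ g₂ : ℝ → ℝ} (hg₁ : Measurable g₁) (hg₂ : Measurable g₂) {B : ℝ}
    (h1 : ∀ x ∈ Icc (0 : ℝ) 1, |g₁ x| ≤ B)
    (h2 : ∀ x ∈ Icc (0 : ℝ) 1, |g₂ x| ≤ B) (h : ∀ x ∈ Icc (0 : ℝ) 1, g₁ x ≤ g₂ x) :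
    gammaInt τ g₁ ≤ gammaInt τ g₂ := by
  refine setIntegral_mono_on (integrable_gammaInt hτ hg₁ h1) (integrable_gammaInt hτ hg₂ h2)
    measurableSet_Ioi fun v hv ↦ ?_
  refine mul_le_mul_of_nonneg_left
    (h _ ⟨(Real.exp_pos _).le, Real.exp_le_one_iff.mpr (neg_nonpos.mpr (le_of_lt hv))⟩)
    (mul_nonneg (Real.rpow_nonneg (le_of_lt hv) _) (Real.exp_pos _).le)

variable {C : ℝ} (hC : 0 < C)
  (hlim : Tendsto (fun s ↦ s ^ τ * ∑' d, w d * Real.exp (-(s * u d))) (𝓝[>] 0) (𝓝 C))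

lemma isBounded_polynomial (q : Polynomial ℝ) :
    ∃ B, ∀ x ∈ Icc (0 : ℝ) 1, |q.eval x| ≤ B :=
  isCompact_Icc.exists_bound_of_continuousOn q.continuous.continuousOn

include hτ in
lemma gammaInt_pow (k : ℕ) :
    gammaInt τ (fun x ↦ x ^ k) = (1 / (k + 1 : ℝ)) ^ τ * Real.Gamma τ := by
  rw [gammaInt, ← Real.integral_rpow_mul_exp_neg_mul_Ioi hτ (by positivity : (0 : ℝ) < k + 1)]
  refine setIntegral_congr_fun measurableSet_Ioi fun v _ ↦ ?_
  rw [← Real.exp_nat_mul, mul_assoc, ← Real.exp_add]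
  ring_nf

include hlim in
lemma tendsto_expSum_pow (k : ℕ) :
    Tendsto (expSum w u τ fun x ↦ x ^ k) (𝓝[>] 0) (𝓝 (C * (1 / (k + 1 : ℝ)) ^ τ)) := by
  have hk : (0 : ℝ) < k + 1 := by positivity
  have h1 : Tendsto (fun s : ℝ ↦ (k + 1) * s) (𝓝[>] 0) (𝓝[>] 0) := by
    refine tendsto_nhdsWithin_iff.mpr ⟨?_, ?_⟩
    · have : Continuous fun s : ℝ ↦ (k + 1) * s := by fun_prop
      simpa using (this.tendsto 0).mono_left nhdsWithin_le_nhds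
    · filter_upwards [self_mem_nhdsWithin] with s hs using mul_pos hk hs
  refine ((hlim.comp h1).mul_const ((1 / (k + 1 : ℝ)) ^ τ)).congr' ?_
  filter_upwards [self_mem_nhdsWithin] with s hs
  simp only [Function.comp_apply, expSum]
  rw [Real.mul_rpow hk.le (le_of_lt hs), Real.div_rpow zero_le_one hk.le, Real.one_rpow]
  have : ∀ d, w d * Real.exp (-((k + 1) * s * u d)) =
      w d * Real.exp (-(s * u d)) * Real.exp (-(s * u d)) ^ k := by
    intro d
    rw [← Real.exp_nat_mul, mul_assoc (w d), ← Real.exp_add]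
    ring_nf
  simp_rw [this]
  field_simp

include hw hu hτ hsum hlim in
lemma tendsto_expSum_polynomial (q : Polynomial ℝ) :
    Tendsto (expSum w u τ q.eval) (𝓝[>] 0) (𝓝 (C / Real.Gamma τ * gammaInt τ q.eval)) := by
  have hΓ := Real.Gamma_pos_of_pos hτ
  induction q using Polynomial.induction_on' with
  | add p q hp hq =>
    obtain ⟨B, hB⟩ := isBounded_polynomial p
    obtain ⟨B', hB'⟩ := isBounded_polynomial q
    have e1 : gammaInt τ (p + q).eval = gammaInt τ p.eval + gammaInt τ q.eval := by
      unfold gammaInt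
      rw [← integral_add (integrable_gammaInt hτ p.continuous.measurable hB)
        (integrable_gammaInt hτ q.continuous.measurable hB')]
      simp only [Polynomial.eval_add, mul_add]
    rw [e1, mul_add]
    refine (hp.add hq).congr' ?_
    filter_upwards [self_mem_nhdsWithin] with s hs
    unfold expSum
    rw [← mul_add, ← Summable.tsum_add (summable_expSum hw hu hsum hB hs)
      (summable_expSum hw hu hsum hB' hs)]
    simp only [Polynomial.eval_add, mul_add]
  | monomial k a =>
    have e1 : gammaInt τ (Polynomial.monomial k a).eval = a * gammaInt τ (fun x ↦ x ^ k) := by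
      unfold gammaInt
      rw [← integral_const_mul]
      congr 1
      ext v
      simp only [Polynomial.eval_monomial]
      ring
    have e2 : ∀ s, expSum w u τ (Polynomial.monomial k a).eval s =
        a * expSum w u τ (fun x ↦ x ^ k) s := by
      intro s
      unfold expSum
      rw [mul_left_comm, ← tsum_mul_left (a := a)]
      refine congrArg (s ^ τ * ·) (tsum_congr fun d ↦ ?_)
      simp only [Polynomial.eval_monomial]
      ring
    rw [e1, gammaInt_pow hτ, funext e2]
    convert (tendsto_expSum_pow hlim k).const_mul a using 2
    field_simp

include hw hu hτ hsum hC in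
lemma tendsto_expSum_of_sandwich {g : ℝ → ℝ} (hg : Measurable g) {B : ℝ}
    (hB : ∀ x ∈ Icc (0 : ℝ) 1, |g x| ≤ B)
    (h : ∀ ε > 0, ∃ g₁ g₂ : ℝ → ℝ, Measurable g₁ ∧ Measurable g₂ ∧
      (∃ B, ∀ x ∈ Icc (0 : ℝ) 1, |g₁ x| ≤ B ∧ |g₂ x| ≤ B) ∧
      (∀ x ∈ Icc (0 : ℝ) 1, g₁ x ≤ g x ∧ g x ≤ g₂ x) ∧
      gammaInt τ g₂ - gammaInt τ g₁ < ε ∧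
      Tendsto (expSum w u τ g₁) (𝓝[>] 0) (𝓝 (C / Real.Gamma τ * gammaInt τ g₁)) ∧
      Tendsto (expSum w u τ g₂) (𝓝[>] 0) (𝓝 (C / Real.Gamma τ * gammaInt τ g₂))) :
    Tendsto (expSum w u τ g) (𝓝[>] 0) (𝓝 (C / Real.Gamma τ * gammaInt τ g)) := by
  have hΓ := Real.Gamma_pos_of_pos hτ
  set c := C / Real.Gamma τ
  have hc : 0 < c := by positivity
  refine tendsto_order.mpr ⟨fun a ha ↦ ?_, fun a ha ↦ ?_⟩
  · obtain ⟨g₁, g₂, m1, m2, ⟨B', hb⟩, hle, hlt, t1, t2⟩ :=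
      h ((c * gammaInt τ g - a) / c) (div_pos (by linarith) hc)
    have hb1 : ∀ x ∈ Icc (0 : ℝ) 1, |g₁ x| ≤ max B B' := fun x hx ↦
      (hb x hx).1.trans (le_max_right _ _)
    have hb2 : ∀ x ∈ Icc (0 : ℝ) 1, |g₂ x| ≤ max B B' := fun x hx ↦
      (hb x hx).2.trans (le_max_right _ _)
    have hb0 : ∀ x ∈ Icc (0 : ℝ) 1, |g x| ≤ max B B' := fun x hx ↦
      (hB x hx).trans (le_max_left _ _)
    have h3 := gammaInt_mono hτ hg m2 hb0 hb2 fun x hx ↦ (hle x hx).2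
    rw [lt_div_iff₀ hc] at hlt
    have h4 : a < c * gammaInt τ g₁ := by nlinarith
    filter_upwards [t1.eventually_const_lt h4, self_mem_nhdsWithin] with s h5 hs
    exact h5.trans_le (expSum_mono hw hu hsum hb1 hb0 (fun x hx ↦ (hle x hx).1) hs)
  · obtain ⟨g₁, g₂, m1, m2, ⟨B', hb⟩, hle, hlt, t1, t2⟩ :=
      h ((a - c * gammaInt τ g) / c) (div_pos (by linarith) hc)
    have hb1 : ∀ x ∈ Icc (0 : ℝ) 1, |g₁ x| ≤ max B B' := fun x hx ↦
      (hb x hx).1.trans (le_max_right _ _)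
    have hb2 : ∀ x ∈ Icc (0 : ℝ) 1, |g₂ x| ≤ max B B' := fun x hx ↦
      (hb x hx).2.trans (le_max_right _ _)
    have hb0 : ∀ x ∈ Icc (0 : ℝ) 1, |g x| ≤ max B B' := fun x hx ↦
      (hB x hx).trans (le_max_left _ _)
    have h3 := gammaInt_mono hτ m1 hg hb1 hb0 fun x hx ↦ (hle x hx).1
    rw [lt_div_iff₀ hc] at hlt
    have h4 : c * gammaInt τ g₂ < a := by nlinarith
    filter_upwards [t2.eventually_lt_const h4, self_mem_nhdsWithin] with s h5 hs
    exact (expSum_mono hw hu hsum hb0 hb2 (fun x hx ↦ (hle x hx).2) hs).trans_lt h5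

lemma gammaInt_add_const {g : ℝ → ℝ} (hτ : 0 < τ) (hg : Measurable g) {B : ℝ}
    (hB : ∀ x ∈ Icc (0 : ℝ) 1, |g x| ≤ B) (a : ℝ) :
    gammaInt τ (fun x ↦ g x + a) = gammaInt τ g + a * Real.Gamma τ := by
  have h := gammaInt_pow hτ 0
  simp only [pow_zero, CharP.cast_eq_zero, zero_add, div_one, Real.one_rpow, one_mul] at h
  rw [← h]
  unfold gammaInt
  rw [← integral_const_mul, ← integral_add (integrable_gammaInt hτ hg hB)]
  · congr 1
    ext v
    ring
  · simpa using (integrable_gamma hτ).const_mul a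

include hw hu hτ hsum hC hlim in
lemma tendsto_expSum_continuous {g : ℝ → ℝ} (hg : Continuous g) :
    Tendsto (expSum w u τ g) (𝓝[>] 0) (𝓝 (C / Real.Gamma τ * gammaInt τ g)) := by
  have hΓ := Real.Gamma_pos_of_pos hτ
  obtain ⟨B, hB⟩ := isCompact_Icc.exists_bound_of_continuousOn (s := Icc (0 : ℝ) 1)
    hg.continuousOn
  refine tendsto_expSum_of_sandwich hw hu hτ hsum hC hg.measurable hB fun ε hε ↦ ?_
  set η := ε / (4 * Real.Gamma τ)
  have hη : 0 < η := by positivity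
  obtain ⟨q, hq⟩ := exists_polynomial_near_of_continuousOn 0 1 g hg.continuousOn η hη
  obtain ⟨B', hB'⟩ := isBounded_polynomial q
  have ev : ∀ a : ℝ, (fun x ↦ q.eval x + a) = (q + Polynomial.C a).eval := by
    intro a; ext x; simp
  have hle : ∀ x ∈ Icc (0 : ℝ) 1, q.eval x + -η ≤ g x ∧ g x ≤ q.eval x + η := fun x hx ↦ by
    have := abs_lt.mp (hq x hx)
    constructor <;> linarith
  refine ⟨fun x ↦ q.eval x + -η, fun x ↦ q.eval x + η, by fun_prop, by fun_prop,
    ⟨B' + η, fun x hx ↦ ⟨?_, ?_⟩⟩, hle, ?_, ?_, ?_⟩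
  · exact (abs_add_le _ _).trans (by rw [abs_neg, abs_of_pos hη]; linarith [hB' x hx])
  · exact (abs_add_le _ _).trans (by rw [abs_of_pos hη]; linarith [hB' x hx])
  · rw [gammaInt_add_const hτ q.continuous.measurable hB',
      gammaInt_add_const hτ q.continuous.measurable hB']
    have : η * Real.Gamma τ = ε / 4 := by simp only [η]; field_simp
    linarith
  · rw [ev]
    exact tendsto_expSum_polynomial hw hu hτ hsum hlim _
  · rw [ev]
    exact tendsto_expSum_polynomial hw hu hτ hsum hlim _

end

end Karamata

end

section

open MeasureTheory Set Topology

namespace Karamata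

section

/-- A continuous approximation to the indicator of `[e⁻¹, ∞)`, divided by `x`. -/
noncomputable def ramp (a η x : ℝ) : ℝ :=
  (max x (Real.exp (-1)))⁻¹ * max 0 (min 1 ((x - Real.exp (-1)) / η + a))

/-- The function `x⁻¹` cut off below `e⁻¹`. -/
noncomputable def cutInv (x : ℝ) : ℝ := if Real.exp (-1) ≤ x then x⁻¹ else 0

lemma continuous_ramp (a η : ℝ) : Continuous (ramp a η) := by
  unfold ramp
  refine Continuous.mul (Continuous.inv₀ (by fun_prop) fun x ↦ ?_) (by fun_prop)
  exact (lt_max_of_lt_right (Real.exp_pos _)).ne'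

lemma measurable_cutInv : Measurable cutInv :=
  Measurable.ite measurableSet_Ici measurable_inv measurable_const

lemma max_inv_le (x : ℝ) : (max x (Real.exp (-1)))⁻¹ ≤ Real.exp 1 := by
  rw [← inv_inv (Real.exp 1), ← Real.exp_neg]
  exact inv_anti₀ (Real.exp_pos _) (le_max_right _ _)

lemma max_inv_pos (x : ℝ) : 0 < (max x (Real.exp (-1)))⁻¹ :=
  inv_pos.mpr (lt_max_of_lt_right (Real.exp_pos _))

lemma ramp_nonneg (a η x : ℝ) : 0 ≤ ramp a η x :=
  mul_nonneg (max_inv_pos x).le (le_max_left _ _)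

lemma abs_ramp_le (a η x : ℝ) : |ramp a η x| ≤ Real.exp 1 := by
  rw [abs_of_nonneg (ramp_nonneg _ _ _)]
  refine (mul_le_of_le_one_right (max_inv_pos x).le ?_).trans (max_inv_le x)
  exact max_le zero_le_one (min_le_left _ _)

lemma abs_cutInv_le (x : ℝ) : |cutInv x| ≤ Real.exp 1 := by
  unfold cutInv
  split_ifs with h
  · rw [abs_of_pos (inv_pos.mpr ((Real.exp_pos _).trans_le h))]
    simpa [max_eq_left h] using max_inv_le x
  · simpa using (Real.exp_pos _).le

lemma ramp_zero_le {η : ℝ} (hη : 0 < η) (x : ℝ) : ramp 0 η x ≤ cutInv x := by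
  unfold ramp cutInv
  split_ifs with h
  · rw [max_eq_left h]
    exact mul_le_of_le_one_right (inv_pos.mpr ((Real.exp_pos _).trans_le h)).le
      (max_le zero_le_one (min_le_left _ _))
  · have : (x - Real.exp (-1)) / η ≤ 0 := div_nonpos_of_nonpos_of_nonneg (by linarith) hη.le
    rw [add_zero, max_eq_left ((min_le_right _ _).trans this), mul_zero]

lemma le_ramp_one {η : ℝ} (hη : 0 < η) (x : ℝ) : cutInv x ≤ ramp 1 η x := by
  unfold cutInv
  split_ifs with h
  · have : 0 ≤ (x - Real.exp (-1)) / η := div_nonneg (by linarith) hη.le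
    rw [ramp, max_eq_left h, min_eq_left (by linarith), max_eq_right zero_le_one, mul_one]
  · exact ramp_nonneg _ _ _

lemma ramp_eq {η x : ℝ} (hη : 0 < η) (h : η ≤ |x - Real.exp (-1)|) :
    ramp 1 η x = ramp 0 η x := by
  unfold ramp
  congr 1
  rcases le_abs.mp h with h | h
  · have : 1 ≤ (x - Real.exp (-1)) / η := (one_le_div hη).mpr h
    rw [min_eq_left (by linarith), min_eq_left (by linarith)]
  · have : (x - Real.exp (-1)) / η ≤ -1 := by
      rw [div_le_iff₀ hη]; linarith
    rw [max_eq_left ((min_le_right _ _).trans (by linarith)),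
      max_eq_left ((min_le_right _ _).trans (by linarith))]

variable {w u : ℕ → ℝ} {τ : ℝ}

lemma tendsto_gammaInt_ramp (hτ : 0 < τ) :
    Tendsto (fun η ↦ gammaInt τ (ramp 1 η) - gammaInt τ (ramp 0 η)) (𝓝[>] 0) (𝓝 0) := by
  have hi (a η : ℝ) := integrable_gammaInt hτ (continuous_ramp a η).measurable
    fun x _ ↦ abs_ramp_le a η x
  have e : ∀ η, gammaInt τ (ramp 1 η) - gammaInt τ (ramp 0 η) = ∫ v in Ioi (0 : ℝ),
      (v ^ (τ - 1) * Real.exp (-v) * ramp 1 η (Real.exp (-v)) -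
        v ^ (τ - 1) * Real.exp (-v) * ramp 0 η (Real.exp (-v))) := fun η ↦ by
    rw [integral_sub (hi 1 η) (hi 0 η)]; rfl
  rw [funext e, show 𝓝 (0 : ℝ) = 𝓝 (∫ _ in Ioi (0 : ℝ), (0 : ℝ)) by simp]
  refine tendsto_integral_filter_of_dominated_convergence
    (fun v ↦ 2 * Real.exp 1 * (v ^ (τ - 1) * Real.exp (-v)))
    (Eventually.of_forall fun η ↦ ((hi 1 η).sub (hi 0 η)).aestronglyMeasurable)
    (Eventually.of_forall fun η ↦ ?_) ((integrable_gamma hτ).const_mul _) ?_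
  · filter_upwards [ae_restrict_mem measurableSet_Ioi] with v hv
    have h0 : 0 ≤ v ^ (τ - 1) * Real.exp (-v) :=
      mul_nonneg (Real.rpow_nonneg (le_of_lt hv) _) (Real.exp_pos _).le
    rw [← mul_sub, norm_mul, Real.norm_of_nonneg h0, mul_comm]
    refine mul_le_mul_of_nonneg_right ((abs_sub _ _).trans ?_) h0
    rw [two_mul]
    exact add_le_add (abs_ramp_le _ _ _) (abs_ramp_le _ _ _)
  · have hne : ∀ᵐ v : ℝ ∂volume.restrict (Ioi 0), v ≠ 1 :=
      ae_restrict_of_ae (by simp [ae_iff])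
    filter_upwards [hne] with v hv
    refine tendsto_const_nhds.congr' ?_
    have : 0 < |Real.exp (-v) - Real.exp (-1)| := by
      rw [abs_pos, sub_ne_zero]
      simpa using hv
    filter_upwards [self_mem_nhdsWithin, nhdsWithin_le_nhds (Iio_mem_nhds this)] with η h1 h2
    rw [ramp_eq h1 (le_of_lt h2), sub_self]

lemma gammaInt_cutInv (hτ : 0 < τ) : gammaInt τ cutInv = 1 / τ := by
  have : ∀ v : ℝ, v ^ (τ - 1) * Real.exp (-v) * cutInv (Real.exp (-v)) =
      (Iic (1 : ℝ)).indicator (fun v ↦ v ^ (τ - 1)) v := by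
    intro v
    unfold cutInv
    simp only [indicator, mem_Iic, Real.exp_le_exp, neg_le_neg_iff]
    split_ifs
    · rw [mul_assoc, mul_inv_cancel₀ (Real.exp_pos _).ne', mul_one]
    · simp
  unfold gammaInt
  simp_rw [this]
  rw [setIntegral_indicator measurableSet_Iic, Ioi_inter_Iic,
    ← intervalIntegral.integral_of_le zero_le_one, integral_rpow (Or.inl (by linarith))]
  simp [hτ.ne']

lemma expSum_cutInv (s : ℝ) :
    expSum w u τ cutInv s = s ^ τ * ∑' d, if s * u d ≤ 1 then w d else 0 := by
  unfold expSum cutInv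
  congr 1
  refine tsum_congr fun d ↦ ?_
  simp only [Real.exp_le_exp, neg_le_neg_iff]
  split_ifs
  · rw [mul_assoc, mul_inv_cancel₀ (Real.exp_pos _).ne', mul_one]
  · simp

/-- **Karamata's Tauberian theorem** for weighted exponential sums. -/
theorem tendsto_sum_of_tendsto_laplace (hw : ∀ d, 0 ≤ w d) (hu : ∀ d, 0 ≤ u d) (hτ : 0 < τ)
    (hsum : ∀ s > 0, Summable fun d ↦ w d * Real.exp (-(s * u d))) {C : ℝ} (hC : 0 < C)
    (hlim : Tendsto (fun s ↦ s ^ τ * ∑' d, w d * Real.exp (-(s * u d))) (𝓝[>] 0) (𝓝 C)) :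
    Tendsto (fun T ↦ (∑' d, if u d ≤ T then w d else 0) / T ^ τ) atTop
      (𝓝 (C / Real.Gamma (τ + 1))) := by
  have h : Tendsto (expSum w u τ cutInv) (𝓝[>] 0)
      (𝓝 (C / Real.Gamma τ * gammaInt τ cutInv)) := by
    refine tendsto_expSum_of_sandwich hw hu hτ hsum hC measurable_cutInv
      (fun x _ ↦ abs_cutInv_le x) fun ε hε ↦ ?_
    obtain ⟨η, h1, h2⟩ := (((tendsto_gammaInt_ramp hτ).eventually_lt_const hε).and
      self_mem_nhdsWithin).exists
    exact ⟨ramp 0 η, ramp 1 η, (continuous_ramp _ _).measurable, (continuous_ramp _ _).measurable,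
      ⟨_, fun x _ ↦ ⟨abs_ramp_le _ _ _, abs_ramp_le _ _ _⟩⟩,
      fun x _ ↦ ⟨ramp_zero_le h2 x, le_ramp_one h2 x⟩, h1,
      tendsto_expSum_continuous hw hu hτ hsum hC hlim (continuous_ramp _ _),
      tendsto_expSum_continuous hw hu hτ hsum hC hlim (continuous_ramp _ _)⟩
  rw [gammaInt_cutInv hτ, ← mul_div_assoc, mul_one, div_div, mul_comm, ← Real.Gamma_add_one hτ.ne']
    at h
  refine (h.comp tendsto_inv_atTop_nhdsGT_zero).congr' ?_
  filter_upwards [eventually_gt_atTop 0] with T hT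
  simp only [Function.comp_apply, expSum_cutInv]
  rw [Real.inv_rpow hT.le, inv_mul_eq_div]
  congr 1
  refine tsum_congr fun d ↦ ?_
  simp only [inv_mul_le_iff₀ hT, mul_one]

end

end Karamata

end

section

open Topology

namespace SquarefreeCount

open scoped Classical

/-- The squarefree numbers all of whose prime factors lie in `P`. -/
def sqf (P : Set ℕ) : Set ℕ := {d | Squarefree d ∧ ∀ p, p.Prime → p ∣ d → p ∈ P}

variable {P : Set ℕ}

lemma zero_notMem_sqf : 0 ∉ sqf P := fun h ↦ not_squarefree_zero h.1

lemma one_mem_sqf : 1 ∈ sqf P :=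
  ⟨squarefree_one, fun _ hp h ↦ (hp.one_lt.ne' (Nat.dvd_one.mp h)).elim⟩

lemma mul_mem_sqf_iff {m n : ℕ} (h : m.Coprime n) : m * n ∈ sqf P ↔ m ∈ sqf P ∧ n ∈ sqf P := by
  unfold sqf
  simp only [Set.mem_ofPred_eq, Nat.squarefree_mul_iff]
  constructor
  · rintro ⟨⟨-, h1, h2⟩, h3⟩
    exact ⟨⟨h1, fun p hp hd ↦ h3 p hp (hd.mul_right _)⟩, ⟨h2,
        fun p hp hd ↦ h3 p hp (hd.mul_left _)⟩⟩
  · rintro ⟨⟨h1, h2⟩, h3, h4⟩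
    exact ⟨⟨h, h1, h3⟩, fun p hp hd ↦ (hp.dvd_mul.mp hd).elim (h2 p hp) (h4 p hp)⟩

lemma prime_mem_sqf_iff {p : ℕ} (hp : p.Prime) : p ∈ sqf P ↔ p ∈ P :=
  ⟨fun h ↦ h.2 p hp dvd_rfl, fun h ↦ ⟨hp.prime.squarefree,
    fun _ hq hd ↦ ((Nat.prime_dvd_prime_iff_eq hq hp).mp hd) ▸ h⟩⟩

lemma pow_notMem_sqf {p e : ℕ} (hp : p.Prime) (he : 2 ≤ e) : p ^ e ∉ sqf P := fun h ↦ by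
  have := h.1 p (by rw [← pow_two]; exact pow_dvd_pow p he)
  exact hp.one_lt.ne' (Nat.isUnit_iff.mp this)

/-- The general term of the Dirichlet series of `sqf P`. -/
noncomputable def term (P : Set ℕ) (σ : ℝ) (d : ℕ) : ℝ := if d ∈ sqf P then (d : ℝ) ^ (-σ) else 0

/-- The `p`-term of the prime Dirichlet series of `P`. -/
noncomputable def pterm (P : Set ℕ) (σ : ℝ) (p : Nat.Primes) : ℝ :=
  if (p : ℕ) ∈ P then (p : ℝ) ^ (-σ) else 0

lemma term_nonneg (σ : ℝ) (d : ℕ) : 0 ≤ term P σ d := by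
  unfold term; split_ifs <;> positivity

lemma pterm_nonneg (σ : ℝ) (p : Nat.Primes) : 0 ≤ pterm P σ p := by
  unfold pterm; split_ifs <;> positivity

lemma pterm_le (σ : ℝ) (p : Nat.Primes) : pterm P σ p ≤ (p : ℝ) ^ (-σ) := by
  unfold pterm; split_ifs
  · exact le_rfl
  · positivity

lemma summable_term {σ : ℝ} (hσ : 1 < σ) : Summable (term P σ) :=
  Summable.of_nonneg_of_le (term_nonneg σ) (fun d ↦ by
    unfold term; split_ifs
    · exact le_rfl
    · positivity) (Real.summable_nat_rpow.mpr (by linarith : -σ < -1))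

lemma summable_pterm {σ : ℝ} (hσ : 1 < σ) : Summable (pterm P σ) :=
  Summable.of_nonneg_of_le (pterm_nonneg σ) (pterm_le σ)
    (Nat.Primes.summable_rpow.mpr (by linarith))

lemma hasProd_term {σ : ℝ} (hσ : 1 < σ) :
    HasProd (fun p ↦ 1 + pterm P σ p) (∑' d, term P σ d) := by
  have h1 : term P σ 1 = 1 := by simp [term, one_mem_sqf]
  have := EulerProduct.eulerProduct_hasProd (f := term P σ) h1
    (fun {m n} h ↦ by
      unfold term
      rw [mul_mem_sqf_iff h, Nat.cast_mul, Real.mul_rpow (Nat.cast_nonneg _) (Nat.cast_nonneg _)]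
      by_cases hm : m ∈ sqf P <;> by_cases hn : n ∈ sqf P <;> simp [hm, hn])
    (summable_term hσ).norm (by simp [term, zero_notMem_sqf])
  have e : (fun p : Nat.Primes ↦ 1 + pterm P σ p) = fun p : Nat.Primes ↦
      ∑' e : ℕ, term P σ ((p : ℕ) ^ e) := by
    ext p
    rw [tsum_eq_sum (s := Finset.range 2)]
    · simp [Finset.sum_range_succ, h1]
      simp [term, pterm, prime_mem_sqf_iff p.2]
    · intro e he
      rw [Finset.mem_range, not_lt] at he
      rw [term, if_neg (pow_notMem_sqf p.2 he)]
  rw [e]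
  exact this

lemma abs_log_one_add_sub_le {x : ℝ} (hx : 0 ≤ x) : |Real.log (1 + x) - x| ≤ x ^ 2 := by
  have h1 := Real.le_log_one_add_of_nonneg hx
  have h2 := Real.log_le_sub_one_of_pos (by linarith : 0 < 1 + x)
  have h3 : x - x ^ 2 ≤ 2 * x / (x + 2) := by
    rw [le_div_iff₀ (by linarith)]
    nlinarith [pow_nonneg hx 3, pow_nonneg hx 2]
  rw [abs_le]
  constructor <;> linarith

lemma pterm_sq_le {σ : ℝ} (hσ : 1 < σ) (p : Nat.Primes) :
    pterm P σ p ^ 2 ≤ (p : ℝ) ^ (-2 : ℝ) := by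
  have hp : (1 : ℝ) ≤ p := by exact_mod_cast p.2.one_lt.le
  refine (pow_le_pow_left₀ (pterm_nonneg σ p) (pterm_le σ p) 2).trans ?_
  rw [← Real.rpow_mul_natCast (by positivity)]
  exact Real.rpow_le_rpow_of_exponent_le hp (by push_cast; linarith)

lemma summable_log_sub {σ : ℝ} (hσ : 1 < σ) :
    Summable fun p ↦ Real.log (1 + pterm P σ p) - pterm P σ p :=
  Summable.of_norm_bounded (Nat.Primes.summable_rpow.mpr (by norm_num)) fun p ↦
    (abs_log_one_add_sub_le (pterm_nonneg σ p)).trans (pterm_sq_le hσ p)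

lemma tsum_term_eq_exp {σ : ℝ} (hσ : 1 < σ) :
    ∑' d, term P σ d = Real.exp (∑' p, pterm P σ p +
      ∑' p, (Real.log (1 + pterm P σ p) - pterm P σ p)) := by
  rw [← (summable_pterm hσ).tsum_add (summable_log_sub hσ), ← (hasProd_term hσ).tprod_eq]
  simp only [add_sub_cancel]
  refine (Real.rexp_tsum_eq_tprod (fun p ↦ ?_) ?_).symm
  · linarith [pterm_nonneg (P := P) σ p]
  · simpa using (summable_pterm (P := P) hσ).add (summable_log_sub (P := P) hσ)

lemma continuous_pterm (p : Nat.Primes) : Continuous fun σ ↦ pterm P σ p := by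
  unfold pterm
  split_ifs
  · have : (0 : ℝ) < p := by exact_mod_cast p.2.pos
    exact Continuous.rpow continuous_const (by fun_prop) fun _ ↦ Or.inl this.ne'
  · exact continuous_const

lemma tendsto_log_sub :
    Tendsto (fun s ↦ ∑' p, (Real.log (1 + pterm P (1 + s) p) - pterm P (1 + s) p)) (𝓝[>] 0)
      (𝓝 (∑' p, (Real.log (1 + pterm P 1 p) - pterm P 1 p))) := by
  refine tendsto_tsum_of_dominated_convergence
    (Nat.Primes.summable_rpow.mpr (by norm_num : (-2 : ℝ) < -1)) (fun p ↦ ?_) ?_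
  · have h0 := (continuous_pterm (P := P) p)
    have : Continuous fun s ↦ Real.log (1 + pterm P (1 + s) p) - pterm P (1 + s) p :=
      (Continuous.log (by fun_prop) fun s ↦
        (by linarith [pterm_nonneg (P := P) (1 + s) p] : 0 < 1 + pterm P (1 + s) p).ne').sub
        (by fun_prop)
    simpa using (this.tendsto 0).mono_left nhdsWithin_le_nhds
  · filter_upwards [self_mem_nhdsWithin] with s hs p
    exact (abs_log_one_add_sub_le (pterm_nonneg _ p)).trans
      (pterm_sq_le (by simpa using hs) p)

/-- The sum of the reciprocals of the members of `sqf P` up to `x`. -/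
noncomputable def recipSum (P : Set ℕ) (x : ℝ) : ℝ :=
  ∑ d ∈ Finset.Icc 1 ⌊x⌋₊ with d ∈ sqf P, (d : ℝ)⁻¹

lemma tsum_eq_recipSum {x : ℝ} (hx : 1 ≤ x) :
    (∑' d : ℕ, if Real.log d ≤ Real.log x then term P 1 d else 0) = recipSum P x := by
  unfold recipSum
  rw [tsum_eq_sum (s := Finset.Icc 1 ⌊x⌋₊), Finset.sum_filter]
  · refine Finset.sum_congr rfl fun d hd ↦ ?_
    rw [Finset.mem_Icc, Nat.le_floor_iff (by linarith)] at hd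
    have : (0 : ℝ) < d := by exact_mod_cast hd.1
    rw [if_pos (Real.log_le_log this hd.2), term, Real.rpow_neg_one]
  · intro d hd
    rw [Finset.mem_Icc, Nat.le_floor_iff (by linarith), not_and_or, not_le, not_le,
      Nat.lt_one_iff] at hd
    rcases hd with rfl | hd
    · simp [term, zero_notMem_sqf]
    · rw [if_neg]
      rw [not_le]
      exact Real.log_lt_log (by linarith) hd

theorem exists_tendsto_recipSum {τ c : ℝ} (hτ : 0 < τ)
    (hD : Tendsto (fun s ↦ ∑' p, pterm P (1 + s) p + τ * Real.log s) (𝓝[>] 0) (𝓝 c)) :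
    ∃ C : ℝ, 0 < C ∧ Tendsto (fun x ↦ recipSum P x / Real.log x ^ τ) atTop (𝓝 C) := by
  have key : ∀ s : ℝ, ∀ d : ℕ, term P 1 d * Real.exp (-(s * Real.log d)) = term P (1 + s) d := by
    intro s d
    unfold term
    split_ifs with h
    · have : (0 : ℝ) < d := by
        exact_mod_cast Nat.pos_of_ne_zero (by rintro rfl; exact zero_notMem_sqf h)
      rw [neg_add, Real.rpow_add this, Real.rpow_def_of_pos this (-s)]
      ring_nf
    · simp
  have hlim : Tendsto (fun s ↦ s ^ τ * ∑' d, term P 1 d * Real.exp (-(s * Real.log d))) (𝓝[>] 0)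
      (𝓝 (Real.exp (c + ∑' p, (Real.log (1 + pterm P 1 p) - pterm P 1 p)))) := by
    refine ((Real.continuous_exp.tendsto _).comp (hD.add tendsto_log_sub)).congr' ?_
    filter_upwards [self_mem_nhdsWithin] with s hs
    have hs : 0 < s := hs
    simp only [key, Function.comp_apply]
    rw [tsum_term_eq_exp (by linarith), Real.rpow_def_of_pos hs, ← Real.exp_add]
    ring_nf
  have := Karamata.tendsto_sum_of_tendsto_laplace (w := term P 1) (u := fun d ↦ Real.log d)
    (term_nonneg 1) (fun d ↦ Real.log_natCast_nonneg d) hτ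
    (fun s hs ↦ by simpa only [key] using summable_term (by linarith)) (Real.exp_pos _) hlim
  refine ⟨_, div_pos (Real.exp_pos _) (Real.Gamma_pos_of_pos (by linarith)),
    (this.comp Real.tendsto_log_atTop).congr' ?_⟩
  filter_upwards [eventually_ge_atTop 1] with x hx
  simp only [Function.comp_apply, tsum_eq_recipSum hx]

end SquarefreeCount

end

section

open Topology

namespace SquarefreeCount

open scoped Classical

variable {P : Set ℕ}

/-- The logarithmically weighted count of the primes in `P` up to `x`. -/
noncomputable def theta (P : Set ℕ) (x : ℝ) : ℝ :=
  ∑ p ∈ Finset.Icc 1 ⌊x⌋₊ with p.Prime ∧ p ∈ P, Real.log p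

lemma card_filter_dvd {p N : ℕ} (hp : p.Prime) (hP : p ∈ P) :
    ((Finset.Icc 1 N).filter (· ∈ sqf P) |>.filter (p ∣ ·)).card =
      ((Finset.Icc 1 N).filter (· ∈ sqf P) |>.filter fun m ↦ m * p ≤ N ∧ ¬ p ∣ m).card := by
  symm
  have hcop : ∀ m, ¬ p ∣ m → (m * p ∈ sqf P ↔ m ∈ sqf P) := fun m hm ↦ by
    rw [mul_mem_sqf_iff ((hp.coprime_iff_not_dvd.mpr hm).symm), prime_mem_sqf_iff hp]
    exact and_iff_left hP
  refine Finset.card_bij (fun m _ ↦ m * p) ?_ ?_ ?_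
  · intro m hm
    simp only [Finset.mem_filter, Finset.mem_Icc] at hm ⊢
    exact ⟨⟨⟨Nat.mul_pos hm.1.1.1 hp.pos, hm.2.1⟩, (hcop m hm.2.2).mpr hm.1.2⟩, dvd_mul_left _ _⟩
  · intro a _ b _ h
    exact Nat.eq_of_mul_eq_mul_right hp.pos h
  · intro d hd
    simp only [Finset.mem_filter, Finset.mem_Icc] at hd
    obtain ⟨m, rfl⟩ := hd.2
    have hm : ¬ p ∣ m := fun h ↦
      hp.one_lt.ne' (Nat.isUnit_iff.mp (hd.1.2.1 p (mul_dvd_mul_left p h)))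
    rw [mul_comm] at hd
    have h0 : 0 < m := Nat.pos_of_ne_zero (by rintro rfl; simp at hm)
    refine ⟨m, ?_, mul_comm _ _⟩
    simp only [Finset.mem_filter, Finset.mem_Icc]
    exact ⟨⟨⟨h0, (Nat.le_mul_of_pos_right m hp.pos).trans hd.1.1.2⟩, (hcop m hm).mp hd.1.2⟩,
      hd.1.1.2, hm⟩

lemma card_filter_sq_le {p N : ℕ} (hp : 0 < p) (s : Finset ℕ) (hs : s ⊆ Finset.Icc 1 N) :
    ((s.filter fun m ↦ m * p ≤ N ∧ p ∣ m).card : ℝ) ≤ N / (p : ℝ) ^ 2 := by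
  have : (s.filter fun m ↦ m * p ≤ N ∧ p ∣ m).card ≤ (Finset.Icc 1 (N / p ^ 2)).card := by
    refine Finset.card_le_card_of_injOn (· / p) ?_ ?_
    · intro m hm
      simp only [Finset.coe_filter, Set.mem_ofPred_eq] at hm
      obtain ⟨h1, h2, m, rfl⟩ := hm
      have := Finset.mem_Icc.mp (hs h1)
      simp only [Finset.coe_Icc, Set.mem_Icc]
      rw [Nat.mul_div_cancel_left _ hp, Nat.le_div_iff_mul_le (by positivity)]
      exact ⟨Nat.pos_of_ne_zero (by rintro rfl; simp at this), by nlinarith⟩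
    · intro a ha b hb h
      simp only [Finset.coe_filter, Set.mem_ofPred_eq] at ha hb
      exact (Nat.div_left_inj ha.2.2 hb.2.2).mp h
  rw [Nat.card_Icc, Nat.add_sub_cancel] at this
  exact (Nat.cast_le.mpr this).trans (by exact_mod_cast Nat.cast_div_le (α := ℝ) (m := N) (n :=
      p ^ 2))

lemma summable_log_div_sq : Summable fun n : ℕ ↦ Real.log n / (n : ℝ) ^ 2 := by
  refine Summable.of_nonneg_of_le (fun n ↦ div_nonneg (Real.log_natCast_nonneg n) (by positivity))
    (fun n ↦ ?_) ((Real.summable_nat_rpow.mpr (by norm_num : (-3 / 2 : ℝ) < -1)).mul_left 2)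
  rcases Nat.eq_zero_or_pos n with rfl | hn
  · simp
  have hn' : (0 : ℝ) < n := by exact_mod_cast hn
  have := Real.log_le_rpow_div hn'.le (by norm_num : (0 : ℝ) < 1 / 2)
  rw [div_le_iff₀ (by positivity), mul_assoc, ← Real.rpow_natCast, ← Real.rpow_add hn']
  norm_num at this ⊢
  linarith

lemma abs_sum_log_sub_le (N : ℕ) :
    |∑ d ∈ Finset.Icc 1 N with d ∈ sqf P, Real.log d -
      ∑ m ∈ Finset.Icc 1 N with m ∈ sqf P, theta P (N / m)| ≤
        (∑' n : ℕ, Real.log n / (n : ℝ) ^ 2) * N := by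
  set D := (Finset.Icc 1 N).filter (· ∈ sqf P) with hD
  set Q := (Finset.Icc 1 N).filter fun p ↦ p.Prime ∧ p ∈ P with hQ
  have e1 : ∑ d ∈ D, Real.log d = ∑ p ∈ Q, Real.log p * (D.filter (p ∣ ·)).card := by
    have : ∀ d ∈ D, Real.log d = ∑ p ∈ Q, if p ∣ d then Real.log p else 0 := by
      intro d hd
      rw [hD, Finset.mem_filter, Finset.mem_Icc] at hd
      have h1 : (d : ℝ) = ∏ p ∈ d.primeFactors, (p : ℝ) := by
        rw [← Nat.cast_prod, Nat.prod_primeFactors_of_squarefree hd.2.1]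
      rw [← Finset.sum_filter, h1, Real.log_prod fun p hp ↦ by
        exact_mod_cast (Nat.prime_of_mem_primeFactors hp).ne_zero]
      refine Finset.sum_congr ?_ fun _ _ ↦ rfl
      ext p
      simp only [hQ, Finset.mem_filter, Nat.mem_primeFactors, Finset.mem_Icc]
      constructor
      · rintro ⟨h2, h3, h4⟩
        exact ⟨⟨⟨h2.pos, (Nat.le_of_dvd hd.1.1 h3).trans hd.1.2⟩, h2, hd.2.2 p h2 h3⟩, h3⟩
      · rintro ⟨⟨-, h2, -⟩, h3⟩
        exact ⟨h2, h3, by lia⟩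
    rw [Finset.sum_congr rfl this, Finset.sum_comm]
    refine Finset.sum_congr rfl fun p _ ↦ ?_
    rw [← Finset.sum_filter, Finset.sum_const, nsmul_eq_mul, mul_comm]
  have e2 : ∑ m ∈ D, theta P (N / m) =
      ∑ p ∈ Q, Real.log p * (D.filter fun m ↦ m * p ≤ N).card := by
    have : ∀ m ∈ D, theta P (N / m) = ∑ p ∈ Q, if m * p ≤ N then Real.log p else 0 := by
      intro m hm
      rw [hD, Finset.mem_filter, Finset.mem_Icc] at hm
      rw [theta, Nat.floor_div_natCast, Nat.floor_natCast, ← Finset.sum_filter]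
      refine Finset.sum_congr ?_ fun _ _ ↦ rfl
      ext p
      simp only [hQ, Finset.mem_filter, Finset.mem_Icc]
      rw [Nat.le_div_iff_mul_le hm.1.1, mul_comm]
      constructor
      · rintro ⟨⟨h1, h2⟩, h3⟩
        exact ⟨⟨⟨h1, (Nat.le_mul_of_pos_left p hm.1.1).trans h2⟩, h3⟩, h2⟩
      · rintro ⟨⟨⟨h1, -⟩, h3⟩, h2⟩
        exact ⟨⟨h1, h2⟩, h3⟩
    rw [Finset.sum_congr rfl this, Finset.sum_comm]
    refine Finset.sum_congr rfl fun p _ ↦ ?_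
    rw [← Finset.sum_filter, Finset.sum_const, nsmul_eq_mul, mul_comm]
  rw [e1, e2, ← Finset.sum_sub_distrib]
  refine (Finset.abs_sum_le_sum_abs _ _).trans ?_
  have e3 : ∀ p ∈ Q, |Real.log p * (D.filter (p ∣ ·)).card -
      Real.log p * (D.filter fun m ↦ m * p ≤ N).card| ≤ Real.log p / (p : ℝ) ^ 2 * N := by
    intro p hp
    rw [hQ, Finset.mem_filter] at hp
    have h1 := card_filter_dvd (N := N) hp.2.1 hp.2.2
    have h2 := Finset.card_filter_add_card_filter_not (s := D.filter fun m ↦ m * p ≤ N) (p ∣ ·)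
    rw [← hD] at h1
    rw [Finset.filter_filter (fun m ↦ m * p ≤ N), Finset.filter_filter (fun m ↦ m * p ≤ N)] at h2
    rw [← mul_sub, abs_mul, abs_of_nonneg (Real.log_natCast_nonneg p), div_mul_eq_mul_div,
      mul_div_assoc]
    refine mul_le_mul_of_nonneg_left ?_ (Real.log_natCast_nonneg p)
    rw [← h2, h1, Nat.cast_add, sub_add_cancel_right, abs_neg, Nat.abs_cast]
    exact card_filter_sq_le hp.2.1.pos D (Finset.filter_subset _ _)
  refine (Finset.sum_le_sum e3).trans ?_
  rw [← Finset.sum_mul]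
  exact mul_le_mul_of_nonneg_right (summable_log_div_sq.sum_le_tsum _ fun n _ ↦
    div_nonneg (Real.log_natCast_nonneg n) (by positivity)) (Nat.cast_nonneg _)

lemma sum_one_div_sqrt_le (N : ℕ) : ∑ n ∈ Finset.Icc 1 N, 1 / √(n : ℝ) ≤ 2 * √N := by
  induction N with
  | zero => simp
  | succ N ih =>
    rw [Finset.sum_Icc_succ_top (by lia)]
    push_cast
    have h0 : 0 < √((N : ℝ) + 1) := Real.sqrt_pos.mpr (by positivity)
    have h1 := Real.sq_sqrt (by positivity : (0 : ℝ) ≤ N + 1)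
    have h2 := Real.sq_sqrt (by positivity : (0 : ℝ) ≤ N)
    have : 1 / √((N : ℝ) + 1) ≤ 2 * √((N : ℝ) + 1) - 2 * √N := by
      rw [div_le_iff₀ h0]
      nlinarith [sq_nonneg (√((N : ℝ) + 1) - √N)]
    linarith

lemma abs_card_mul_log_sub_le {x : ℝ} (hx : 1 ≤ x) (s : Finset ℕ) (hs : s ⊆ Finset.Icc 1 ⌊x⌋₊) :
    |s.card * Real.log x - ∑ d ∈ s, Real.log d| ≤ 4 * x := by
  have h0 : ∀ d ∈ Finset.Icc 1 ⌊x⌋₊, 0 ≤ Real.log x - Real.log d ∧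
      Real.log x - Real.log d ≤ 2 * √x * (1 / √d) := by
    intro d hd
    rw [Finset.mem_Icc, Nat.le_floor_iff (by linarith)] at hd
    have hd0 : (0 : ℝ) < d := by exact_mod_cast hd.1
    refine ⟨sub_nonneg.mpr (Real.log_le_log hd0 hd.2), ?_⟩
    have := Real.log_le_rpow_div (by positivity : 0 ≤ x / d) (by norm_num : (0 : ℝ) < 1 / 2)
    rw [← Real.sqrt_eq_rpow, Real.sqrt_div (by linarith),
        Real.log_div (by linarith) hd0.ne'] at this
    refine this.trans (le_of_eq ?_)
    ring
  rw [← nsmul_eq_mul, ← Finset.sum_const, ← Finset.sum_sub_distrib,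
    abs_of_nonneg (Finset.sum_nonneg fun d hd ↦ (h0 d (hs hd)).1)]
  refine (Finset.sum_le_sum_of_subset_of_nonneg hs fun d hd _ ↦ (h0 d hd).1).trans ?_
  refine (Finset.sum_le_sum fun d hd ↦ (h0 d hd).2).trans ?_
  rw [← Finset.mul_sum]
  have h1 : √(⌊x⌋₊ : ℝ) ≤ √x := Real.sqrt_le_sqrt (Nat.floor_le (by linarith))
  have h2 := sum_one_div_sqrt_le ⌊x⌋₊
  have h3 := Real.sq_sqrt (by linarith : 0 ≤ x)
  calc _ ≤ 2 * √x * (2 * √x) := by gcongr; linarith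
    _ = 4 * x := by linear_combination 4 * h3

end SquarefreeCount

end

section

open Topology

namespace SquarefreeCount

open scoped Classical

variable {P : Set ℕ}

lemma theta_nonneg (x : ℝ) : 0 ≤ theta P x :=
  Finset.sum_nonneg fun _ _ ↦ Real.log_natCast_nonneg _

lemma theta_mono : Monotone (theta P) := fun _ _ h ↦
  Finset.sum_le_sum_of_subset_of_nonneg
    (Finset.filter_subset_filter _ (Finset.Icc_subset_Icc_right (Nat.floor_mono h)))
    fun _ _ _ ↦ Real.log_natCast_nonneg _

lemma exists_abs_theta_sub_le {τ : ℝ} (hτ : 0 < τ)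
    (hθ : Tendsto (fun x ↦ theta P x / x) atTop (𝓝 τ)) {ε : ℝ} (hε : 0 < ε) :
    ∃ B, 0 ≤ B ∧ ∀ y, 0 ≤ y → |theta P y - τ * y| ≤ ε * y + B := by
  obtain ⟨Y, hY⟩ := Metric.tendsto_atTop.mp hθ ε hε
  set Z := max Y 1
  have hZ : 0 < Z := lt_max_of_lt_right one_pos
  refine ⟨theta P Z + τ * Z, add_nonneg (theta_nonneg _) (by positivity), fun y hy ↦ ?_⟩
  rcases le_total Z y with h | h
  · have := hY y ((le_max_left Y 1).trans h)
    have hy0 : 0 < y := hZ.trans_le h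
    rw [Real.dist_eq, div_sub' hy0.ne', abs_div, abs_of_pos hy0, div_lt_iff₀ hy0] at this
    rw [mul_comm τ]
    have := add_nonneg (theta_nonneg (P := P) Z) (by positivity : 0 ≤ τ * Z)
    linarith
  · have h1 := theta_mono (P := P) h
    have h2 := theta_nonneg (P := P) y
    have h3 := theta_nonneg (P := P) Z
    have h4 : τ * y ≤ τ * Z := by gcongr
    have h5 : 0 ≤ ε * y := by positivity
    have h6 : 0 ≤ τ * y := by positivity
    rw [abs_le]
    constructor <;> linarith

lemma recipSum_nonneg (x : ℝ) : 0 ≤ recipSum P x :=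
  Finset.sum_nonneg fun _ _ ↦ by positivity

/-- The number of members of `sqf P` up to `x`. -/
noncomputable def count (P : Set ℕ) (x : ℝ) : ℕ :=
  ((Finset.Icc 1 ⌊x⌋₊).filter (· ∈ sqf P)).card

lemma abs_count_mul_log_sub_le {τ ε B : ℝ} (hτ : 0 < τ) (hε : 0 ≤ ε)
    (hB : 0 ≤ B) (h : ∀ y, 0 ≤ y → |theta P y - τ * y| ≤ ε * y + B) {x : ℝ} (hx : 1 ≤ x) :
    |count P x * Real.log x - τ * (x * recipSum P x)| ≤
      (4 + (∑' n : ℕ, Real.log n / (n : ℝ) ^ 2) + B) * x + ε * (x * recipSum P x) +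
        τ * recipSum P x := by
  set K := ∑' n : ℕ, Real.log n / (n : ℝ) ^ 2
  have hK : 0 ≤ K := tsum_nonneg fun n ↦
    div_nonneg (Real.log_natCast_nonneg n) (by positivity)
  set N := ⌊x⌋₊ with hN
  set D := (Finset.Icc 1 N).filter (· ∈ sqf P)
  have hNx : (N : ℝ) ≤ x := Nat.floor_le (by linarith)
  have hxN : x < N + 1 := Nat.lt_floor_add_one x
  have h1 := abs_card_mul_log_sub_le hx D (Finset.filter_subset _ _)
  have h2 := abs_sum_log_sub_le (P := P) N
  have hR := recipSum_nonneg (P := P) x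
  have e : N * recipSum P x = ∑ m ∈ D, (N : ℝ) / m := by
    rw [recipSum, Finset.mul_sum]; rfl
  have h3 : |∑ m ∈ D, theta P (N / m) - τ * (N * recipSum P x)| ≤
      ε * (N * recipSum P x) + B * N := by
    rw [e, Finset.mul_sum, ← Finset.sum_sub_distrib]
    refine (Finset.abs_sum_le_sum_abs _ _).trans
      ((Finset.sum_le_sum fun (m : ℕ) _ ↦ h (N / m) (div_nonneg (Nat.cast_nonneg _)
          (Nat.cast_nonneg _))).trans ?_)
    rw [Finset.sum_add_distrib, ← Finset.mul_sum, Finset.sum_const, nsmul_eq_mul, mul_comm B]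
    gcongr
    exact (Finset.card_filter_le _ _).trans (by simp)
  have h4 : |τ * (N * recipSum P x) - τ * (x * recipSum P x)| ≤ τ * recipSum P x := by
    rw [← mul_sub, ← sub_mul, abs_mul, abs_mul, abs_of_pos hτ, abs_of_nonneg hR]
    refine mul_le_mul_of_nonneg_left (mul_le_of_le_one_left hR ?_) hτ.le
    rw [abs_le]
    constructor <;> linarith
  have h5 : ε * (N * recipSum P x) ≤ ε * (x * recipSum P x) := by gcongr
  have h6 : B * N ≤ B * x := by gcongr
  have h7 : K * N ≤ K * x := by gcongr
  have e2 : count P x = D.card := rfl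
  rw [e2]
  rw [abs_le] at *
  constructor <;> linarith

theorem tendsto_count {τ c : ℝ} (hτ : 0 < τ)
    (hθ : Tendsto (fun x ↦ theta P x / x) atTop (𝓝 τ))
    (hD : Tendsto (fun s ↦ ∑' p, pterm P (1 + s) p + τ * Real.log s) (𝓝[>] 0) (𝓝 c)) :
    ∃ C : ℝ, 0 < C ∧
      Tendsto (fun X : ℝ ↦ (count P X : ℝ) / (C * X / Real.log X ^ (1 - τ))) atTop (𝓝 1) := by
  obtain ⟨C, hC, hlim⟩ := exists_tendsto_recipSum hτ hD
  have hR : Tendsto (recipSum P) atTop atTop := by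
    have := hlim.pos_mul_atTop hC ((tendsto_rpow_atTop hτ).comp Real.tendsto_log_atTop)
    refine this.congr' ?_
    filter_upwards [eventually_gt_atTop 1] with x hx
    have := Real.rpow_pos_of_pos (Real.log_pos hx) τ
    simp only [Function.comp_apply]
    field_simp
  have hA : Tendsto (fun x ↦ count P x * Real.log x / (x * recipSum P x)) atTop (𝓝 τ) := by
    rw [Metric.tendsto_nhds]
    intro ε hε
    obtain ⟨B, hB, h⟩ := exists_abs_theta_sub_le hτ hθ (by positivity : 0 < ε / 4)
    set K := 4 + (∑' n : ℕ, Real.log n / (n : ℝ) ^ 2) + B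
    filter_upwards [eventually_ge_atTop 1, hR.eventually_gt_atTop 0,
      hR.eventually_gt_atTop (K * 4 / ε), eventually_gt_atTop (τ * 4 / ε)] with x hx h0 h1 h2
    have hx0 : 0 < x := by linarith
    have := abs_count_mul_log_sub_le hτ (by positivity) hB h hx
    rw [Real.dist_eq, div_sub' (by positivity), abs_div, abs_of_pos (by positivity : 0 < x * _),
      div_lt_iff₀ (by positivity)]
    rw [div_lt_iff₀ hε] at h1 h2
    rw [mul_comm τ] at this
    have e1 : K * x ≤ ε / 4 * (x * recipSum P x) := by nlinarith
    have e2 : τ * recipSum P x ≤ ε / 4 * (x * recipSum P x) := by nlinarith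
    have e3 : 0 < ε / 4 * (x * recipSum P x) := by positivity
    linarith
  refine ⟨τ * C, by positivity, ?_⟩
  have := (hA.mul hlim).div_const (τ * C)
  rw [div_self (by positivity)] at this
  refine this.congr' ?_
  filter_upwards [eventually_gt_atTop 1, hR.eventually_gt_atTop 0] with x hx h0
  have hl := Real.log_pos hx
  have := Real.rpow_pos_of_pos hl τ
  rw [Real.rpow_sub hl, Real.rpow_one]
  field_simp

lemma count_eq_ncard (x : ℝ) :
    count P x = {d : ℕ | 0 < d ∧ (d : ℝ) ≤ x ∧ d ∈ sqf P}.ncard := by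
  rw [count, ← Set.ncard_coe_finset]
  congr 1
  ext d
  simp only [Finset.coe_filter, Finset.mem_Icc, Set.mem_ofPred_eq]
  constructor
  · rintro ⟨⟨h1, h2⟩, h3⟩
    exact ⟨h1, (Nat.le_floor_iff' (by lia)).mp h2, h3⟩
  · rintro ⟨h1, h2, h3⟩
    exact ⟨⟨h1, (Nat.le_floor_iff' (by lia)).mpr h2⟩, h3⟩

end SquarefreeCount

end

section

open Topology Set

namespace PrimeSeries

variable {b : ℕ → ℝ} {B θ : ℝ} {H R : ℂ → ℂ}

lemma lseriesSummable (hb : ∀ n, 0 ≤ b n) (hB : ∀ n, b n ≤ B) {s : ℂ} (hs : 1 < s.re) :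
    LSeriesSummable (fun n ↦ (b n : ℂ)) s :=
  LSeriesSummable_of_bounded_of_one_lt_re (m := B)
    (fun n _ ↦ by simpa [abs_of_nonneg (hb n)] using hB n) hs

lemma abscissa_lt (hb : ∀ n, 0 ≤ b n) (hB : ∀ n, b n ≤ B) {s : ℂ} (hs : 1 < s.re) :
    LSeries.abscissaOfAbsConv (fun n ↦ (b n : ℂ)) < s.re :=
  (LSeries.abscissaOfAbsConv_le_of_le_const
    ⟨B, fun n _ ↦ by simpa [abs_of_nonneg (hb n)] using hB n⟩).trans_lt (by exact_mod_cast hs)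

lemma re_term {n : ℕ} (hn : n ≠ 0) (s : ℂ) :
    (LSeries.term (fun n ↦ (b n : ℂ)) s n).re =
      b n * (n : ℝ) ^ (-s.re) * Real.cos (s.im * Real.log n) := by
  have hn0 : (0 : ℝ) < n := by positivity
  rw [LSeries.term_of_ne_zero hn, div_eq_mul_inv, ← Complex.cpow_neg,
    Complex.re_ofReal_mul, Complex.cpow_def_of_ne_zero (by exact_mod_cast hn),
    ← Complex.natCast_log, Complex.exp_re, Real.rpow_def_of_pos hn0]
  simp only [Complex.mul_re, Complex.mul_im, Complex.ofReal_re, Complex.ofReal_im, Complex.neg_re,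
    Complex.neg_im, zero_mul, sub_zero, add_zero]
  rw [show Real.log n * -s.im = -(s.im * Real.log n) by ring, Real.cos_neg, mul_assoc]

lemma re_comb_nonneg (hb : ∀ n, 0 ≤ b n) (hB : ∀ n, b n ≤ B) {σ : ℝ} (hσ : 1 < σ) (t : ℝ) :
    0 ≤ 3 * (LSeries (fun n ↦ (b n : ℂ)) σ).re +
      4 * (LSeries (fun n ↦ (b n : ℂ)) (σ + t * Complex.I)).re +
      (LSeries (fun n ↦ (b n : ℂ)) (σ + (2 * t : ℝ) * Complex.I)).re := by
  have h (s : ℂ) (hs : 1 < s.re) := Complex.hasSum_re (lseriesSummable hb hB hs).LSeriesHasSum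
  have h0 := h σ (by simpa using hσ)
  have h1 := h (σ + t * Complex.I) (by simpa using hσ)
  have h2 := h (σ + (2 * t : ℝ) * Complex.I) (by simpa using hσ)
  refine (((h0.mul_left 3).add (h1.mul_left 4)).add h2).nonneg fun n ↦ ?_
  rcases eq_or_ne n 0 with rfl | hn
  · simp
  rw [re_term hn, re_term hn, re_term hn]
  have e (u : ℝ) : (σ + u * Complex.I : ℂ).re = σ ∧ (σ + u * Complex.I : ℂ).im = u := by simp
  rw [(e t).1, (e t).2, (e (2 * t)).1, (e (2 * t)).2, Complex.ofReal_re, Complex.ofReal_im,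
      zero_mul,
    Real.cos_zero, mul_assoc 2, Real.cos_two_mul]
  have : 0 ≤ b n * (n : ℝ) ^ (-σ) := mul_nonneg (hb n) (by positivity)
  nlinarith [mul_nonneg this (sq_nonneg (1 + Real.cos (t * Real.log n)))]

theorem ne_zero_of_re_eq_one (hb : ∀ n, 0 ≤ b n) (hB : ∀ n, b n ≤ B) (hθ : θ < 1)
    (hH : DifferentiableOn ℂ H {s | θ < s.re}) (hR : DifferentiableOn ℂ R {s | θ < s.re})
    (h1 : H 1 ≠ 0)
    (hHR : ∀ s : ℂ, 1 < s.re →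
      H s = (s - 1) * Complex.exp (LSeries (fun n ↦ (b n : ℂ)) s + R s))
    (t : ℝ) : H (1 + t * Complex.I) ≠ 0 := by
  rcases eq_or_ne t 0 with rfl | ht
  · simpa using h1
  intro hz
  have hopen : IsOpen {s : ℂ | θ < s.re} := isOpen_lt continuous_const Complex.continuous_re
  have hd {F : ℂ → ℂ} (hF : DifferentiableOn ℂ F {s | θ < s.re}) (u : ℝ) :
      DifferentiableAt ℂ F (1 + u * Complex.I) :=
    hF.differentiableAt (hopen.mem_nhds (by simpa using hθ))
  have hpath (u : ℝ) : Tendsto (fun ε : ℝ ↦ (1 + ε + u * Complex.I : ℂ)) (𝓝[>] 0)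
      (𝓝 (1 + u * Complex.I)) := by
    have : Continuous fun ε : ℝ ↦ (1 + ε + u * Complex.I : ℂ) := by fun_prop
    simpa using (this.tendsto 0).mono_left nhdsWithin_le_nhds
  have hlim {F : ℂ → ℂ} (hF : DifferentiableOn ℂ F {s | θ < s.re}) (u : ℝ) :
      Tendsto (fun ε : ℝ ↦ F (1 + ε + u * Complex.I)) (𝓝[>] 0) (𝓝 (F (1 + u * Complex.I))) :=
    (hd hF u).continuousAt.tendsto.comp (hpath u)
  have hslope : Tendsto (fun ε : ℝ ↦ ‖H (1 + ε + t * Complex.I)‖ / ε) (𝓝[>] 0)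
      (𝓝 ‖deriv H (1 + t * Complex.I)‖) := by
    have h4 : HasDerivAt (fun z : ℂ ↦ (1 + z + t * Complex.I : ℂ)) 1 ((0 : ℝ) : ℂ) :=
      ((hasDerivAt_id _).const_add 1).add_const (t * Complex.I)
    have h5 : HasDerivAt H (deriv H (1 + t * Complex.I)) (1 + ((0 : ℝ) : ℂ) + t * Complex.I) := by
      rw [Complex.ofReal_zero, add_zero]
      exact (hd hH t).hasDerivAt
    have h6 := HasDerivAt.comp ((0 : ℝ) : ℂ) (h₂ := H) h5 h4
    rw [mul_one] at h6
    have h2 : HasDerivAt (fun ε : ℝ ↦ H (1 + ε + t * Complex.I)) (deriv H (1 + t * Complex.I)) 0 :=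
      h6.comp_ofReal
    have h3 := h2.tendsto_slope_zero_right.norm
    refine h3.congr' ?_
    filter_upwards [self_mem_nhdsWithin] with ε hε
    simp [hz, abs_of_pos (show 0 < ε from hε)]
    ring
  have hup : Tendsto (fun ε : ℝ ↦ ‖H (1 + ε + (0 : ℝ) * Complex.I)‖ ^ 3 *
      (‖H (1 + ε + t * Complex.I)‖ / ε) ^ 4 * ‖H (1 + ε + (2 * t : ℝ) * Complex.I)‖ * ε)
      (𝓝[>] 0) (𝓝 0) := by
    have h5 := ((((hlim hH 0).norm.pow 3).mul (hslope.pow 4)).mul (hlim hH (2 * t)).norm).mul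
      ((continuous_id.tendsto (0 : ℝ)).mono_left nhdsWithin_le_nhds)
    simpa using h5
  have hlow : Tendsto (fun ε : ℝ ↦ |t| ^ 4 * |2 * t| *
      Real.exp (3 * (R (1 + ε + (0 : ℝ) * Complex.I)).re + 4 * (R (1 + ε + t * Complex.I)).re +
        (R (1 + ε + (2 * t : ℝ) * Complex.I)).re)) (𝓝[>] 0)
      (𝓝 (|t| ^ 4 * |2 * t| *
      Real.exp (3 * (R (1 + (0 : ℝ) * Complex.I)).re + 4 * (R (1 + t * Complex.I)).re +
        (R (1 + (2 * t : ℝ) * Complex.I)).re))) := by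
    have hre (u : ℝ) := (Complex.continuous_re.tendsto _).comp (hlim hR u)
    exact ((Real.continuous_exp.tendsto _).comp ((((hre 0).const_mul 3).add
      ((hre t).const_mul 4)).add (hre (2 * t)))).const_mul _
  have hpos : 0 < |t| ^ 4 * |2 * t| := by positivity
  have := le_of_tendsto_of_tendsto hlow hup ?_
  · exact absurd this (not_le.mpr (mul_pos hpos (Real.exp_pos _)))
  filter_upwards [self_mem_nhdsWithin] with ε hε
  have hε : 0 < ε := hε
  have hn (u : ℝ) : ‖H (1 + ε + u * Complex.I)‖ = ‖(ε + u * Complex.I : ℂ)‖ *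
      Real.exp ((LSeries (fun n ↦ (b n : ℂ)) (1 + ε + u * Complex.I)).re +
        (R (1 + ε + u * Complex.I)).re) := by
    rw [hHR _ (by simpa using hε), norm_mul, Complex.norm_exp, Complex.add_re]
    congr 2
    ring
  have hge (u : ℝ) : |u| ≤ ‖(ε + u * Complex.I : ℂ)‖ := by
    simpa using Complex.abs_im_le_norm (ε + u * Complex.I : ℂ)
  have h0 : ‖(ε + (0 : ℝ) * Complex.I : ℂ)‖ = ε := by simp [hε.le]
  have hc := re_comb_nonneg hb hB (by linarith : 1 < 1 + ε) t
  rw [hn, hn, hn, h0]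
  set f := LSeries (fun n ↦ (b n : ℂ))
  set x := (R (1 + ε + (0 : ℝ) * Complex.I)).re
  set y := (R (1 + ε + t * Complex.I)).re
  set z := (R (1 + ε + (2 * t : ℝ) * Complex.I)).re
  have hc' : 0 ≤ 3 * (f (1 + ε + (0 : ℝ) * Complex.I)).re + 4 * (f (1 + ε + t * Complex.I)).re +
      (f (1 + ε + (2 * t : ℝ) * Complex.I)).re := by
    simpa using hc
  calc _ ≤ ‖(ε + t * Complex.I : ℂ)‖ ^ 4 * ‖(ε + (2 * t : ℝ) * Complex.I : ℂ)‖ *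
        Real.exp ((3 * (f (1 + ε + (0 : ℝ) * Complex.I)).re + 4 * (f (1 + ε + t * Complex.I)).re +
      (f (1 + ε + (2 * t : ℝ) * Complex.I)).re) + (3 * x + 4 * y + z)) := by
        refine mul_le_mul (by gcongr; exacts [hge t, hge (2 * t)])
          (Real.exp_le_exp.mpr (by linarith)) (Real.exp_pos _).le (by positivity)
    _ = _ := by
        rw [mul_pow, div_pow, mul_pow, ← Real.exp_nat_mul, ← Real.exp_nat_mul]
        rw [show ∀ p q r : ℝ, (3 * p + 4 * q + r) + (3 * x + 4 * y + z) =
          (3 : ℕ) * (p + x) + (4 : ℕ) * (q + y) + (r + z) from fun p q r ↦ by push_cast; ring,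
          Real.exp_add, Real.exp_add]
        field_simp

end PrimeSeries

end

section

open Topology Set MeasureTheory

namespace PrimeSeries

variable {b : ℕ → ℝ} {B θ : ℝ} {H R : ℂ → ℂ}

/-- The partial sums of `b n * log n`. -/
noncomputable def logSum (b : ℕ → ℝ) (x : ℝ) : ℝ := ∑ n ∈ Finset.Icc 1 ⌊x⌋₊, b n * Real.log n

lemma logSum_nonneg (hb : ∀ n, 0 ≤ b n) (x : ℝ) : 0 ≤ logSum b x :=
  Finset.sum_nonneg fun n _ ↦ mul_nonneg (hb n) (Real.log_natCast_nonneg n)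

lemma logSum_mono (hb : ∀ n, 0 ≤ b n) : Monotone (logSum b) := fun _ _ h ↦
  Finset.sum_le_sum_of_subset_of_nonneg (Finset.Icc_subset_Icc_right (Nat.floor_mono h))
    fun n _ _ ↦ mul_nonneg (hb n) (Real.log_natCast_nonneg n)

lemma logSum_le (hb : ∀ n, 0 ≤ b n) (hB : ∀ n, b n ≤ B) {ε : ℝ} (hε : 0 < ε) {x : ℝ} (hx : 0 < x) :
    logSum b x ≤ B / ε * x ^ (1 + ε) := by
  have hB0 : 0 ≤ B := (hb 0).trans (hB 0)
  have hfl : (⌊x⌋₊ : ℝ) ≤ x := Nat.floor_le hx.le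
  have h : ∀ n ∈ Finset.Icc 1 ⌊x⌋₊, b n * Real.log n ≤ B * (x ^ ε / ε) := by
    intro n hn
    rw [Finset.mem_Icc, Nat.le_floor_iff hx.le] at hn
    refine mul_le_mul (hB n) ?_ (Real.log_natCast_nonneg n) hB0
    refine (Real.log_le_rpow_div (Nat.cast_nonneg n) hε).trans ?_
    gcongr
    exact hn.2
  refine (Finset.sum_le_sum h).trans ?_
  rw [Finset.sum_const, nsmul_eq_mul, Nat.card_Icc, Nat.add_sub_cancel, Real.rpow_add hx,
    Real.rpow_one]
  calc (⌊x⌋₊ : ℝ) * (B * (x ^ ε / ε)) ≤ x * (B * (x ^ ε / ε)) := by gcongr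
    _ = _ := by ring

lemma integrableOn_logSum (hb : ∀ n, 0 ≤ b n) (hB : ∀ n, b n ≤ B) {σ : ℝ} (hσ : 1 < σ) :
    IntegrableOn (fun u ↦ logSum b (Real.exp u) * Real.exp (-(σ * u))) (Ioi 0) := by
  have hε : 0 < (σ - 1) / 2 := by linarith
  have hm : Monotone fun u ↦ logSum b (Real.exp u) := (logSum_mono hb).comp Real.exp_monotone
  refine Integrable.mono' ((exp_neg_integrableOn_Ioi 0 hε).const_mul (B / ((σ - 1) / 2)))
    (hm.measurable.mul (by fun_prop)).aestronglyMeasurable (ae_of_all _ fun u ↦ ?_)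
  rw [Real.norm_of_nonneg (mul_nonneg (logSum_nonneg hb _) (Real.exp_pos _).le)]
  refine (mul_le_mul_of_nonneg_right (logSum_le hb hB hε (Real.exp_pos u))
    (Real.exp_pos _).le).trans (le_of_eq ?_)
  rw [← Real.exp_mul, mul_assoc, ← Real.exp_add]
  ring_nf

lemma laplace_logSum (hb : ∀ n, 0 ≤ b n) (hB : ∀ n, b n ≤ B) {z : ℂ} (hz : 1 < z.re) :
    z * ∫ u in Ioi (0 : ℝ), (logSum b (Real.exp u) : ℂ) * Complex.exp (-(z * u)) =
      -deriv (LSeries fun n ↦ (b n : ℂ)) z := by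
  have hε : 0 < (z.re - 1) / 2 := by linarith
  rw [LSeries_deriv (abscissa_lt hb hB hz), neg_neg]
  have e : LSeries (LSeries.logMul fun n ↦ (b n : ℂ)) z =
      LSeries (fun n ↦ ((b n * Real.log n : ℝ) : ℂ)) z := by
    congr 1
    ext n
    simp [LSeries.logMul, mul_comm]
  rw [e, LSeries_eq_mul_integral_of_nonneg (r := 1 +
      (z.re - 1) / 2) _ (by linarith) (by linarith) ?_
    fun n ↦ mul_nonneg (hb n) (Real.log_natCast_nonneg n)]
  · congr 1
    rw [← Real.exp_zero, ← integral_comp_exp_Ioi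
      (fun t : ℝ ↦ (∑ k ∈ Finset.Icc 1 ⌊t⌋₊, ((b k * Real.log k : ℝ) : ℂ)) * (t : ℂ) ^ (-(z + 1)))]
    refine setIntegral_congr_fun measurableSet_Ioi fun u _ ↦ ?_
    simp only [logSum, Complex.ofReal_sum, Complex.real_smul]
    rw [Complex.cpow_def_of_ne_zero (by exact_mod_cast (Real.exp_pos u).ne'),
      ← Complex.ofReal_log (Real.exp_pos u).le, Real.log_exp, mul_left_comm, Complex.ofReal_exp,
      ← Complex.exp_add]
    ring_nf
  · refine Asymptotics.IsBigO.of_bound (B / ((z.re - 1) / 2)) ?_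
    filter_upwards [eventually_gt_atTop 0] with n hn
    have := logSum_le hb hB hε (by exact_mod_cast hn : (0 : ℝ) < n)
    have h2 := logSum_nonneg hb n
    simp only [logSum, Nat.floor_natCast] at this h2
    rwa [Real.norm_of_nonneg h2, Real.norm_of_nonneg (by positivity)]

section

variable (hb : ∀ n, 0 ≤ b n) (hB : ∀ n, b n ≤ B) (hθ : θ < 1)
    (hH : DifferentiableOn ℂ H {s | θ < s.re}) (hR : DifferentiableOn ℂ R {s | θ < s.re})
    (h1 : H 1 ≠ 0)
    (hHR : ∀ s : ℂ, 1 < s.re →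
      H s = (s - 1) * Complex.exp (LSeries (fun n ↦ (b n : ℂ)) s + R s))

include hb hB hθ hH hR h1 hHR

lemma ne_zero_of_one_le_re {z : ℂ} (hz : 1 ≤ z.re) : H z ≠ 0 := by
  rcases hz.eq_or_lt with h | h
  · have := ne_zero_of_re_eq_one hb hB hθ hH hR h1 hHR z.im
    rwa [show (1 + z.im * Complex.I : ℂ) = z by
      apply Complex.ext <;> simp [← h]] at this
  · rw [hHR z h]
    refine mul_ne_zero (sub_ne_zero.mpr ?_) (Complex.exp_ne_zero _)
    rintro rfl
    simp at h

/-- The **prime number theorem** for a bounded nonnegative sequence, given the analytic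
continuation of the exponential of its Dirichlet series. -/
theorem tendsto_logSum_div :
    Tendsto (fun x ↦ logSum b x / x) atTop (𝓝 1) := by
  have hopen : IsOpen {s : ℂ | θ < s.re} := isOpen_lt continuous_const Complex.continuous_re
  have hsub : {z : ℂ | 1 ≤ z.re} ⊆ {s | θ < s.re} := fun z hz ↦ hθ.trans_le hz
  have hne : ∀ z : ℂ, 1 ≤ z.re → z ≠ 0 := by
    rintro z hz rfl
    simp at hz
    linarith
  set G : ℂ → ℂ := fun z ↦ -1 / z + (deriv R z - deriv H z / H z) / z
  have hG : ContinuousOn G {z | 1 ≤ z.re} := by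
    have c1 := (hR.deriv hopen).continuousOn.mono hsub
    have c2 := (hH.deriv hopen).continuousOn.mono hsub
    have c3 := hH.continuousOn.mono hsub
    refine (continuousOn_const.div continuousOn_id hne).add
      ((c1.sub (c2.div c3 fun z hz ↦ ?_)).div continuousOn_id hne)
    exact ne_zero_of_one_le_re hb hB hθ hH hR h1 hHR hz
  have hL : ∀ z : ℂ, 1 < z.re →
      ∫ u in Ioi (0 : ℝ), (logSum b (Real.exp u) : ℂ) * Complex.exp (-(z * u)) =
        (1 : ℝ) / (z - 1) + G z := by
    intro z hz
    have hz0 := hne z hz.le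
    have hz1 : z - 1 ≠ 0 := sub_ne_zero.mpr (by rintro rfl; simp at hz)
    have h2 := laplace_logSum hb hB hz
    have hf := (LSeries_hasDerivAt (abscissa_lt hb hB hz)).differentiableAt.hasDerivAt
    have hR' := (hR.differentiableAt (hopen.mem_nhds (hsub hz.le))).hasDerivAt
    have h3 := ((hasDerivAt_id z).sub_const 1).mul (hf.add hR').cexp
    have h4 : deriv H z = _ := (h3.congr_of_eventuallyEq (by
      filter_upwards [(isOpen_lt continuous_const Complex.continuous_re).mem_nhds hz] with s hs
      exact hHR s hs)).deriv
    have h5 := hHR z hz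
    have h6 := Complex.exp_ne_zero (LSeries (fun n ↦ (b n : ℂ)) z + R z)
    have h7 : deriv H z / H z = 1 / (z - 1) + deriv (LSeries fun n ↦ (b n : ℂ)) z + deriv R z := by
      rw [h4, h5]
      simp only [Pi.add_apply, id_eq]
      field_simp
      ring
    rw [← mul_right_inj' hz0, h2]
    simp only [G, h7]
    field_simp
    push_cast
    ring
  have := WienerIkehara.tendsto_of_laplace (S := fun u ↦ logSum b (Real.exp u)) (A := 1)
    (fun u ↦ logSum_nonneg hb _) ((logSum_mono hb).comp Real.exp_monotone) hG
    (fun σ hσ ↦ integrableOn_logSum hb hB hσ) hL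
  refine (this.comp Real.tendsto_log_atTop).congr' ?_
  filter_upwards [eventually_gt_atTop 0] with x hx
  simp only [Function.comp_apply, Real.exp_neg, Real.exp_log hx, div_eq_mul_inv]

theorem exists_tendsto_tsum_add_log :
    ∃ c, Tendsto (fun s ↦ ∑' n : ℕ, b n * (n : ℝ) ^ (-(1 + s)) + Real.log s) (𝓝[>] 0) (𝓝 c) := by
  have hopen : IsOpen {s : ℂ | θ < s.re} := isOpen_lt continuous_const Complex.continuous_re
  have hpath : Tendsto (fun s : ℝ ↦ (1 + s : ℂ)) (𝓝[>] 0) (𝓝 1) := by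
    have : Continuous fun s : ℝ ↦ (1 + s : ℂ) := by fun_prop
    simpa using (this.tendsto 0).mono_left nhdsWithin_le_nhds
  have hlim {F : ℂ → ℂ} (hF : DifferentiableOn ℂ F {s | θ < s.re}) :
      Tendsto (fun s : ℝ ↦ F (1 + s)) (𝓝[>] 0) (𝓝 (F 1)) :=
    (hF.differentiableAt (hopen.mem_nhds (by simpa using hθ))).continuousAt.tendsto.comp hpath
  refine ⟨Real.log ‖H 1‖ - (R 1).re, ?_⟩
  refine (((hlim hH).norm.log (norm_ne_zero_iff.mpr h1)).sub
    ((Complex.continuous_re.tendsto _).comp (hlim hR))).congr' ?_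
  filter_upwards [self_mem_nhdsWithin] with s hs
  have hs : 0 < s := hs
  have hs1 : 1 < (1 + s : ℂ).re := by simpa using hs
  have e : (LSeries (fun n ↦ (b n : ℂ)) (1 + s)).re = ∑' n : ℕ, b n * (n : ℝ) ^ (-(1 + s)) := by
    rw [LSeries, Complex.re_tsum (lseriesSummable hb hB hs1)]
    refine tsum_congr fun n ↦ ?_
    rcases eq_or_ne n 0 with rfl | hn
    · rw [Nat.cast_zero, Real.zero_rpow (by linarith), mul_zero]
      simp
    · rw [re_term hn]
      simp
  simp only [Function.comp_apply]
  rw [hHR _ hs1, norm_mul, Complex.norm_exp, add_sub_cancel_left, Complex.norm_of_nonneg hs.le,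
    Real.log_mul hs.ne' (Real.exp_pos _).ne', Real.log_exp, Complex.add_re, e]
  ring

end

end PrimeSeries

end

section

open Topology Set MeasureTheory Asymptotics

namespace PrimeSeries

section

variable {a : ℕ → ℝ} {κ M r : ℝ}

/-- The truncated error term of the summatory function of `a` against `κ * t`. -/
noncomputable def errorTerm (a : ℕ → ℝ) (κ : ℝ) (t : ℝ) : ℂ :=
  (Ioi 1).indicator (fun t : ℝ ↦ ((∑ n ∈ Finset.Icc 1 ⌊t⌋₊, a n - κ * t : ℝ) : ℂ)) t

variable (ha : ∀ n, 0 ≤ a n) (hr0 : 0 ≤ r) (hr : r < 1)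
  (hA : ∀ t : ℝ, 1 ≤ t → |∑ n ∈ Finset.Icc 1 ⌊t⌋₊, a n - κ * t| ≤ M * t ^ r)

include hA in
lemma norm_errorTerm_le {t : ℝ} (ht : 0 < t) : ‖errorTerm a κ t‖ ≤ |M| * t ^ r := by
  unfold errorTerm
  by_cases h : t ∈ Ioi (1 : ℝ)
  · rw [indicator_of_mem h, Complex.norm_real, Real.norm_eq_abs]
    exact (hA t (le_of_lt h)).trans (by gcongr; exact le_abs_self M)
  · rw [indicator_of_notMem h, norm_zero]
    positivity

lemma measurable_sumFloor (a : ℕ → ℝ) :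
    Measurable fun t : ℝ ↦ ∑ n ∈ Finset.Icc 1 ⌊t⌋₊, a n :=
  (measurable_from_nat (f := fun m ↦ ∑ n ∈ Finset.Icc 1 m, a n)).comp Nat.measurable_floor

lemma measurable_errorTerm (a : ℕ → ℝ) (κ : ℝ) : Measurable (errorTerm a κ) := by
  refine Measurable.indicator ?_ measurableSet_Ioi
  exact Complex.measurable_ofReal.comp ((measurable_sumFloor a).sub (measurable_const_mul κ))

include hA in
lemma locallyIntegrableOn_errorTerm : LocallyIntegrableOn (errorTerm a κ) (Ioi 0) := by
  have h : LocallyIntegrableOn (fun t : ℝ ↦ |M| * t ^ r) (Ioi 0) := by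
    refine ContinuousOn.locallyIntegrableOn ?_ measurableSet_Ioi
    intro t ht
    exact (continuousAt_const.mul (Real.continuousAt_rpow_const _ _
      (Or.inl (ne_of_gt ht)))).continuousWithinAt
  refine h.mono (measurable_errorTerm a κ).aestronglyMeasurable (ae_of_all _ fun t ↦ ?_)
  rcases lt_or_ge 0 t with ht | ht
  · exact (norm_errorTerm_le hA ht).trans (le_abs_self _)
  · rw [errorTerm, indicator_of_notMem (by simpa using ht.trans zero_le_one), norm_zero]
    positivity

include hA in
lemma differentiableAt_mellin_errorTerm {s : ℂ} (hs : r < s.re) :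
    DifferentiableAt ℂ (mellin (errorTerm a κ)) (-s) := by
  refine mellin_differentiableAt_of_isBigO_rpow (a := -r) (b := -s.re - 1)
    (locallyIntegrableOn_errorTerm hA) ?_ (by simpa) ?_ (by simp)
  · refine IsBigO.of_bound |M| ?_
    filter_upwards [eventually_gt_atTop 0] with t ht
    rw [neg_neg, Real.norm_of_nonneg (by positivity)]
    exact norm_errorTerm_le hA ht
  · refine IsBigO.of_bound 1 ?_
    filter_upwards [Ioo_mem_nhdsGT (zero_lt_one (α := ℝ))] with t ht
    rw [errorTerm, indicator_of_notMem (by simpa using ht.2.le), norm_zero]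
    positivity

include hr in
lemma isBigO_sum (hA : ∀ t : ℝ, 1 ≤ t → |∑ n ∈ Finset.Icc 1 ⌊t⌋₊, a n - κ * t| ≤ M * t ^ r) :
    (fun n ↦ ∑ k ∈ Finset.Icc 1 n, a k) =O[atTop] fun n ↦ (n : ℝ) ^ (1 : ℝ) := by
  refine IsBigO.of_bound (|M| + |κ|) ?_
  filter_upwards [eventually_ge_atTop 1] with n hn
  have hn' : (1 : ℝ) ≤ n := by exact_mod_cast hn
  have h := hA n hn'
  rw [Nat.floor_natCast] at h
  have h2 : (n : ℝ) ^ r ≤ n := by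
    simpa using Real.rpow_le_rpow_of_exponent_le hn' hr.le
  rw [Real.rpow_one, Real.norm_eq_abs, Real.norm_of_nonneg (by positivity)]
  calc |∑ k ∈ Finset.Icc 1 n, a k| = |(∑ k ∈ Finset.Icc 1 n, a k - κ * n) + κ * n| := by ring_nf
    _ ≤ |∑ k ∈ Finset.Icc 1 n, a k - κ * n| + |κ * n| := abs_add_le _ _
    _ ≤ |M| * n + |κ| * n := by
      rw [abs_mul, abs_of_nonneg (by positivity : (0 : ℝ) ≤ n)]
      gcongr
      exact h.trans (mul_le_mul (le_abs_self M) h2 (by positivity) (abs_nonneg M))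
    _ = _ := by ring

include ha hr hA in
lemma lseriesSummable_of_sum {s : ℂ} (hs : 1 < s.re) :
    LSeriesSummable (fun n ↦ (a n : ℂ)) s :=
  LSeriesSummable_of_sum_norm_bigO_and_nonneg (isBigO_sum hr hA) ha zero_le_one hs

include ha hr hA in
lemma lseries_eq_of_sum {s : ℂ} (hs : 1 < s.re) :
    (s - 1) * LSeries (fun n ↦ (a n : ℂ)) s =
      s * κ + s * (s - 1) * mellin (errorTerm a κ) (-s) := by
  have hs1 : s - 1 ≠ 0 := by
    intro h
    rw [sub_eq_zero] at h
    simp [h] at hs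
  have hI2 : IntegrableOn (fun t : ℝ ↦ (κ : ℂ) * (t : ℂ) ^ (-s)) (Ioi 1) :=
    (integrableOn_Ioi_cpow_of_lt (by simpa using hs) one_pos).const_mul _
  have hI1 : IntegrableOn (fun t : ℝ ↦ (t : ℂ) ^ (-s - 1) * errorTerm a κ t) (Ioi 1) := by
    have h : IntegrableOn (fun t : ℝ ↦ |M| * t ^ (r - s.re - 1)) (Ioi 1) :=
      (integrableOn_Ioi_rpow_of_lt (by linarith) one_pos).const_mul _
    refine h.mono' ?_ ?_
    · refine AEStronglyMeasurable.mul ?_ (measurable_errorTerm a κ).aestronglyMeasurable.restrict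
      refine ContinuousOn.aestronglyMeasurable (fun t ht ↦ ?_) measurableSet_Ioi
      exact (Complex.continuousAt_ofReal_cpow_const _ _
        (Or.inr (zero_lt_one.trans ht).ne')).continuousWithinAt
    · rw [ae_restrict_iff' measurableSet_Ioi]
      refine ae_of_all _ fun t ht ↦ ?_
      have ht0 : 0 < t := zero_lt_one.trans ht
      rw [norm_mul, Complex.norm_cpow_eq_rpow_re_of_pos ht0]
      calc t ^ (-s - 1).re * ‖errorTerm a κ t‖ ≤ t ^ (-s - 1).re * (|M| * t ^ r) := by
            gcongr
            exact norm_errorTerm_le hA ht0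
        _ = |M| * (t ^ (-s - 1).re * t ^ r) := by ring
        _ = _ := by
            rw [← Real.rpow_add ht0]
            congr 2
            simp
            ring
  have hm : mellin (errorTerm a κ) (-s) =
      ∫ t in Ioi (1 : ℝ), (t : ℂ) ^ (-s - 1) * errorTerm a κ t := by
    rw [mellin]
    simp only [smul_eq_mul]
    refine (setIntegral_eq_of_subset_of_forall_sdiff_eq_zero measurableSet_Ioi
      (Ioi_subset_Ioi zero_le_one) fun t ht ↦ ?_)
    rw [errorTerm, indicator_of_notMem ht.2, mul_zero]
  have key : ∫ t in Ioi (1 : ℝ), (∑ k ∈ Finset.Icc 1 ⌊t⌋₊, (a k : ℂ)) * t ^ (-(s + 1)) =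
      mellin (errorTerm a κ) (-s) + κ * (1 / (s - 1)) := by
    have e : (1 / (s - 1) : ℂ) = ∫ t in Ioi (1 : ℝ), (t : ℂ) ^ (-s) := by
      rw [integral_Ioi_cpow_of_lt (by simpa using hs) one_pos]
      rw [Complex.ofReal_one, Complex.one_cpow, neg_div, ← div_neg]
      congr 1
      ring
    rw [e, ← integral_const_mul, hm, ← integral_add hI1 hI2]
    refine setIntegral_congr_fun measurableSet_Ioi fun t ht ↦ ?_
    have ht0 : (t : ℂ) ≠ 0 := Complex.ofReal_ne_zero.mpr (zero_lt_one.trans ht).ne'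
    simp only [errorTerm]
    rw [indicator_of_mem ht, show -(s + 1) = -s - 1 by ring, Complex.cpow_sub _ _ ht0,
      Complex.cpow_one]
    push_cast
    field_simp
    ring
  rw [LSeries_eq_mul_integral_of_nonneg a zero_le_one hs (isBigO_sum hr hA) ha, key]
  field_simp
  ring

include ha hr hA in
/-- The Dirichlet series of a nonnegative sequence with summatory function `κ t + O(t ^ r)`
extends meromorphically to `r < re s`, with a simple pole at `1` of residue `κ`. -/
theorem exists_continuation : ∃ H : ℂ → ℂ, DifferentiableOn ℂ H {s | r < s.re} ∧ H 1 = κ ∧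
    ∀ s : ℂ, 1 < s.re → H s = (s - 1) * LSeries (fun n ↦ (a n : ℂ)) s := by
  refine ⟨fun s ↦ s * κ + s * (s - 1) * mellin (errorTerm a κ) (-s), fun s hs ↦ ?_, by simp,
    fun s hs ↦ (lseries_eq_of_sum ha hr hA hs).symm⟩
  have h1 : DifferentiableAt ℂ (fun s ↦ mellin (errorTerm a κ) (-s)) s :=
    (differentiableAt_mellin_errorTerm hA hs).comp s differentiableAt_id.neg
  refine DifferentiableAt.differentiableWithinAt ?_
  fun_prop

end

end PrimeSeries

end

section

open Topology Set IsDedekindDomain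

section Fiberwise

variable {ι : Type*} {g : ι → ℕ}

lemma summable_comp_of_card_mul (hfin : ∀ n, Finite {i // g i = n}) {u : ℕ → ℝ} (hu : ∀ n, 0 ≤ u n)
    (h : Summable fun n ↦ (Nat.card {i // g i = n} : ℝ) * u n) : Summable fun i ↦ u (g i) := by
  rw [← (Equiv.sigmaFiberEquiv g).summable_iff]
  refine (summable_sigma_of_nonneg fun x ↦ hu (g (Equiv.sigmaFiberEquiv g x))).mpr ?_
  have e : ∀ (n : ℕ) (i : {i // g i = n}),
      ((fun i ↦ u (g i)) ∘ Equiv.sigmaFiberEquiv g) ⟨n, i⟩ = u n := fun n i ↦ by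
    simp [Equiv.sigmaFiberEquiv, i.2]
  refine ⟨fun n ↦ ?_, ?_⟩
  · have := Fintype.ofFinite {i // g i = n}
    exact (hasSum_fintype _).summable
  · refine h.congr fun n ↦ ?_
    rw [← nsmul_eq_mul, ← tsum_const]
    exact (tsum_congr (e n)).symm

lemma tsum_comp_eq_tsum_card_mul {F : ℕ → ℂ} (h : Summable fun i ↦ F (g i)) :
    ∑' i, F (g i) = ∑' n, (Nat.card {i // g i = n} : ℂ) * F n := by
  rw [← (Equiv.sigmaFiberEquiv g).tsum_eq]
  refine (Summable.tsum_sigma ((Equiv.sigmaFiberEquiv g).summable_iff.mpr h)).trans ?_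
  simp only [Function.comp_apply]
  refine tsum_congr fun n ↦ ?_
  have e : ∀ i : {i // g i = n}, F (g (Equiv.sigmaFiberEquiv g ⟨n, i⟩)) = F n := fun i ↦ by
    simp [Equiv.sigmaFiberEquiv, i.2]
  simp only [e]
  rw [tsum_const, nsmul_eq_mul]

end Fiberwise

namespace IdealEuler

variable {R : Type*} [CommRing R] [IsDedekindDomain R]

open scoped Classical in
/-- The restriction of a function on ideals to those coprime to a finite set of primes. -/
noncomputable def coprimePart (f : Ideal R → ℂ) (T : Finset (HeightOneSpectrum R)) (I : Ideal R) :
    ℂ := if ∀ 𝔭 ∈ T, ¬ 𝔭.asIdeal ∣ I then f I else 0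

variable {f : Ideal R →*₀ ℂ}

omit [IsDedekindDomain R] in
lemma norm_coprimePart_le (T : Finset (HeightOneSpectrum R)) (I : Ideal R) :
    ‖coprimePart f T I‖ ≤ ‖f I‖ := by
  unfold coprimePart
  split_ifs <;> simp

omit [IsDedekindDomain R] in
lemma summable_coprimePart (hf : Summable fun I ↦ ‖f I‖) (T : Finset (HeightOneSpectrum R)) :
    Summable (coprimePart f T) :=
  Summable.of_norm_bounded hf (norm_coprimePart_le T)

lemma coprimePart_mul {T : Finset (HeightOneSpectrum R)} {𝔮 : HeightOneSpectrum R} (h𝔮 : 𝔮 ∉ T)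
    (J : Ideal R) : coprimePart f T (𝔮.asIdeal * J) = f 𝔮.asIdeal * coprimePart f T J := by
  unfold coprimePart
  have h : (∀ 𝔭 ∈ T, ¬ 𝔭.asIdeal ∣ 𝔮.asIdeal * J) ↔ ∀ 𝔭 ∈ T, ¬ 𝔭.asIdeal ∣ J := by
    refine forall₂_congr fun 𝔭 h𝔭 ↦ not_congr ?_
    rw [𝔭.prime.dvd_mul, or_iff_right]
    intro hdvd
    apply h𝔮
    rw [Ideal.dvd_iff_le] at hdvd
    have : 𝔮.asIdeal = 𝔭.asIdeal := 𝔮.isMaximal.eq_of_le 𝔭.isPrime.ne_top hdvd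
    rwa [HeightOneSpectrum.ext this]
  by_cases hJ : ∀ 𝔭 ∈ T, ¬ 𝔭.asIdeal ∣ J
  · rw [if_pos hJ, if_pos (h.mpr hJ), map_mul]
  · rw [if_neg hJ, if_neg (mt h.mp hJ), mul_zero]

open scoped Classical in
lemma tsum_coprimePart_insert (hf : Summable fun I ↦ ‖f I‖) {T : Finset (HeightOneSpectrum R)}
    {𝔮 : HeightOneSpectrum R} (h𝔮 : 𝔮 ∉ T) :
    ∑' I, coprimePart f (insert 𝔮 T) I = (1 - f 𝔮.asIdeal) * ∑' I, coprimePart f T I := by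
  have hS := summable_coprimePart hf
  have hinj : Function.Injective fun J : Ideal R ↦ 𝔮.asIdeal * J := fun J J' h ↦
    mul_left_cancel₀ (a := 𝔮.asIdeal) 𝔮.ne_bot h
  have h1 : ∑' I, (coprimePart f T I - coprimePart f (insert 𝔮 T) I) =
      ∑' J, coprimePart f T (𝔮.asIdeal * J) := by
    rw [← hinj.tsum_eq]
    · refine tsum_congr fun J ↦ ?_
      rw [sub_eq_self, coprimePart, if_neg]
      exact fun h ↦ h 𝔮 (Finset.mem_insert_self _ _) (dvd_mul_right _ _)
    · intro I hI
      by_contra h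
      apply hI
      rw [sub_eq_zero]
      have h' : ¬ 𝔮.asIdeal ∣ I := fun ⟨J, hJ⟩ ↦ h ⟨J, hJ.symm⟩
      unfold coprimePart
      refine if_congr ?_ rfl rfl
      simp [h']
  rw [(hS T).tsum_sub (hS _)] at h1
  simp only [coprimePart_mul h𝔮, tsum_mul_left] at h1
  linear_combination -h1

lemma tsum_coprimePart_eq_prod (hf : Summable fun I ↦ ‖f I‖) (T : Finset (HeightOneSpectrum R)) :
    ∑' I, coprimePart f T I = (∏ 𝔭 ∈ T, (1 - f 𝔭.asIdeal)) * ∑' I, f I := by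
  classical
  induction T using Finset.induction_on with
  | empty => simp [coprimePart]
  | insert 𝔮 T h ih => rw [tsum_coprimePart_insert hf h, ih, Finset.prod_insert h, mul_assoc]

lemma tendsto_tsum_coprimePart [Nonempty (HeightOneSpectrum R)] (hf : Summable fun I ↦ ‖f I‖) :
    Tendsto (fun T ↦ ∑' I, coprimePart f T I) atTop (𝓝 1) := by
  classical
  have h1 : ∑' I : Ideal R, (if I = ⊤ then (1 : ℂ) else 0) = 1 := by
    rw [tsum_eq_single ⊤ fun I hI ↦ if_neg hI, if_pos rfl]
  rw [← h1]
  refine tendsto_tsum_of_dominated_convergence hf (fun I ↦ ?_)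
    (Eventually.of_forall fun T I ↦ norm_coprimePart_le T I)
  split_ifs with hI
  · refine tendsto_const_nhds.congr fun T ↦ ?_
    rw [coprimePart, if_pos, hI, ← Ideal.one_eq_top, map_one]
    intro 𝔭 _ h
    rw [hI, Ideal.dvd_iff_le] at h
    exact 𝔭.isPrime.ne_top (top_le_iff.mp h)
  · obtain ⟨𝔭, h𝔭⟩ : ∃ 𝔭 : HeightOneSpectrum R, 𝔭.asIdeal ∣ I := by
      by_cases hb : I = ⊥
      · exact ⟨Classical.arbitrary _, hb ▸ dvd_zero _⟩
      · obtain ⟨M, hM, hIM⟩ := Ideal.exists_le_maximal I hI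
        exact ⟨⟨M, hM.isPrime, fun h ↦ hb (le_bot_iff.mp (h ▸ hIM))⟩, Ideal.dvd_iff_le.mpr hIM⟩
    refine tendsto_const_nhds.congr' ?_
    filter_upwards [eventually_ge_atTop {𝔭}] with T hT
    rw [coprimePart, if_neg]
    exact fun h ↦ h 𝔭 (hT (Finset.mem_singleton_self _)) h𝔭

omit [IsDedekindDomain R] in
lemma asIdeal_injective : Function.Injective (HeightOneSpectrum.asIdeal (R := R)) :=
  fun _ _ ↦ HeightOneSpectrum.ext

/-- The **Euler product** over the primes of a Dedekind domain, in logarithmic form. -/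
theorem exp_tsum_neg_log [Nonempty (HeightOneSpectrum R)] (hf : Summable fun I ↦ ‖f I‖)
    (h1 : ∀ 𝔭 : HeightOneSpectrum R, f 𝔭.asIdeal ≠ 1) :
    Complex.exp (∑' 𝔭 : HeightOneSpectrum R, -Complex.log (1 - f 𝔭.asIdeal)) = ∑' I, f I := by
  have hs : Summable fun 𝔭 : HeightOneSpectrum R ↦ f 𝔭.asIdeal :=
    (hf.comp_injective asIdeal_injective).of_norm
  have h : Tendsto (fun T : Finset (HeightOneSpectrum R) ↦ ∏ 𝔭 ∈ T, (1 - f 𝔭.asIdeal)) atTop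
      (𝓝 (Complex.exp (∑' 𝔭 : HeightOneSpectrum R, Complex.log (1 - f 𝔭.asIdeal)))) := by
    refine ((Complex.continuous_exp.tendsto _).comp hs.clog_one_sub.hasSum).congr fun T ↦ ?_
    rw [Function.comp_apply, Complex.exp_sum]
    exact Finset.prod_congr rfl fun 𝔭 _ ↦ Complex.exp_log (sub_ne_zero.mpr (h1 𝔭).symm)
  have h2 := tendsto_nhds_unique (h.mul_const (∑' I, f I))
    ((tendsto_tsum_coprimePart hf).congr (tsum_coprimePart_eq_prod hf))
  rw [tsum_neg, Complex.exp_neg]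
  exact inv_eq_of_mul_eq_one_right h2

end IdealEuler

end

section

open Topology Set IsDedekindDomain nonZeroDivisors

namespace IdealEuler

variable (K : Type*) [Field K] [NumberField K]

/-- The function `I ↦ N(I) ^ (-s)` on ideals. -/
noncomputable def normCpow {s : ℂ} (hs : s ≠ 0) : Ideal (𝓞 K) →*₀ ℂ where
  toFun I := (Ideal.absNorm I : ℂ) ^ (-s)
  map_zero' := by simp [hs]
  map_one' := by simp
  map_mul' I J := by rw [map_mul, Nat.cast_mul, Complex.natCast_mul_natCast_cpow]

lemma card_ideal_pos_le (t : ℝ) : ∑ n ∈ Finset.Icc 1 ⌊t⌋₊,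
    (Nat.card {I : Ideal (𝓞 K) // Ideal.absNorm I = n} : ℝ) =
      Nat.card {I : (Ideal (𝓞 K))⁰ // (Ideal.absNorm (I : Ideal (𝓞 K)) : ℝ) ≤ t} := by
  classical
  rw [← Nat.cast_sum]
  congr 1
  rcases lt_or_ge t 0 with ht | ht
  · rw [Nat.floor_of_nonpos ht.le, Finset.Icc_eq_empty (by norm_num), Finset.sum_empty, eq_comm,
      Nat.card_eq_zero]
    exact Or.inl ⟨fun I ↦ absurd I.2 (not_le.mpr (ht.trans_le (Nat.cast_nonneg _)))⟩
  · simp_rw [← Nat.le_floor_iff ht]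
    rw [← add_left_inj 1, ← Ideal.card_norm_le_eq_card_norm_le_add_one,
      show Finset.Icc 1 ⌊t⌋₊ = Finset.Ioc 0 ⌊t⌋₊ from Finset.Icc_succ_left_eq_Ioc _ _,
      show 1 = Nat.card {I : Ideal (𝓞 K) // Ideal.absNorm I = 0} by
        simp [Ideal.absNorm_eq_zero_iff],
      Finset.sum_Ioc_add_eq_sum_Icc ⌊t⌋₊.zero_le,
      ← Finset.card_preimage_eq_sum_card_image_eq (fun k _ ↦ Ideal.finite_setOfPred_absNorm_eq k)]
    simp [Set.coe_eq_subtype]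

/-- The Dirichlet series of the number of ideals of given norm. -/
theorem exists_continuation_zeta : ∃ r : ℝ, r < 1 ∧ ∃ H : ℂ → ℂ,
    DifferentiableOn ℂ H {s | r < s.re} ∧ H 1 ≠ 0 ∧ ∀ s : ℂ, 1 < s.re →
      LSeriesSummable (fun n ↦ (Nat.card {I : Ideal (𝓞 K) // Ideal.absNorm I = n} : ℂ)) s ∧
      H s = (s - 1) *
        LSeries (fun n ↦ (Nat.card {I : Ideal (𝓞 K) // Ideal.absNorm I = n} : ℂ)) s := by
  obtain ⟨κ, M, hκ, h⟩ := IdealCount.exists_abs_card_ideal_sub_le K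
  have hd : (0 : ℝ) < Module.finrank ℚ K := Nat.cast_pos.mpr Module.finrank_pos
  have hr : 1 - 1 / (2 * (Module.finrank ℚ K : ℝ)) < 1 := sub_lt_self _ (by positivity)
  have hA : ∀ t : ℝ, 1 ≤ t → |∑ n ∈ Finset.Icc 1 ⌊t⌋₊,
      (Nat.card {I : Ideal (𝓞 K) // Ideal.absNorm I = n} : ℝ) - κ * t| ≤
        M * t ^ (1 - 1 / (2 * (Module.finrank ℚ K : ℝ))) := fun t ht ↦ by
    rw [card_ideal_pos_le]
    exact h t ht
  obtain ⟨H, hH, h1, hHs⟩ := PrimeSeries.exists_continuation (fun n ↦ Nat.cast_nonneg _) hr hA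
  refine ⟨_, hr, H, hH, ?_, fun s hs ↦ ⟨?_, ?_⟩⟩
  · rw [h1]
    exact Complex.ofReal_ne_zero.mpr hκ.ne'
  · simpa using PrimeSeries.lseriesSummable_of_sum (fun n ↦ Nat.cast_nonneg _) hr hA hs
  · simpa using hHs s hs

variable {K}

lemma summable_norm_normCpow {s : ℂ} (hs : 1 < s.re) (h0 : s ≠ 0) :
    Summable fun I ↦ ‖normCpow K h0 I‖ := by
  obtain ⟨r, -, H, -, -, h⟩ := exists_continuation_zeta K
  have := (h s hs).1.norm
  refine summable_comp_of_card_mul (g := fun I : Ideal (𝓞 K) ↦ Ideal.absNorm I)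
    (u := fun n ↦ ‖(n : ℂ) ^ (-s)‖) (fun n ↦ Ideal.finite_setOfPred_absNorm_eq n)
    (fun n ↦ norm_nonneg _) (this.congr fun n ↦ ?_)
  rcases eq_or_ne n 0 with rfl | hn
  · simp [h0]
  · rw [LSeries.term_of_ne_zero hn, norm_div, Complex.cpow_neg, norm_inv, div_eq_mul_inv]
    simp

lemma tsum_normCpow {s : ℂ} (hs : 1 < s.re) (h0 : s ≠ 0) : ∑' I, normCpow K h0 I =
    LSeries (fun n ↦ (Nat.card {I : Ideal (𝓞 K) // Ideal.absNorm I = n} : ℂ)) s := by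
  refine (tsum_comp_eq_tsum_card_mul (g := fun I : Ideal (𝓞 K) ↦ Ideal.absNorm I)
    (F := fun n ↦ (n : ℂ) ^ (-s)) (summable_norm_normCpow hs h0).of_norm).trans ?_
  refine tsum_congr fun n ↦ ?_
  rcases eq_or_ne n 0 with rfl | hn
  · simp [h0]
  · rw [LSeries.term_of_ne_zero hn, Complex.cpow_neg, div_eq_mul_inv]

variable (K) in
lemma nonempty_heightOneSpectrum : Nonempty (HeightOneSpectrum (𝓞 K)) := by
  obtain ⟨M, hM⟩ := Ideal.exists_maximal (𝓞 K)
  exact ⟨⟨M, hM.isPrime, Ring.ne_bot_of_isMaximal_of_not_isField hM (RingOfIntegers.not_isField K)⟩⟩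

/-- The residue characteristic of a prime. -/
noncomputable def residueChar (𝔭 : HeightOneSpectrum (𝓞 K)) : ℕ := 𝔭.asIdeal.absNorm.minFac

lemma residueChar_spec (𝔭 : HeightOneSpectrum (𝓞 K)) : (residueChar 𝔭).Prime ∧
    (residueChar 𝔭 : 𝓞 K) ∈ 𝔭.asIdeal ∧
    ∃ n, 0 < n ∧ 𝔭.asIdeal.absNorm = residueChar 𝔭 ^ n := by
  have := 𝔭.isMaximal
  obtain ⟨p, n, hn, hp𝔭, hp, h⟩ := Ideal.exists_prime_and_absNorm_eq_pow 𝔭.asIdeal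
  have : residueChar 𝔭 = p := by
    rw [residueChar, h, hp.pow_minFac hn.ne']
  rw [this]
  exact ⟨hp, hp𝔭, n, hn, h⟩

lemma card_residueChar_le (p : ℕ) :
    Finite {𝔭 : HeightOneSpectrum (𝓞 K) // residueChar 𝔭 = p} ∧
    Nat.card {𝔭 : HeightOneSpectrum (𝓞 K) // residueChar 𝔭 = p} ≤ Module.finrank ℚ K := by
  by_cases hp : p.Prime
  swap
  · have : IsEmpty {𝔭 : HeightOneSpectrum (𝓞 K) // residueChar 𝔭 = p} :=
      ⟨fun 𝔭 ↦ hp (𝔭.2 ▸ (residueChar_spec 𝔭.1).1)⟩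
    exact ⟨inferInstance, by simp⟩
  have hp' : Prime (p : ℤ) := Nat.prime_iff_prime_int.mp hp
  have h0 : Ideal.span {(p : ℤ)} ≠ ⊥ := by simpa using hp.ne_zero
  have : (Ideal.span {(p : ℤ)}).IsPrime := (Ideal.span_singleton_prime hp'.ne_zero).mpr hp'
  have hmax : (Ideal.span {(p : ℤ)}).IsMaximal := this.isMaximal h0
  let φ : {𝔭 : HeightOneSpectrum (𝓞 K) // residueChar 𝔭 = p} →
      (Ideal.span {(p : ℤ)}).primesOver (𝓞 K) := fun 𝔭 ↦
    ⟨𝔭.1.asIdeal, 𝔭.1.isPrime, ⟨hmax.eq_of_le (𝔭.1.isPrime.under ℤ).ne_top (by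
      rw [Ideal.span_singleton_le_iff_mem, Ideal.mem_comap]
      have := (residueChar_spec 𝔭.1).2.1
      rw [𝔭.2] at this
      simpa using this)⟩⟩
  have hφ : Function.Injective φ := fun 𝔭 𝔮 h ↦
    Subtype.ext (HeightOneSpectrum.ext (congrArg Subtype.val h))
  refine ⟨Finite.of_injective φ hφ, (Nat.card_le_card_of_injective φ hφ).trans ?_⟩
  rw [← RingOfIntegers.rank K, ← Ideal.sum_ramification_inertia_eq_finrank (Ideal.span {(p : ℤ)}),
    Nat.card_eq_fintype_card, Fintype.card_eq_sum_ones]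
  refine Finset.sum_le_sum fun 𝔮 _ ↦ ?_
  have := 𝔮.2.1
  exact Nat.mul_pos (Ideal.ramificationIdx_pos _ _) (Ideal.inertiaDeg_pos _ _)

lemma summable_residueChar {σ : ℝ} (hσ : 1 < σ) :
    Summable fun 𝔭 : HeightOneSpectrum (𝓞 K) ↦ (residueChar 𝔭 : ℝ) ^ (-σ) := by
  refine summable_comp_of_card_mul (u := fun n : ℕ ↦ (n : ℝ) ^ (-σ))
    (fun n ↦ (card_residueChar_le n).1) (fun n ↦ by positivity) ?_
  refine Summable.of_nonneg_of_le (fun n ↦ by positivity) (fun n ↦ ?_)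
    ((Real.summable_nat_rpow.mpr (neg_lt_neg hσ)).mul_left (Module.finrank ℚ K : ℝ))
  gcongr
  exact (card_residueChar_le n).2

end IdealEuler

end

section

open Topology Set IsDedekindDomain

namespace IdealEuler

variable {K : Type*} [Field K] [NumberField K]

open scoped Classical in
/-- The number of primes of prime norm `n`. -/
noncomputable def degreeOneCount (K : Type*) [Field K] [NumberField K] (n : ℕ) : ℝ :=
  if n.Prime then Nat.card {𝔭 : HeightOneSpectrum (𝓞 K) // 𝔭.asIdeal.absNorm = n} else 0

open scoped Classical in
/-- The remainder of the logarithm of the Euler factor at a prime of norm `n`. -/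
noncomputable def eulerRemainder (n : ℕ) (s : ℂ) : ℂ :=
  -Complex.log (1 - (n : ℂ) ^ (-s)) - if n.Prime then (n : ℂ) ^ (-s) else 0

lemma degreeOneCount_nonneg (n : ℕ) : 0 ≤ degreeOneCount K n := by
  unfold degreeOneCount
  split_ifs <;> positivity

lemma finite_absNorm_eq (n : ℕ) :
    Finite {𝔭 : HeightOneSpectrum (𝓞 K) // 𝔭.asIdeal.absNorm = n} :=
  (Ideal.finite_setOfPred_absNorm_eq n).preimage asIdeal_injective.injOn

lemma degreeOneCount_le (n : ℕ) : degreeOneCount K n ≤ Module.finrank ℚ K := by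
  unfold degreeOneCount
  split_ifs with hn
  · rw [Nat.cast_le]
    have := (card_residueChar_le (K := K) n).1
    refine le_trans ?_ (card_residueChar_le (K := K) n).2
    refine Nat.card_le_card_of_injective (fun 𝔭 ↦ ⟨𝔭.1, ?_⟩) fun 𝔭 𝔮 h ↦ ?_
    · rw [residueChar, 𝔭.2, hn.minFac_eq]
    · simpa [Subtype.ext_iff] using h
  · positivity

lemma two_le_absNorm (𝔭 : HeightOneSpectrum (𝓞 K)) : 2 ≤ 𝔭.asIdeal.absNorm := by
  obtain ⟨hp, -, n, hn, h⟩ := residueChar_spec 𝔭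
  rw [h]
  exact hp.two_le.trans (Nat.le_self_pow hn.ne' _)

lemma norm_cpow_neg {n : ℕ} (hn : 2 ≤ n) (s : ℂ) : ‖(n : ℂ) ^ (-s)‖ = (n : ℝ) ^ (-s.re) := by
  rw [Complex.norm_natCast_cpow_of_pos (by omega), Complex.neg_re]

lemma norm_cpow_neg_le {n : ℕ} (hn : 2 ≤ n) {s : ℂ} (hs : 3 / 4 < s.re) :
    ‖(n : ℂ) ^ (-s)‖ ≤ (n : ℝ) ^ (-(3 / 4 : ℝ)) := by
  rw [norm_cpow_neg hn]
  have : (2 : ℝ) ≤ n := by exact_mod_cast hn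
  exact Real.rpow_le_rpow_of_exponent_le (by linarith) (by linarith)

lemma norm_cpow_neg_le_three_quarters {n : ℕ} (hn : 2 ≤ n) {s : ℂ} (hs : 3 / 4 < s.re) :
    ‖(n : ℂ) ^ (-s)‖ ≤ 3 / 4 := by
  refine (norm_cpow_neg_le hn hs).trans ?_
  have h2 : (2 : ℝ) ≤ n := by exact_mod_cast hn
  calc (n : ℝ) ^ (-(3 / 4 : ℝ)) ≤ 2 ^ (-(3 / 4 : ℝ)) :=
        Real.rpow_le_rpow_of_nonpos (by norm_num) h2 (by norm_num)
    _ ≤ 2 ^ (-(1 / 2 : ℝ)) := Real.rpow_le_rpow_of_exponent_le (by norm_num) (by norm_num)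
    _ ≤ 3 / 4 := by
      rw [Real.rpow_neg (by norm_num), ← Real.sqrt_eq_rpow, inv_le_comm₀ (by positivity)
        (by norm_num), Real.le_sqrt (by norm_num) (by norm_num)]
      norm_num

lemma norm_neg_log_sub_le {z : ℂ} (hz : ‖z‖ ≤ 3 / 4) :
    ‖-Complex.log (1 - z) - z‖ ≤ 2 * ‖z‖ ^ 2 := by
  have h := Complex.norm_log_one_add_sub_self_le (z := -z) (by rw [norm_neg]; linarith)
  rw [norm_neg] at h
  have e : -Complex.log (1 - z) - z = -(Complex.log (1 + -z) - -z) := by ring_nf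
  rw [e, norm_neg]
  refine h.trans ?_
  have : (1 - ‖z‖)⁻¹ ≤ 4 := by
    rw [inv_le_comm₀ (by linarith) (by norm_num)]
    linarith
  nlinarith [sq_nonneg ‖z‖]

lemma norm_eulerRemainder_le (𝔭 : HeightOneSpectrum (𝓞 K)) {s : ℂ} (hs : 3 / 4 < s.re) :
    ‖eulerRemainder 𝔭.asIdeal.absNorm s‖ ≤ 3 * (residueChar 𝔭 : ℝ) ^ (-(3 / 2 : ℝ)) := by
  obtain ⟨hp, -, f, hf, h⟩ := residueChar_spec 𝔭
  have hN := two_le_absNorm 𝔭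
  have hz := norm_cpow_neg_le_three_quarters hN hs
  have hz' := norm_cpow_neg_le hN hs
  have hp1 : (1 : ℝ) ≤ residueChar 𝔭 := by exact_mod_cast hp.one_lt.le
  set q := residueChar 𝔭
  unfold eulerRemainder
  generalize ((𝔭.asIdeal.absNorm : ℕ) : ℂ) ^ (-s) = z at hz hz'
  have hlog := norm_neg_log_sub_le hz
  have hsq : ‖z‖ ^ 2 ≤ (q : ℝ) ^ (-(3 / 2 : ℝ)) := by
    calc ‖z‖ ^ 2 ≤ ((𝔭.asIdeal.absNorm : ℝ) ^ (-(3 / 4 : ℝ))) ^ 2 := by gcongr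
      _ = (𝔭.asIdeal.absNorm : ℝ) ^ (-(3 / 2 : ℝ)) := by
        rw [← Real.rpow_mul_natCast (by positivity)]
        norm_num
      _ ≤ _ := by
        refine Real.rpow_le_rpow_of_nonpos (by linarith) ?_ (by norm_num)
        rw [h]
        exact_mod_cast Nat.le_self_pow hf.ne' _
  split_ifs with hprime
  · exact hlog.trans (by nlinarith [norm_nonneg z, sq_nonneg ‖z‖])
  · have hf2 : 2 ≤ f := by
      by_contra hlt
      obtain rfl : f = 1 := by omega
      rw [h, pow_one] at hprime
      exact hprime hp
    have h1 : ‖z‖ ≤ (q : ℝ) ^ (-(3 / 2 : ℝ)) := by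
      refine hz'.trans ?_
      calc (𝔭.asIdeal.absNorm : ℝ) ^ (-(3 / 4 : ℝ)) ≤ ((q : ℝ) ^ 2) ^ (-(3 / 4 : ℝ)) := by
            refine Real.rpow_le_rpow_of_nonpos (by positivity) ?_ (by norm_num)
            rw [h]
            exact_mod_cast Nat.pow_le_pow_right hp.pos hf2
        _ = _ := by
          rw [← Real.rpow_natCast, ← Real.rpow_mul (by linarith)]
          norm_num
    rw [sub_zero]
    calc ‖-Complex.log (1 - z)‖ = ‖(-Complex.log (1 - z) - z) + z‖ := by ring_nf
      _ ≤ 2 * ‖z‖ ^ 2 + ‖z‖ := norm_add_le_of_le hlog le_rfl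
      _ ≤ _ := by linarith

lemma differentiableOn_eulerRemainder {n : ℕ} (hn : 2 ≤ n) :
    DifferentiableOn ℂ (eulerRemainder n) {s | 3 / 4 < s.re} := by
  intro s hs
  have hn0 : (n : ℂ) ≠ 0 := by exact_mod_cast (by omega : n ≠ 0)
  have hd : DifferentiableAt ℂ (fun s : ℂ ↦ (n : ℂ) ^ (-s)) s :=
    differentiableAt_id.neg.const_cpow (Or.inl hn0)
  have hsl : 1 - (n : ℂ) ^ (-s) ∈ Complex.slitPlane := by
    rw [sub_eq_add_neg]
    refine Complex.mem_slitPlane_of_norm_lt_one ?_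
    rw [norm_neg]
    exact (norm_cpow_neg_le_three_quarters hn hs).trans_lt (by norm_num)
  refine DifferentiableAt.differentiableWithinAt ?_
  unfold eulerRemainder
  refine (((differentiableAt_const _).sub hd).clog hsl).neg.sub ?_
  split_ifs
  · exact hd
  · exact differentiableAt_const _

lemma differentiableOn_tsum_eulerRemainder : DifferentiableOn ℂ
    (fun s ↦ ∑' 𝔭 : HeightOneSpectrum (𝓞 K), eulerRemainder 𝔭.asIdeal.absNorm s)
    {s | 3 / 4 < s.re} :=
  Complex.differentiableOn_tsum_of_summable_norm ((summable_residueChar (by norm_num)).mul_left 3)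
    (fun 𝔭 ↦ differentiableOn_eulerRemainder (two_le_absNorm 𝔭))
    (isOpen_lt continuous_const Complex.continuous_re)
    fun 𝔭 _ hs ↦ norm_eulerRemainder_le 𝔭 hs

lemma zeta_eq_exp {s : ℂ} (hs : 1 < s.re) :
    LSeries (fun n ↦ (Nat.card {I : Ideal (𝓞 K) // Ideal.absNorm I = n} : ℂ)) s =
      Complex.exp (LSeries (fun n ↦ (degreeOneCount K n : ℂ)) s +
        ∑' 𝔭 : HeightOneSpectrum (𝓞 K), eulerRemainder 𝔭.asIdeal.absNorm s) := by
  classical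
  have h0 : s ≠ 0 := by
    rintro rfl
    norm_num at hs
  have hs' : 3 / 4 < s.re := by linarith
  have := nonempty_heightOneSpectrum K
  have hsum := summable_norm_normCpow (K := K) hs h0
  rw [← tsum_normCpow hs h0, ← exp_tsum_neg_log hsum fun 𝔭 h ↦ ?_]
  swap
  · have h' := norm_cpow_neg_le_three_quarters (two_le_absNorm 𝔭) hs'
    change (𝔭.asIdeal.absNorm : ℂ) ^ (-s) = 1 at h
    rw [h, norm_one] at h'
    norm_num at h'
  have hR : Summable fun 𝔭 : HeightOneSpectrum (𝓞 K) ↦ eulerRemainder 𝔭.asIdeal.absNorm s :=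
    Summable.of_norm_bounded ((summable_residueChar (by norm_num)).mul_left 3)
      fun 𝔭 ↦ norm_eulerRemainder_le 𝔭 hs'
  have hG : Summable fun 𝔭 : HeightOneSpectrum (𝓞 K) ↦
      (if 𝔭.asIdeal.absNorm.Prime then (𝔭.asIdeal.absNorm : ℂ) ^ (-s) else 0) := by
    refine Summable.of_norm_bounded (hsum.comp_injective asIdeal_injective) fun 𝔭 ↦ ?_
    split_ifs
    · exact le_rfl
    · rw [norm_zero]
      exact norm_nonneg _
  have hL : ∑' 𝔭 : HeightOneSpectrum (𝓞 K),
      (if 𝔭.asIdeal.absNorm.Prime then (𝔭.asIdeal.absNorm : ℂ) ^ (-s) else 0) =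
      LSeries (fun n ↦ (degreeOneCount K n : ℂ)) s := by
    refine (tsum_comp_eq_tsum_card_mul
      (F := fun n : ℕ ↦ if n.Prime then (n : ℂ) ^ (-s) else 0) hG).trans ?_
    refine tsum_congr fun n ↦ ?_
    rcases eq_or_ne n 0 with rfl | hn
    · simp [Nat.not_prime_zero]
    · rw [LSeries.term_of_ne_zero hn, degreeOneCount]
      split_ifs
      · rw [Complex.cpow_neg, div_eq_mul_inv]
        simp
      · simp
  rw [← hL, ← hG.tsum_add hR]
  congr 1
  refine tsum_congr fun 𝔭 ↦ ?_
  rw [eulerRemainder, add_sub_cancel]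
  rfl

variable (K) in
lemma exists_continuation_degreeOneCount : ∃ θ : ℝ, θ < 1 ∧ ∃ H R : ℂ → ℂ,
    DifferentiableOn ℂ H {s | θ < s.re} ∧ DifferentiableOn ℂ R {s | θ < s.re} ∧ H 1 ≠ 0 ∧
    ∀ s : ℂ, 1 < s.re →
      H s = (s - 1) * Complex.exp (LSeries (fun n ↦ (degreeOneCount K n : ℂ)) s + R s) := by
  obtain ⟨r, hr, H, hH, h1, h⟩ := exists_continuation_zeta K
  refine ⟨max r (3 / 4), max_lt hr (by norm_num), H, _, hH.mono fun s hs ↦ ?_,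
    (differentiableOn_tsum_eulerRemainder (K := K)).mono fun s hs ↦ ?_, h1, fun s hs ↦ ?_⟩
  · have hs : max r (3 / 4) < s.re := hs
    exact (le_max_left _ _).trans_lt hs
  · have hs : max r (3 / 4) < s.re := hs
    exact (le_max_right _ _).trans_lt hs
  · rw [(h s hs).2, zeta_eq_exp hs]

variable (K)

/-- The **prime ideal theorem** for primes of degree one. -/
theorem tendsto_logSum_degreeOneCount_div :
    Tendsto (fun x ↦ PrimeSeries.logSum (degreeOneCount K) x / x) atTop (𝓝 1) := by
  obtain ⟨θ, hθ, H, R, hH, hR, h1, h⟩ := exists_continuation_degreeOneCount K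
  exact PrimeSeries.tendsto_logSum_div degreeOneCount_nonneg degreeOneCount_le hθ hH hR h1 h

theorem exists_tendsto_tsum_degreeOneCount_add_log : ∃ c, Tendsto
    (fun s ↦ ∑' n : ℕ, degreeOneCount K n * (n : ℝ) ^ (-(1 + s)) + Real.log s) (𝓝[>] 0) (𝓝 c) := by
  obtain ⟨θ, hθ, H, R, hH, hR, h1, h⟩ := exists_continuation_degreeOneCount K
  exact PrimeSeries.exists_tendsto_tsum_add_log degreeOneCount_nonneg degreeOneCount_le hθ hH hR
    h1 h

end IdealEuler

end

section

open IsDedekindDomain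

namespace ResidueHom

section General

variable {O : Type*} [CommRing O] {p : ℕ}

lemma eq_of_ker_le [NeZero p] {φ φ' : O →+* ZMod p} (h : RingHom.ker φ ≤ RingHom.ker φ') :
    φ = φ' := by
  ext x
  have : x - (φ x).val ∈ RingHom.ker φ := by simp [RingHom.mem_ker]
  have := h this
  rw [RingHom.mem_ker, map_sub, map_natCast, ZMod.natCast_val, ZMod.cast_id', sub_eq_zero] at this
  exact this.symm

lemma isMaximal_ker [Fact p.Prime] (φ : O →+* ZMod p) : (RingHom.ker φ).IsMaximal :=
  RingHom.ker_isMaximal_of_surjective φ (ZMod.ringHom_surjective φ)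

variable [IsDedekindDomain O] [Module.Free ℤ O]

lemma absNorm_ker (φ : O →+* ZMod p) : (RingHom.ker φ).absNorm = p := by
  rw [Ideal.absNorm_apply, Submodule.cardQuot_apply]
  refine (Nat.card_congr
    (RingHom.quotientKerEquivOfSurjective (ZMod.ringHom_surjective φ)).toEquiv).trans ?_
  rw [Nat.card_zmod]

lemma exists_ker_eq (hp : p.Prime) {P : Ideal O} (hP : P.absNorm = p) :
    ∃ φ : O →+* ZMod p, RingHom.ker φ = P := by
  rw [Ideal.absNorm_apply, Submodule.cardQuot_apply] at hP
  have : Finite (O ⧸ P) := Nat.finite_of_card_ne_zero (hP ▸ hp.ne_zero)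
  have := Fintype.ofFinite (O ⧸ P)
  have hc : Fintype.card (O ⧸ P) = p := by rw [← hP, Nat.card_eq_fintype_card]
  let e : ZMod p ≃+* O ⧸ P := ZMod.ringEquivOfPrime (O ⧸ P) hp hc
  refine ⟨(e.symm : O ⧸ P →+* ZMod p).comp (Ideal.Quotient.mk P), ?_⟩
  ext x
  simp [RingHom.mem_ker, Ideal.Quotient.eq_zero_iff_mem]

lemma exists_ker_eq_of_absNorm_mul (hp : p.Prime) {P Q : Ideal O} (hP : P.IsPrime)
    (hQ : Q.IsPrime) (h : (P * Q).absNorm = p ^ 2) :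
    (∃ φ : O →+* ZMod p, RingHom.ker φ = P) ∧ ∃ φ : O →+* ZMod p, RingHom.ker φ = Q := by
  have h1 : ∀ R : Ideal O, R.IsPrime → R.absNorm ≠ 1 := fun R hR h ↦
    hR.ne_top (Ideal.absNorm_eq_one_iff.mp h)
  rw [map_mul, hp.mul_eq_prime_sq_iff (h1 P hP) (h1 Q hQ)] at h
  exact ⟨exists_ker_eq hp h.1, exists_ker_eq hp h.2⟩

lemma eq_mul_ker_iff [Fact p.Prime] {I : Ideal O} (hI : I.absNorm = p ^ 2) :
    (∃ P Q : Ideal O, P ≠ Q ∧ P.IsPrime ∧ Q.IsPrime ∧ I = P * Q) ↔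
      ∃ φ φ' : O →+* ZMod p, φ ≠ φ' ∧ I ≤ RingHom.ker φ ∧ I ≤ RingHom.ker φ' := by
  have hp : p.Prime := Fact.out
  constructor
  · rintro ⟨P, Q, hPQ, hP, hQ, rfl⟩
    obtain ⟨⟨φ, rfl⟩, φ', rfl⟩ := exists_ker_eq_of_absNorm_mul hp hP hQ hI
    exact ⟨φ, φ', fun h ↦ hPQ (by rw [h]), Ideal.mul_le_left, Ideal.mul_le_right⟩
  · rintro ⟨φ, φ', hne, h, h'⟩
    have hm := isMaximal_ker φ
    have hm' := isMaximal_ker φ'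
    have hker : RingHom.ker φ ≠ RingHom.ker φ' := fun h ↦ hne (eq_of_ker_le h.le)
    refine ⟨_, _, hker, hm.isPrime, hm'.isPrime, ?_⟩
    have hle : I ≤ RingHom.ker φ * RingHom.ker φ' := by
      rw [Ideal.mul_eq_inf_of_isCoprime (Ideal.isCoprime_of_isMaximal hker)]
      exact le_inf h h'
    obtain ⟨J, hJ⟩ := Ideal.dvd_iff_le.mpr hle
    have : J.absNorm = 1 := by
      rw [hJ, map_mul, map_mul, absNorm_ker, absNorm_ker, ← pow_two] at hI
      exact Nat.eq_of_mul_eq_mul_left (pow_pos hp.pos 2) (by rw [hI, mul_one])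
    rw [hJ, Ideal.absNorm_eq_one_iff.mp this, Ideal.mul_top]

end General

variable {K : Type*} [Field K] [NumberField K]

lemma nonempty_equiv {p : ℕ} (hp : p.Prime) : Nonempty ((𝓞 K →+* ZMod p) ≃
    {𝔭 : HeightOneSpectrum (𝓞 K) // 𝔭.asIdeal.absNorm = p}) := by
  have : Fact p.Prime := ⟨hp⟩
  have hne (φ : 𝓞 K →+* ZMod p) : RingHom.ker φ ≠ ⊥ := fun h ↦ by
    have := absNorm_ker φ
    rw [h, Ideal.absNorm_bot] at this
    exact hp.ne_zero this.symm
  refine ⟨Equiv.ofBijective (fun φ ↦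
    ⟨⟨RingHom.ker φ, (isMaximal_ker φ).isPrime, hne φ⟩, absNorm_ker φ⟩) ⟨fun φ φ' h ↦ ?_, ?_⟩⟩
  · simp only [Subtype.mk.injEq, HeightOneSpectrum.mk.injEq] at h
    exact eq_of_ker_le h.le
  · rintro ⟨⟨P, hP, hP0⟩, hPp⟩
    obtain ⟨φ, rfl⟩ := exists_ker_eq hp hPp
    exact ⟨φ, rfl⟩

lemma degreeOneCount_eq {p : ℕ} (hp : p.Prime) :
    IdealEuler.degreeOneCount K p = Nat.card (𝓞 K →+* ZMod p) := by
  rw [IdealEuler.degreeOneCount, if_pos hp, Nat.card_congr (nonempty_equiv hp).some]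

instance {p : ℕ} [hp : Fact p.Prime] : Finite (𝓞 K →+* ZMod p) :=
  have := IdealEuler.finite_absNorm_eq (K := K) p
  .of_equiv _ (nonempty_equiv hp.out).some.symm

lemma card_le {p : ℕ} (hp : p.Prime) :
    Nat.card (𝓞 K →+* ZMod p) ≤ Module.finrank ℚ K := by
  have := IdealEuler.degreeOneCount_le (K := K) p
  rw [degreeOneCount_eq hp] at this
  exact_mod_cast this

end ResidueHom

end

namespace QuadExt

section Ring

variable {R S k : Type*} [CommRing R] [CommRing S] [Algebra R S] [Field k]

/-- An involution of `S` with fixed ring `R`. -/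
structure IsConj (R : Type*) {S : Type*} [CommRing R] [CommRing S] [Algebra R S]
    (τ : S →+* S) : Prop where
  exists_ne : ∃ x, τ x ≠ x
  involutive : ∀ x, τ (τ x) = x
  exists_eq : ∀ y, τ y = y → ∃ c : R, algebraMap R S c = y
  map_algebraMap : ∀ c : R, τ (algebraMap R S c) = algebraMap R S c

lemma IsConj.exists_sqrt {τ : S →+* S} (hτ : IsConj R τ) :
    ∃ (a : R) (r : S), r ^ 2 = algebraMap R S a ∧ τ r = -r ∧ r ≠ 0 := by
  obtain ⟨x, hx⟩ := hτ.exists_ne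
  have h : τ (x - τ x) = -(x - τ x) := by rw [map_sub, hτ.involutive]; ring
  obtain ⟨a, ha⟩ := hτ.exists_eq ((x - τ x) ^ 2) (by rw [map_pow, h, neg_sq])
  exact ⟨a, _, ha.symm, h, sub_ne_zero.mpr hx.symm⟩

lemma nonempty_extension_equiv [FaithfulSMul R S] {τ : S →+* S} (hτ : IsConj R τ) {a : R} {r : S}
    (hr : r ^ 2 = algebraMap R S a) (hτr : τ r = -r) (ψ : R →+* k) (h2a : ψ (2 * a) ≠ 0) :
    Nonempty ({φ : S →+* k // φ.comp (algebraMap R S) = ψ} ≃ {t : k // t ^ 2 = ψ a}) := by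
  have hinj : Function.Injective (algebraMap R S) := FaithfulSMul.algebraMap_injective R S
  choose A hA using fun x : S ↦ hτ.exists_eq (x + τ x) (by rw [map_add, hτ.involutive, add_comm])
  choose B hB using fun x : S ↦ hτ.exists_eq (r * (x - τ x))
    (by rw [map_mul, map_sub, hτ.involutive, hτr]; ring)
  have hAB (x : S) : algebraMap R S (2 * a) * x =
      algebraMap R S (a * A x) + algebraMap R S (B x) * r := by
    simp only [map_mul, hA, hB, map_ofNat, ← hr]
    ring
  have h2 : ψ 2 ≠ 0 := fun h ↦ h2a (by rw [map_mul, h, zero_mul])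
  have ha : ψ a ≠ 0 := fun h ↦ h2a (by rw [map_mul, h, mul_zero])
  have hA0 (c : R) : A (algebraMap R S c) = 2 * c := hinj (by
    rw [hA, hτ.map_algebraMap, map_mul, map_ofNat, two_mul])
  have hB0 (c : R) : B (algebraMap R S c) = 0 := hinj (by
    rw [hB, hτ.map_algebraMap, sub_self, mul_zero, map_zero])
  have hAadd (x y : S) : A (x + y) = A x + A y := hinj (by
    simp only [map_add, hA]; ring)
  have hBadd (x y : S) : B (x + y) = B x + B y := hinj (by
    simp only [map_add, hB]; ring)
  have hAmul (x y : S) : 2 * a * A (x * y) = a * (A x * A y) + B x * B y := hinj (by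
    simp only [map_add, map_mul, hA, hB, map_ofNat, ← hr]; ring)
  have hBmul (x y : S) : 2 * B (x * y) = A x * B y + A y * B x := hinj (by
    simp only [map_add, map_mul, hA, hB, map_ofNat]; ring)
  have hAr : A r = 0 := hinj (by rw [hA, hτr, map_zero]; ring)
  have hBr : B r = 2 * a := hinj (by rw [hB, hτr, map_mul, map_ofNat, ← hr]; ring)
  let ext (t : k) (ht : t ^ 2 = ψ a) : S →+* k :=
    { toFun x := (ψ (a * A x) + ψ (B x) * t) / ψ (2 * a)
      map_zero' := by
        rw [← map_zero (algebraMap R S), hA0, hB0]; simp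
      map_one' := by
        rw [← map_one (algebraMap R S), hA0, hB0, map_zero, zero_mul, add_zero, mul_one,
          mul_comm a, div_self h2a]
      map_add' x y := by
        rw [hAadd, hBadd]; simp only [map_add, map_mul]; ring
      map_mul' x y := by
        have h1 := congrArg ψ (hAmul x y)
        have h3 := congrArg ψ (hBmul x y)
        simp only [map_add, map_mul] at h1 h3 ⊢
        field_simp
        linear_combination ψ a * h1 + t * ψ a * h3 - ψ (B x) * ψ (B y) * ht }
  refine ⟨⟨fun φ ↦ ⟨φ.1 r, ?_⟩, fun t ↦ ⟨ext t.1 t.2, ?_⟩, fun φ ↦ ?_, fun t ↦ ?_⟩⟩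
  · rw [← map_pow, hr]
    exact DFunLike.congr_fun φ.2 a
  · ext c
    change (ψ (a * A (algebraMap R S c)) + ψ (B (algebraMap R S c)) * t.1) / ψ (2 * a) = ψ c
    rw [hA0, hB0, map_zero, zero_mul, add_zero, div_eq_iff h2a, ← map_mul]
    congr 1
    ring
  · obtain ⟨φ, rfl⟩ := φ
    ext x
    have h := congrArg φ (hAB x)
    change ((φ.comp _) (a * A x) + (φ.comp _) (B x) * φ r) / (φ.comp _) (2 * a) = φ x
    rw [div_eq_iff h2a]
    simp only [RingHom.comp_apply, map_mul, map_add] at h ⊢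
    linear_combination -h
  · ext
    change (ψ (a * A r) + ψ (B r) * t.1) / ψ (2 * a) = t.1
    rw [hAr, hBr, mul_zero, map_zero, zero_add, mul_div_cancel_left₀ _ h2a]

lemma IsConj.map_sqrt [IsDomain S] {τ : S →+* S} (hτ : IsConj R τ) {a : R} {r : S}
    (hr : r ^ 2 = algebraMap R S a) (hne : ∀ c : R, algebraMap R S c ≠ r) : τ r = -r := by
  have : τ r ^ 2 = r ^ 2 := by rw [← map_pow, hr, hτ.map_algebraMap]
  refine (sq_eq_sq_iff_eq_or_eq_neg.mp this).resolve_left fun h ↦ ?_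
  obtain ⟨c, hc⟩ := hτ.exists_eq r h
  exact hne c hc

end Ring

variable {F K : Type*} [Field F] [Field K] [NumberField F] [NumberField K] [Algebra F K]

lemma exists_isConj (h : Module.finrank F K = 2) : ∃ τ : 𝓞 K →+* 𝓞 K, IsConj (𝓞 F) τ := by
  have : Algebra.IsQuadraticExtension F K := { finrank_eq_two' := h }
  have hcard : Nat.card Gal(K/F) = 2 := (IsGalois.card_aut_eq_finrank F K).trans h
  have : Nontrivial Gal(K/F) := Finite.one_lt_card_iff_nontrivial.mp (by omega)
  obtain ⟨σ, hσ⟩ := exists_ne (1 : Gal(K/F))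
  have hσ2 : σ * σ = 1 := by rw [← pow_two, ← hcard, pow_card_eq_one']
  refine ⟨RingOfIntegers.mapRingHom (σ : K →+* K), ?_, fun x ↦ ?_, fun y hy ↦ ?_, fun c ↦ ?_⟩
  · by_contra! hall
    refine hσ (AlgEquiv.ext fun x ↦ ?_)
    obtain ⟨u, v, -, rfl⟩ := IsFractionRing.div_surjective (A := 𝓞 K) x
    have h1 (u : 𝓞 K) : σ (algebraMap (𝓞 K) K u) = algebraMap (𝓞 K) K u :=
      congrArg (algebraMap (𝓞 K) K) (hall u)
    rw [map_div₀, h1, h1]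
    rfl
  · exact RingOfIntegers.ext (DFunLike.congr_fun hσ2 (x : K))
  · have hfix : (y : K) ∈ Set.range (algebraMap F K) := by
      rw [IsGalois.mem_range_algebraMap_iff_fixed]
      intro g
      have hσy : σ (y : K) = y := congrArg (algebraMap (𝓞 K) K) hy
      have : g ∈ Subgroup.zpowers σ := by
        have : Fact (Nat.Prime 2) := ⟨Nat.prime_two⟩
        exact mem_zpowers_of_prime_card hcard hσ
      obtain ⟨m, rfl⟩ := this
      exact (MulAction.mem_stabilizer_iff (a := (y : K)).mp
        (Subgroup.zpow_mem (MulAction.stabilizer Gal(K/F) (y : K))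
          (MulAction.mem_stabilizer_iff.mpr hσy) m))
    obtain ⟨c, hc⟩ := hfix
    have hcint : IsIntegral ℤ c := by
      rw [← isIntegral_algebraMap_iff (algebraMap F K).injective, hc]
      exact y.2
    exact ⟨⟨c, hcint⟩, RingOfIntegers.ext hc⟩
  · exact RingOfIntegers.ext (σ.commutes (c : F))

end QuadExt

namespace QuadExt

variable {F K : Type*} [Field F] [Field K] [Algebra F K] {p : ℕ} [Fact p.Prime]

lemma map_ker_le_iff {ψ : 𝓞 F →+* ZMod p} {φ : 𝓞 K →+* ZMod p} :
    (RingHom.ker ψ).map (algebraMap (𝓞 F) (𝓞 K)) ≤ RingHom.ker φ ↔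
      φ.comp (algebraMap (𝓞 F) (𝓞 K)) = ψ := by
  rw [Ideal.map_le_iff_le_comap, RingHom.comap_ker]
  exact ⟨fun h ↦ (ResidueHom.eq_of_ker_le h).symm, fun h ↦ by rw [h]⟩

variable [NumberField F]

lemma eventually_map_ne_zero {a : 𝓞 F} (ha : a ≠ 0) :
    ∀ᶠ p : ℕ in atTop, ∀ ψ : 𝓞 F →+* ZMod p, ψ a ≠ 0 := by
  obtain ⟨c, hc⟩ := Ideal.mem_span_singleton.mp (Ideal.absNorm_mem (Ideal.span {a}))
  have h0 : (Ideal.span {a}).absNorm ≠ 0 := by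
    rwa [Ne, Ideal.absNorm_eq_zero_iff, Ideal.span_singleton_eq_bot]
  filter_upwards [eventually_gt_atTop (Ideal.span {a}).absNorm] with p hp ψ hψ
  have h := congrArg ψ hc
  rw [map_natCast, map_mul, hψ, zero_mul, ZMod.natCast_eq_zero_iff] at h
  exact absurd (Nat.le_of_dvd (Nat.pos_of_ne_zero h0) h) (by omega)

variable [NumberField K]

lemma finrank_ringOfIntegers (h : Module.finrank F K = 2) : Module.finrank (𝓞 F) (𝓞 K) = 2 := by
  rw [← h]
  exact (IsFractionRing.finrank_eq (𝓞 F) F (𝓞 K) K).symm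

lemma exists_map_ker_eq_mul_iff (h : Module.finrank F K = 2) {τ : 𝓞 K →+* 𝓞 K}
    (hτ : IsConj (𝓞 F) τ) {a : 𝓞 F} {r : 𝓞 K} (hr : r ^ 2 = algebraMap (𝓞 F) (𝓞 K) a)
    (hτr : τ r = -r) {ψ : 𝓞 F →+* ZMod p} (h2a : ψ (2 * a) ≠ 0) :
    (∃ P Q : Ideal (𝓞 K), P ≠ Q ∧ P.IsPrime ∧ Q.IsPrime ∧
      (RingHom.ker ψ).map (algebraMap (𝓞 F) (𝓞 K)) = P * Q) ↔ IsSquare (ψ a) := by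
  rw [ResidueHom.eq_mul_ker_iff (p := p) (by
    rw [Ideal.absNorm_algebraMap, finrank_ringOfIntegers h, ResidueHom.absNorm_ker])]
  simp only [map_ker_le_iff]
  obtain ⟨e⟩ := nonempty_extension_equiv hτ hr hτr ψ h2a
  constructor
  · rintro ⟨φ, -, -, hφ, -⟩
    have := (e ⟨φ, hφ⟩).2
    exact ⟨_, by rw [← pow_two, this]⟩
  · rintro ⟨t, ht⟩
    rw [← pow_two] at ht
    have hne : t ≠ -t := by
      rw [Ne, eq_neg_iff_add_eq_zero, ← two_mul]
      intro h0
      apply h2a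
      rw [map_mul, ht, pow_two, ← mul_assoc, map_ofNat, h0, zero_mul]
    refine ⟨(e.symm ⟨t, ht.symm⟩).1, (e.symm ⟨-t, by rw [neg_sq, ht]⟩).1, fun h ↦ hne ?_,
      (e.symm _).2, (e.symm _).2⟩
    exact congrArg Subtype.val (e.symm.injective (Subtype.ext h))

noncomputable instance : Fintype (𝓞 K →+* ZMod p) := Fintype.ofFinite _

lemma natCard_eq_sum {τ : 𝓞 K →+* 𝓞 K}
    (hτ : IsConj (𝓞 F) τ) {a : 𝓞 F} {r : 𝓞 K} (hr : r ^ 2 = algebraMap (𝓞 F) (𝓞 K) a)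
    (hτr : τ r = -r) (h2a : ∀ ψ : 𝓞 F →+* ZMod p, ψ (2 * a) ≠ 0) :
    (Nat.card (𝓞 K →+* ZMod p) : ℤ) =
      ∑ ψ : 𝓞 F →+* ZMod p, (quadraticChar (ZMod p) (ψ a) + 1) := by
  rw [← Nat.card_congr (Equiv.sigmaFiberEquiv fun φ : 𝓞 K →+* ZMod p ↦
    φ.comp (algebraMap (𝓞 F) (𝓞 K))), Nat.card_sigma, Nat.cast_sum]
  refine Finset.sum_congr rfl fun ψ _ ↦ ?_
  have h2 : ringChar (ZMod p) ≠ 2 := fun h ↦ h2a ψ (by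
    have : (2 : ZMod p) = 0 := by
      have := ringChar.Nat.cast_ringChar (R := ZMod p)
      rwa [h] at this
    rw [map_mul, map_ofNat, this, zero_mul])
  rw [← quadraticChar_card_sqrts h2,
    Nat.card_congr (nonempty_extension_equiv hτ hr hτr ψ (h2a ψ)).some]
  simp [Fintype.card_subtype]

end QuadExt

namespace QuadExt

variable {k : Type*} [Field k] [NumberField k] {p : ℕ} [Fact p.Prime]

lemma IsConj.comp_ne {R S : Type*} [CommRing R] [CommRing S] [Algebra R S] {τ : S →+* S}
    {r : S} (hτr : τ r = -r) {A : Type*} [CommRing A] {ψ : S →+* A} (h : ψ (2 * r) ≠ 0) :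
    ψ ≠ ψ.comp τ := fun he ↦ h (by
  have := DFunLike.congr_fun he r
  rw [RingHom.comp_apply, hτr, map_neg] at this
  rw [two_mul, map_add]
  nth_rewrite 1 [this]
  exact neg_add_cancel _)

open scoped Classical in
lemma eq_or_eq_comp (hk : Module.finrank ℚ k = 2) {τ : 𝓞 k →+* 𝓞 k} {ψ : 𝓞 k →+* ZMod p}
    (hne : ψ ≠ ψ.comp τ) (φ : 𝓞 k →+* ZMod p) : φ = ψ ∨ φ = ψ.comp τ := by
  by_contra! h
  have h3 : ({φ, ψ, ψ.comp τ} : Finset (𝓞 k →+* ZMod p)).card = 3 :=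
    Finset.card_eq_three.mpr ⟨_, _, _, h.1, h.2, hne, rfl⟩
  have h2 := ResidueHom.card_le (K := k) (Fact.out : p.Prime)
  rw [hk, Nat.card_eq_fintype_card] at h2
  have := Finset.card_le_univ ({φ, ψ, ψ.comp τ} : Finset (𝓞 k →+* ZMod p))
  omega

open scoped Classical in
lemma sum_eq_add (hk : Module.finrank ℚ k = 2) {τ : 𝓞 k →+* 𝓞 k} {ψ : 𝓞 k →+* ZMod p}
    (hne : ψ ≠ ψ.comp τ) (f : (𝓞 k →+* ZMod p) → ℤ) :
    ∑ φ, f φ = f ψ + f (ψ.comp τ) := by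
  rw [← Finset.sum_pair hne]
  refine (Finset.sum_subset (Finset.subset_univ _) fun φ _ h ↦ absurd ?_ h).symm
  simpa using eq_or_eq_comp hk hne φ

lemma absNorm_span (hk : Module.finrank ℚ k = 2) (p : ℕ) :
    (Ideal.span {(p : 𝓞 k)}).absNorm = p ^ 2 := by
  rw [Ideal.absNorm_span_natCast, RingOfIntegers.rank, hk]

lemma exists_span_eq_mul_iff (hk : Module.finrank ℚ k = 2) {τ : 𝓞 k →+* 𝓞 k} {r : 𝓞 k}
    (hτr : τ r = -r) (h2r : ∀ ψ : 𝓞 k →+* ZMod p, ψ (2 * r) ≠ 0) :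
    (∃ P Q : Ideal (𝓞 k), P ≠ Q ∧ P.IsPrime ∧ Q.IsPrime ∧
      Ideal.span {(p : 𝓞 k)} = P * Q) ↔ Nonempty (𝓞 k →+* ZMod p) := by
  rw [ResidueHom.eq_mul_ker_iff (absNorm_span hk p)]
  have hle (φ : 𝓞 k →+* ZMod p) : Ideal.span {(p : 𝓞 k)} ≤ RingHom.ker φ := by
    rw [Ideal.span_singleton_le_iff_mem, RingHom.mem_ker, map_natCast, ZMod.natCast_self]
  exact ⟨fun ⟨φ, _⟩ ↦ ⟨φ⟩, fun ⟨φ⟩ ↦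
    ⟨φ, φ.comp τ, IsConj.comp_ne (R := ℤ) hτr (h2r φ), hle _, hle _⟩⟩

lemma exists_ker_eq_of_mem (hk : Module.finrank ℚ k = 2) {P Q : Ideal (𝓞 k)} (hP : P.IsPrime)
    (hQ : Q.IsPrime) (h : Ideal.span {(p : 𝓞 k)} = P * Q) {𝔭 : Ideal (𝓞 k)} (h𝔭 : 𝔭.IsPrime)
    (hp : (p : 𝓞 k) ∈ 𝔭) : ∃ ψ : 𝓞 k →+* ZMod p, RingHom.ker ψ = 𝔭 := by
  obtain ⟨⟨φ, rfl⟩, φ', rfl⟩ := ResidueHom.exists_ker_eq_of_absNorm_mul (O := 𝓞 k)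
    (Fact.out : p.Prime) hP hQ (h ▸ absNorm_span hk p)
  rw [← Ideal.span_singleton_le_iff_mem, h] at hp
  rcases h𝔭.mul_le.mp hp with h | h
  · exact ⟨φ, (ResidueHom.isMaximal_ker φ).eq_of_le h𝔭.ne_top h⟩
  · exact ⟨φ', (ResidueHom.isMaximal_ker φ').eq_of_le h𝔭.ne_top h⟩

open scoped Classical in
/-- Detecting by quadratic characters that no `a i` is a square at any prime of degree one
above `p`. -/
lemma sum_prod_one_sub_quadraticChar {ι : Type*} [Fintype ι] (hk : Module.finrank ℚ k = 2)
    {τ : 𝓞 k →+* 𝓞 k} (hττ : ∀ x, τ (τ x) = x) {r : 𝓞 k}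
    (hτr : τ r = -r) (h2r : ∀ ψ : 𝓞 k →+* ZMod p, ψ (2 * r) ≠ 0) {a : ι → 𝓞 k}
    (ha : ∀ i, ∀ ψ : 𝓞 k →+* ZMod p, ψ (a i) ≠ 0) :
    ∑ ψ : 𝓞 k →+* ZMod p, ∏ j : ι × Bool,
        (1 - quadraticChar (ZMod p) (ψ (if j.2 then τ (a j.1) else a j.1))) =
      if Nonempty (𝓞 k →+* ZMod p) ∧ ∀ ψ : 𝓞 k →+* ZMod p, ∀ i, ¬ IsSquare (ψ (a i)) then
        2 ^ (2 * Fintype.card ι + 1) else 0 := by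
  split_ifs with h
  · obtain ⟨⟨ψ⟩, h⟩ := h
    have hprod (ψ : 𝓞 k →+* ZMod p) : ∏ j : ι × Bool,
        (1 - quadraticChar (ZMod p) (ψ (if j.2 then τ (a j.1) else a j.1))) =
        2 ^ (2 * Fintype.card ι) := by
      have h1 (j : ι × Bool) :
          1 - quadraticChar (ZMod p) (ψ (if j.2 then τ (a j.1) else a j.1)) = 2 := by
        have : quadraticChar (ZMod p) (ψ (if j.2 then τ (a j.1) else a j.1)) = -1 := by
          rw [quadraticChar_neg_one_iff_not_isSquare]
          split_ifs
          · exact h (ψ.comp τ) j.1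
          · exact h ψ j.1
        rw [this]; norm_num
      rw [Finset.prod_congr rfl fun j _ ↦ h1 j, Finset.prod_const, Finset.card_univ,
        Fintype.card_prod, Fintype.card_bool, mul_comm 2]
    rw [sum_eq_add hk (IsConj.comp_ne (R := ℤ) hτr (h2r ψ)), hprod, hprod, pow_succ]
    ring
  · refine Finset.sum_eq_zero fun φ _ ↦ ?_
    rw [not_and] at h
    obtain ⟨ψ, i, hψ⟩ : ∃ ψ : 𝓞 k →+* ZMod p, ∃ i, IsSquare (ψ (a i)) := by
      simpa using h ⟨φ⟩
    have h1 : quadraticChar (ZMod p) (ψ (a i)) = 1 :=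
      (quadraticChar_one_iff_isSquare (ha i ψ)).mpr hψ
    rcases eq_or_eq_comp hk (IsConj.comp_ne (R := ℤ) hτr (h2r ψ)) φ with rfl | rfl
    · exact Finset.prod_eq_zero (Finset.mem_univ (i, false)) (by simp [h1])
    · exact Finset.prod_eq_zero (Finset.mem_univ (i, true)) (by simp [h1, hττ])

lemma sum_prod_one_sub_quadraticChar_eq {ι : Type*} [Fintype ι] [DecidableEq ι] (b : ι → 𝓞 k) :
    ∑ ψ : 𝓞 k →+* ZMod p, ∏ j, (1 - quadraticChar (ZMod p) (ψ (b j))) =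
      Nat.card (𝓞 k →+* ZMod p) + ∑ S : Finset ι with S.Nonempty, (-1) ^ S.card *
        ∑ ψ : 𝓞 k →+* ZMod p, quadraticChar (ZMod p) (ψ (∏ j ∈ S, b j)) := by
  have hS : (Finset.univ : Finset (Finset ι)) =
      insert ∅ (Finset.univ.filter fun S : Finset ι ↦ S.Nonempty) := by
    ext S
    simp [Finset.eq_empty_or_nonempty]
  have h1 (ψ : 𝓞 k →+* ZMod p) : ∏ j, (1 - quadraticChar (ZMod p) (ψ (b j))) =
      ∑ S : Finset ι, (-1) ^ S.card * quadraticChar (ZMod p) (ψ (∏ j ∈ S, b j)) := by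
    simp_rw [sub_eq_add_neg]
    rw [Finset.prod_one_add, Finset.powerset_univ]
    refine Finset.sum_congr rfl fun S _ ↦ ?_
    rw [map_prod, map_prod, Finset.prod_neg]
  simp_rw [h1]
  rw [Finset.sum_comm]
  refine ((Finset.sum_congr hS fun _ _ ↦ rfl).trans (Finset.sum_insert (by simp))).trans ?_
  congr 1
  · simp [Nat.card_eq_fintype_card]
  · exact Finset.sum_congr rfl fun S _ ↦ (Finset.mul_sum _ _ _).symm

end QuadExt

section

open Topology

namespace PrimeSeries

/-- `f` behaves on average over the primes like the constant `m`: a Chebyshev-type asymptotic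
together with a logarithmic singularity of the Dirichlet series at `1`. -/
structure HasPrimeMean (f : ℕ → ℝ) (m : ℝ) : Prop where
  exists_bound : ∃ B, ∀ n, |f n| ≤ B
  tendsto_logSum : Tendsto (fun x ↦ logSum f x / x) atTop (𝓝 m)
  exists_tendsto_tsum : ∃ c,
    Tendsto (fun s ↦ ∑' n : ℕ, f n * (n : ℝ) ^ (-(1 + s)) + m * Real.log s) (𝓝[>] 0) (𝓝 c)

namespace HasPrimeMean

variable {f g : ℕ → ℝ} {m m' : ℝ}

lemma summable (hf : HasPrimeMean f m) {s : ℝ} (hs : 0 < s) :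
    Summable fun n : ℕ ↦ f n * (n : ℝ) ^ (-(1 + s)) := by
  obtain ⟨B, hB⟩ := hf.exists_bound
  refine .of_norm_bounded ((Real.summable_nat_rpow.mpr (by linarith : -(1 + s) < -1)).mul_left B)
    fun n ↦ ?_
  rw [norm_mul, Real.norm_eq_abs, Real.norm_of_nonneg (by positivity)]
  exact mul_le_mul_of_nonneg_right (hB n) (by positivity)

lemma zero : HasPrimeMean (fun _ ↦ 0) 0 where
  exists_bound := ⟨0, by simp⟩
  tendsto_logSum := by simp [logSum]
  exists_tendsto_tsum := ⟨0, by simp⟩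

lemma add (hf : HasPrimeMean f m) (hg : HasPrimeMean g m') :
    HasPrimeMean (fun n ↦ f n + g n) (m + m') where
  exists_bound := by
    obtain ⟨B, hB⟩ := hf.exists_bound
    obtain ⟨B', hB'⟩ := hg.exists_bound
    exact ⟨B + B', fun n ↦ (abs_add_le _ _).trans (add_le_add (hB n) (hB' n))⟩
  tendsto_logSum := by
    refine (hf.tendsto_logSum.add hg.tendsto_logSum).congr fun x ↦ ?_
    simp only [logSum, add_mul, Finset.sum_add_distrib, add_div]
  exists_tendsto_tsum := by
    obtain ⟨c, hc⟩ := hf.exists_tendsto_tsum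
    obtain ⟨c', hc'⟩ := hg.exists_tendsto_tsum
    refine ⟨c + c', (hc.add hc').congr' ?_⟩
    filter_upwards [self_mem_nhdsWithin] with s hs
    simp only [add_mul]
    rw [(hf.summable hs).tsum_add (hg.summable hs)]
    ring

lemma const_mul (hf : HasPrimeMean f m) (a : ℝ) : HasPrimeMean (fun n ↦ a * f n) (a * m) where
  exists_bound := by
    obtain ⟨B, hB⟩ := hf.exists_bound
    exact ⟨|a| * B, fun n ↦ by rw [abs_mul]; exact mul_le_mul_of_nonneg_left (hB n) (abs_nonneg a)⟩
  tendsto_logSum := by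
    refine (hf.tendsto_logSum.const_mul a).congr fun x ↦ ?_
    simp only [logSum, mul_assoc, ← Finset.mul_sum, mul_div_assoc]
  exists_tendsto_tsum := by
    obtain ⟨c, hc⟩ := hf.exists_tendsto_tsum
    refine ⟨a * c, (hc.const_mul a).congr fun s ↦ ?_⟩
    simp only [mul_assoc, tsum_mul_left, mul_add]

lemma sum {ι : Type*} (t : Finset ι) {f : ι → ℕ → ℝ} {m : ι → ℝ}
    (h : ∀ i ∈ t, HasPrimeMean (f i) (m i)) :
    HasPrimeMean (fun n ↦ ∑ i ∈ t, f i n) (∑ i ∈ t, m i) := by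
  classical
  induction t using Finset.induction_on with
  | empty => simpa using zero
  | insert i t hi ih =>
    simp only [Finset.sum_insert hi]
    exact (h i (by simp)).add (ih fun j hj ↦ h j (by simp [hj]))

lemma single (n : ℕ) : HasPrimeMean (Pi.single n 1) 0 where
  exists_bound := ⟨1, fun k ↦ by by_cases h : k = n <;> simp [h]⟩
  tendsto_logSum := by
    refine squeeze_zero_norm' (a := fun x : ℝ ↦ Real.log n / x) ?_
      (tendsto_const_nhds.div_atTop tendsto_id)
    filter_upwards [eventually_gt_atTop 0] with x hx
    rw [norm_div, Real.norm_of_nonneg hx.le]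
    gcongr
    simp only [logSum, Pi.single_apply, ite_mul, one_mul, zero_mul, Finset.sum_ite_eq']
    split_ifs
    · rw [Real.norm_of_nonneg (Real.log_natCast_nonneg n)]
    · simpa using Real.log_natCast_nonneg n
  exists_tendsto_tsum := by
    have h (s : ℝ) : ∑' k : ℕ, (Pi.single n 1 : ℕ → ℝ) k * (k : ℝ) ^ (-(1 + s)) + 0 * Real.log s =
        (n : ℝ) ^ (-(1 + s)) := by
      rw [tsum_eq_single n fun k hk ↦ by simp [hk]]
      simp
    simp only [h]
    have hc : Tendsto (fun s : ℝ ↦ -(1 + s)) (𝓝[>] 0) (𝓝 (-(1 + 0))) :=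
      (Continuous.tendsto (by fun_prop) 0).mono_left nhdsWithin_le_nhds
    exact ⟨_, (Real.continuousAt_const_rpow' (a := (n : ℝ)) (by norm_num)).tendsto.comp hc⟩

lemma congr' (hf : HasPrimeMean f m) (h : f =ᶠ[atTop] g) : HasPrimeMean g m := by
  obtain ⟨N, hN⟩ := eventually_atTop.mp h
  have h1 := hf.add (sum (Finset.range N) fun n _ ↦ (single n).const_mul (g n - f n))
  convert h1 using 1
  · ext n
    simp only [Pi.single_apply, mul_ite, mul_one, mul_zero]
    by_cases hn : n < N
    · rw [Finset.sum_eq_single n] <;> simp +contextual [hn, eq_comm]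
    · rw [Finset.sum_eq_zero, add_zero, hN n (not_lt.mp hn)]
      intro k hk
      rw [if_neg]
      rintro rfl
      exact hn (Finset.mem_range.mp hk)
  · simp

end HasPrimeMean

open IdealEuler in
lemma hasPrimeMean_degreeOneCount (K : Type*) [Field K] [NumberField K] :
    HasPrimeMean (degreeOneCount K) 1 where
  exists_bound := ⟨_, fun n ↦ by
    rw [abs_of_nonneg (degreeOneCount_nonneg n)]; exact degreeOneCount_le n⟩
  tendsto_logSum := tendsto_logSum_degreeOneCount_div K
  exists_tendsto_tsum := by simpa using exists_tendsto_tsum_degreeOneCount_add_log K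

end PrimeSeries

end

section

open Topology

namespace SquarefreeCount

open scoped Classical in
lemma tendsto_count_of_hasPrimeMean {P : Set ℕ} {τ : ℝ} (hτ : 0 < τ)
    (h : PrimeSeries.HasPrimeMean (fun n ↦ if n.Prime ∧ n ∈ P then 1 else 0) τ) :
    ∃ C : ℝ, 0 < C ∧ Tendsto (fun X : ℝ ↦ (count P X : ℝ) / (C * X / Real.log X ^ (1 - τ)))
      atTop (𝓝 1) := by
  obtain ⟨c, hc⟩ := h.exists_tendsto_tsum
  refine tendsto_count (c := c) hτ (h.tendsto_logSum.congr fun x ↦ ?_) (hc.congr fun s ↦ ?_)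
  · simp only [PrimeSeries.logSum, theta, ite_mul, one_mul, zero_mul, Finset.sum_filter]
  · congr 1
    have := tsum_subtype {p : ℕ | p.Prime} fun n : ℕ ↦
      if n ∈ P then (n : ℝ) ^ (-(1 + s)) else 0
    refine Eq.trans ?_ this.symm
    refine tsum_congr fun n ↦ ?_
    by_cases h1 : n.Prime <;> by_cases h2 : n ∈ P <;> simp [Set.indicator, h1, h2]

end SquarefreeCount

namespace QuadExt

open NumberField PrimeSeries Polynomial

universe u

variable {k : Type u} [Field k] [NumberField k]

lemma exists_quadratic_extension {b : 𝓞 k} (hb : ∀ c : k, c ^ 2 ≠ b) :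
    ∃ (K : Type u) (_ : Field K) (_ : NumberField K) (_ : Algebra k K),
      Module.finrank k K = 2 ∧ ∃ r : 𝓞 K, r ^ 2 = algebraMap (𝓞 k) (𝓞 K) b ∧
        ∀ c : 𝓞 k, algebraMap (𝓞 k) (𝓞 K) c ≠ r := by
  have hirr : Irreducible (X ^ 2 - C (b : k)) := X_pow_sub_C_irreducible_of_prime Nat.prime_two hb
  have : Fact (Irreducible (X ^ 2 - C (b : k))) := ⟨hirr⟩
  have hfin : Module.finrank k (AdjoinRoot (X ^ 2 - C (b : k))) = 2 := by
    rw [(AdjoinRoot.powerBasis hirr.ne_zero).finrank, AdjoinRoot.powerBasis_dim,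
      natDegree_X_pow_sub_C]
  have : FiniteDimensional k (AdjoinRoot (X ^ 2 - C (b : k))) :=
    Module.finite_of_finrank_pos (by omega)
  have : CharZero (AdjoinRoot (X ^ 2 - C (b : k))) :=
    charZero_of_injective_algebraMap (algebraMap k _).injective
  have : NumberField (AdjoinRoot (X ^ 2 - C (b : k))) :=
    { to_finiteDimensional := FiniteDimensional.trans ℚ k _ }
  have hroot : AdjoinRoot.root (X ^ 2 - C (b : k)) ^ 2 = algebraMap k _ (b : k) := by
    have := AdjoinRoot.eval₂_root (X ^ 2 - C (b : k))
    rw [eval₂_sub, eval₂_pow, eval₂_X, eval₂_C, sub_eq_zero] at this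
    exact this
  have hInt : IsIntegral ℤ (AdjoinRoot.root (X ^ 2 - C (b : k))) := by
    refine IsIntegral.of_pow two_pos ?_
    rw [hroot]
    exact (RingOfIntegers.isIntegral_coe b).algebraMap
  refine ⟨_, inferInstance, this, inferInstance, hfin, ⟨_, hInt⟩, RingOfIntegers.ext hroot,
    fun c hc ↦ hb c ?_⟩
  have h1 : algebraMap k _ (c : k) = AdjoinRoot.root (X ^ 2 - C (b : k)) :=
    congrArg (algebraMap (𝓞 _) (AdjoinRoot (X ^ 2 - C (b : k)))) hc
  apply (algebraMap k (AdjoinRoot (X ^ 2 - C (b : k)))).injective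
  rw [map_pow, h1, hroot]

lemma exists_hasPrimeMean_quadraticChar {b : 𝓞 k} (hb : ∀ c : k, c ^ 2 ≠ b) :
    ∃ f : ℕ → ℝ, HasPrimeMean f 0 ∧ (∀ n, ¬ n.Prime → f n = 0) ∧ ∀ᶠ p : ℕ in atTop,
      ∀ [Fact p.Prime], f p = (∑ ψ : 𝓞 k →+* ZMod p, quadraticChar (ZMod p) (ψ b) : ℤ) := by
  obtain ⟨K, _, _, _, hfin, r, hr, hne⟩ := exists_quadratic_extension hb
  obtain ⟨τ, hτ⟩ := exists_isConj hfin
  have h2b : (2 * b : 𝓞 k) ≠ 0 := by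
    refine mul_ne_zero two_ne_zero fun h ↦ hb 0 ?_
    rw [h]; simp
  refine ⟨fun n ↦ IdealEuler.degreeOneCount K n + -1 * IdealEuler.degreeOneCount k n, ?_,
    fun n hn ↦ by simp [IdealEuler.degreeOneCount, hn], ?_⟩
  · simpa using (hasPrimeMean_degreeOneCount K).add ((hasPrimeMean_degreeOneCount k).const_mul (-1))
  · filter_upwards [eventually_map_ne_zero h2b] with p hp hprime
    have h := natCard_eq_sum hτ hr (hτ.map_sqrt hr hne) hp
    rw [Finset.sum_add_distrib, Finset.sum_const, Finset.card_univ, nsmul_one] at h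
    rw [ResidueHom.degreeOneCount_eq hprime.out, ResidueHom.degreeOneCount_eq hprime.out,
      Nat.card_eq_fintype_card (α := 𝓞 k →+* ZMod p)]
    have h' := congrArg (Int.cast (R := ℝ)) h
    push_cast at h' ⊢
    rw [h']
    ring

open scoped Classical in
theorem hasPrimeMean_indicator {ι : Type*} [Fintype ι] (hk : Module.finrank ℚ k = 2)
    {τ : 𝓞 k →+* 𝓞 k} (hττ : ∀ x, τ (τ x) = x) {r : 𝓞 k} (hr : r ≠ 0)
    (hτr : τ r = -r) {a : ι → 𝓞 k} (ha : ∀ i, a i ≠ 0)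
    (hsq : ∀ S : Finset (ι × Bool), S.Nonempty → ∀ c : k,
      c ^ 2 ≠ (∏ j ∈ S, if j.2 then τ (a j.1) else a j.1 : 𝓞 k))
    {P : Set ℕ} (hP : ∀ᶠ p : ℕ in atTop, ∀ [Fact p.Prime], p ∈ P ↔
      Nonempty (𝓞 k →+* ZMod p) ∧ ∀ ψ : 𝓞 k →+* ZMod p, ∀ i, ¬ IsSquare (ψ (a i))) :
    HasPrimeMean (fun n ↦ if n.Prime ∧ n ∈ P then 1 else 0)
      (1 / 2 ^ (2 * Fintype.card ι + 1)) := by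
  choose! f hf hf0 hfp using fun (S : Finset (ι × Bool)) (hS : S.Nonempty) ↦
    exists_hasPrimeMean_quadraticChar (hsq S hS)
  have hmain := ((hasPrimeMean_degreeOneCount k).add
    (HasPrimeMean.sum (Finset.univ.filter fun S : Finset (ι × Bool) ↦ S.Nonempty) fun S hS ↦
      (hf S (Finset.mem_filter.mp hS).2).const_mul ((-1) ^ S.card))).const_mul
    (1 / 2 ^ (2 * Fintype.card ι + 1))
  simp only [mul_zero, Finset.sum_const_zero, add_zero, mul_one] at hmain
  refine hmain.congr' ?_
  have hfp' : ∀ᶠ p : ℕ in atTop, ∀ S : Finset (ι × Bool), S.Nonempty → ∀ [Fact p.Prime],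
      f S p = (∑ ψ : 𝓞 k →+* ZMod p, quadraticChar (ZMod p)
        (ψ (∏ j ∈ S, if j.2 then τ (a j.1) else a j.1)) : ℤ) := by
    rw [eventually_all]
    intro S
    by_cases hS : S.Nonempty
    · filter_upwards [hfp S hS] with p hp _
      exact hp
    · simp [hS]
  filter_upwards [hfp', hP, eventually_map_ne_zero (mul_ne_zero two_ne_zero hr),
    eventually_all.mpr fun i ↦ eventually_map_ne_zero (ha i)] with p hfp hP h2r ha
  by_cases hp : p.Prime
  · have : Fact p.Prime := ⟨hp⟩
    have key := (sum_prod_one_sub_quadraticChar_eq (p := p)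
      fun j : ι × Bool ↦ if j.2 then τ (a j.1) else a j.1).symm.trans
      (sum_prod_one_sub_quadraticChar hk hττ hτr h2r ha)
    have key' := congrArg (Int.cast (R := ℝ)) key
    rw [ResidueHom.degreeOneCount_eq hp, Finset.sum_congr rfl fun S hS ↦ by
      rw [hfp S (Finset.mem_filter.mp hS).2]]
    simp only [hp, true_and, hP]
    push_cast at key' ⊢
    rw [key']
    split_ifs
    · exact one_div_mul_cancel (by positivity)
    · exact mul_zero _
  · rw [Finset.sum_eq_zero fun S hS ↦ by rw [hf0 S (Finset.mem_filter.mp hS).2 p hp, mul_zero]]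
    simp [IdealEuler.degreeOneCount, hp]

end QuadExt

end

namespace SplitsIn

open QuadExt ComplexConjugate

variable {k : IntermediateField ℚ ℂ} [NumberField k]

lemma exists_conj (hquad : Module.finrank ℚ k = 2)
    (himag : ¬ (k : Set ℂ) ⊆ Set.range Complex.ofReal) :
    ∃ τ : 𝓞 k →+* 𝓞 k, (∀ x, τ (τ x) = x) ∧ (∃ r, r ≠ 0 ∧ τ r = -r) ∧
      ∀ x : 𝓞 k, conj ((x : k) : ℂ) = ((τ x : k) : ℂ) := by
  obtain ⟨τ, hτ⟩ := exists_isConj (F := ℚ) (K := k) hquad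
  obtain ⟨q, r, hr, hτr, hr0⟩ := hτ.exists_sqrt
  refine ⟨τ, hτ.involutive, ⟨r, hr0, hτr⟩, ?_⟩
  let e : 𝓞 k →+* ℂ := (algebraMap k ℂ).comp (algebraMap (𝓞 k) k)
  have he : Function.Injective e :=
    (algebraMap k ℂ).injective.comp RingOfIntegers.coe_injective
  have hrat (c : 𝓞 ℚ) : conj (e (algebraMap (𝓞 ℚ) (𝓞 k) c)) = e (algebraMap (𝓞 ℚ) (𝓞 k) c) := by
    have : e (algebraMap (𝓞 ℚ) (𝓞 k) c) = ((algebraMap k ℂ).comp (algebraMap ℚ k)) (c : ℚ) := rfl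
    rw [this, eq_ratCast, map_ratCast]
  have her0 : e r ≠ 0 := (map_ne_zero_iff e he).mpr hr0
  have hfix (x : 𝓞 k) : conj (e (x + τ x)) = e (x + τ x) := by
    obtain ⟨c, hc⟩ := hτ.exists_eq (x + τ x) (by rw [map_add, hτ.involutive, add_comm])
    rw [← hc, hrat]
  have hfix' (x : 𝓞 k) : conj (e (r * (x - τ x))) = e (r * (x - τ x)) := by
    obtain ⟨c, hc⟩ := hτ.exists_eq (r * (x - τ x))
      (by rw [map_mul, map_sub, hτ.involutive, hτr]; ring)
    rw [← hc, hrat]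
  have hsq : conj (e r) ^ 2 = e r ^ 2 := by rw [← map_pow, ← map_pow, hr, hrat]
  rcases sq_eq_sq_iff_eq_or_eq_neg.mp hsq with h | h
  · refine absurd (fun z hz ↦ ?_) himag
    have hall (x : 𝓞 k) : conj (e x) = e x := by
      have h1 := hfix x
      have h2 := hfix' x
      simp only [map_add, map_mul, map_sub, h] at h1 h2
      have h2' := mul_left_cancel₀ her0 h2
      linear_combination (h1 + h2') / 2
    obtain ⟨u, v, -, huv⟩ := IsFractionRing.div_surjective (A := 𝓞 k) (⟨z, hz⟩ : k)
    have : z = e u / e v := by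
      have := congrArg (algebraMap k ℂ) huv
      rw [map_div₀] at this
      exact this.symm
    obtain ⟨t, ht⟩ := Complex.conj_eq_iff_real.mp
      (show conj z = z by rw [this, map_div₀, hall, hall])
    exact ⟨t, ht.symm⟩
  · intro x
    change conj (e x) = e (τ x)
    have h1 := hfix x
    have h2 := hfix' x
    simp only [map_add, map_mul, map_sub, h] at h1 h2
    have h2' : -(conj (e x) - conj (e (τ x))) = e x - e (τ x) :=
      mul_left_cancel₀ her0 (by linear_combination h2)
    linear_combination (h1 - h2') / 2

lemma exists_sqrt {L : IntermediateField ℚ ℂ} (hkL : k ≤ L)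
    (hL : Module.finrank ℚ L = 2 * Module.finrank ℚ k) :
    ∃ (a : 𝓞 k) (r : ℂ), a ≠ 0 ∧ r ^ 2 = ((a : k) : ℂ) ∧
      (∀ E : Subfield ℂ, (∀ x ∈ k, x ∈ E) → r ∈ E → ∀ x ∈ L, x ∈ E) ∧
      ∀ᶠ p : ℕ in atTop, ∀ [Fact p.Prime], ∀ ψ : 𝓞 k →+* ZMod p,
        SplitsIn k L hkL (RingHom.ker ψ) ↔ IsSquare (ψ a) := by
  have hpos : 0 < Module.finrank ℚ k := Module.finrank_pos
  have : FiniteDimensional ℚ L := Module.finite_of_finrank_pos (by omega)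
  have : NumberField L := { to_finiteDimensional := this }
  let _ : Algebra k L := (IntermediateField.inclusion hkL).toRingHom.toAlgebra
  have : IsScalarTower ℚ k L := .of_algebraMap_eq fun x ↦ rfl
  have hfin : Module.finrank k L = 2 := by
    have := Module.finrank_mul_finrank ℚ k L
    rw [hL, mul_comm] at this
    exact Nat.eq_of_mul_eq_mul_right hpos this
  obtain ⟨τ, hτ⟩ := exists_isConj hfin
  obtain ⟨a, r, hr, hτr, hr0⟩ := hτ.exists_sqrt
  have ha : a ≠ 0 := by
    rintro rfl
    rw [map_zero] at hr
    exact hr0 (pow_eq_zero_iff two_ne_zero |>.mp hr)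
  let e : 𝓞 L →+* ℂ := (algebraMap L ℂ).comp (algebraMap (𝓞 L) L)
  have he : Function.Injective e :=
    (algebraMap L ℂ).injective.comp RingOfIntegers.coe_injective
  refine ⟨a, e r, ha, ?_, fun E hk hrE x hx ↦ ?_, ?_⟩
  · rw [← map_pow, hr]; rfl
  · have hkE (c : 𝓞 k) : e (algebraMap (𝓞 k) (𝓞 L) c) ∈ E := hk _ (c : k).2
    have her0 : e r ≠ 0 := (map_ne_zero_iff e he).mpr hr0
    have hall (y : 𝓞 L) : e y ∈ E := by
      obtain ⟨A, hA⟩ := hτ.exists_eq (y + τ y) (by rw [map_add, hτ.involutive, add_comm])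
      obtain ⟨B, hB⟩ := hτ.exists_eq (r * (y - τ y))
        (by rw [map_mul, map_sub, hτ.involutive, hτr]; ring)
      have : e y = (e (algebraMap (𝓞 k) (𝓞 L) A) + e (algebraMap (𝓞 k) (𝓞 L) B) / e r) / 2 := by
        rw [hA, hB, map_add, map_mul, map_sub, mul_div_cancel_left₀ _ her0]
        ring
      rw [this]
      exact E.div_mem (E.add_mem (hkE A) (E.div_mem (hkE B) hrE)) (ofNat_mem E 2)
    obtain ⟨u, v, -, huv⟩ := IsFractionRing.div_surjective (A := 𝓞 L) (⟨x, hx⟩ : L)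
    have : e u / e v = x := by
      have := congrArg (algebraMap L ℂ) huv
      rwa [map_div₀] at this
    rw [← this]
    exact E.div_mem (hall u) (hall v)
  · filter_upwards [eventually_map_ne_zero (mul_ne_zero two_ne_zero ha)] with p hp _ ψ
    exact exists_map_ker_eq_mul_iff hfin hτ hr hτr (hp ψ)

end SplitsIn

namespace SplitsIn

open IntermediateField ComplexConjugate Polynomial

section Degree

variable {F E : Type*} [Field F] [Field E] [Algebra F E]

lemma finiteDimensional_adjoin_sqrt {r : E} {b : F} (h : r ^ 2 = algebraMap F E b) :
    FiniteDimensional F F⟮r⟯ ∧ Module.finrank F F⟮r⟯ ≤ 2 := by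
  have hmonic : (X ^ 2 - C b).Monic := monic_X_pow_sub_C b two_ne_zero
  have hr : aeval r (X ^ 2 - C b) = 0 := by simp [h]
  have hInt : IsIntegral F r := ⟨_, hmonic, hr⟩
  refine ⟨adjoin.finiteDimensional hInt, ?_⟩
  rw [adjoin.finrank hInt, ← natDegree_X_pow_sub_C (n := 2) (r := b)]
  exact natDegree_le_of_dvd (minpoly.dvd F r hr) hmonic.ne_zero

lemma finrank_sup_adjoin_sqrt_le {ι : Type*} {r : ι → E} {b : ι → F}
    (h : ∀ i, r i ^ 2 = algebraMap F E (b i)) (t : Finset ι) :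
    FiniteDimensional F (t.sup fun i ↦ F⟮r i⟯ : IntermediateField F E) ∧
      Module.finrank F (t.sup fun i ↦ F⟮r i⟯ : IntermediateField F E) ≤ 2 ^ t.card := by
  classical
  induction t using Finset.induction_on with
  | empty =>
    rw [Finset.sup_empty, Finset.card_empty, pow_zero]
    exact ⟨inferInstance, (IntermediateField.finrank_bot (F := F) (E := E)).le⟩
  | insert i t hi ih =>
    obtain ⟨h1, h2⟩ := ih
    obtain ⟨h3, h4⟩ := finiteDimensional_adjoin_sqrt (h i)
    rw [Finset.sup_insert, Finset.card_insert_of_notMem hi, pow_succ']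
    exact ⟨inferInstance, (IntermediateField.finrank_sup_le _ _).trans (Nat.mul_le_mul h4 h2)⟩

lemma sqrt_mem_sup_erase {ι : Type*} [Fintype ι] [DecidableEq ι] {r : ι → E} {b : ι → F}
    (h : ∀ i, r i ^ 2 = algebraMap F E (b i)) (hb : ∀ i, b i ≠ 0) {S : Finset ι} {c : F}
    (hc : c ^ 2 = ∏ i ∈ S, b i) {i : ι} (hi : i ∈ S) (j : ι) :
    r j ∈ ((Finset.univ.erase i).sup fun i ↦ F⟮r i⟯ : IntermediateField F E) := by
  set M : IntermediateField F E := (Finset.univ.erase i).sup fun i ↦ F⟮r i⟯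
  have hne (j : ι) (hj : j ≠ i) : r j ∈ M :=
    (Finset.le_sup (f := fun i ↦ F⟮r i⟯) (Finset.mem_erase.mpr ⟨hj, Finset.mem_univ j⟩) :
      F⟮r j⟯ ≤ M) (mem_adjoin_simple_self F (r j))
  by_cases hj : j = i
  · subst hj
    have hr0 (i : ι) : r i ≠ 0 := fun h0 ↦ hb i (by
      have := h i
      rw [h0, zero_pow two_ne_zero] at this
      exact (map_eq_zero _).mp this.symm)
    have hprod : ∏ i ∈ S.erase j, r i ∈ M :=
      prod_mem fun i hi ↦ hne i (Finset.ne_of_mem_erase hi)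
    have hprod0 : ∏ i ∈ S.erase j, r i ≠ 0 := Finset.prod_ne_zero_iff.mpr fun i _ ↦ hr0 i
    have hsq : (∏ i ∈ S, r i) ^ 2 = algebraMap F E c ^ 2 := by
      rw [← map_pow, hc, map_prod, ← Finset.prod_pow]
      exact Finset.prod_congr rfl fun i _ ↦ h i
    have hall : ∏ i ∈ S, r i ∈ M := by
      rcases sq_eq_sq_iff_eq_or_eq_neg.mp hsq with h | h <;> rw [h]
      · exact M.algebraMap_mem c
      · exact M.neg_mem (M.algebraMap_mem c)
    rw [← Finset.mul_prod_erase S r hi] at hall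
    have := M.div_mem hall hprod
    rwa [mul_div_cancel_right₀ _ hprod0] at this
  · exact hne j hj

end Degree

lemma prod_ne_sq {k : IntermediateField ℚ ℂ} [NumberField k] {ι : Type*} [Fintype ι]
    {L : ι → IntermediateField ℚ ℂ} {τ : 𝓞 k →+* 𝓞 k}
    (hτ : ∀ x : 𝓞 k, conj ((x : k) : ℂ) = ((τ x : k) : ℂ))
    {a : ι → 𝓞 k} (ha : ∀ i, a i ≠ 0) {r : ι → ℂ} (hr : ∀ i, r i ^ 2 = ((a i : k) : ℂ))
    (hL : ∀ i, ∀ E : Subfield ℂ, (∀ x ∈ k, x ∈ E) → r i ∈ E → ∀ x ∈ L i, x ∈ E)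
    (hcompositum : Module.finrank ℚ (⨆ i, L i ⊔ conjField (L i) : IntermediateField ℚ ℂ) =
      2 ^ (2 * Fintype.card ι) * Module.finrank ℚ k)
    (S : Finset (ι × Bool)) (hS : S.Nonempty) (c : k) :
    c ^ 2 ≠ (∏ j ∈ S, if j.2 then τ (a j.1) else a j.1 : 𝓞 k) := by
  classical
  intro hc
  obtain ⟨i, hi⟩ := hS
  let R : ι × Bool → ℂ := fun j ↦ if j.2 then conj (r j.1) else r j.1
  let b : ι × Bool → k := fun j ↦ (if j.2 then τ (a j.1) else a j.1 : 𝓞 k)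
  have hRb (j : ι × Bool) : R j ^ 2 = algebraMap k ℂ (b j) := by
    simp only [R, b]
    split_ifs
    · rw [← map_pow, hr, hτ]; rfl
    · exact hr j.1
  have hb (j : ι × Bool) : b j ≠ 0 := by
    simp only [b]
    rw [RingOfIntegers.coe_ne_zero_iff]
    split_ifs
    · intro h0
      have := hτ (a j.1)
      rw [h0] at this
      simp at this
      exact ha j.1 this
    · exact ha j.1
  have hc' : c ^ 2 = ∏ j ∈ S, b j := hc.trans (map_prod (algebraMap (𝓞 k) k) _ _)
  have hmem := sqrt_mem_sup_erase hRb hb hc' hi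
  obtain ⟨hfd, hfin⟩ := finrank_sup_adjoin_sqrt_le hRb (Finset.univ.erase i)
  set M : IntermediateField k ℂ := (Finset.univ.erase i).sup fun i ↦ k⟮R i⟯
  have hkM (x : ℂ) (hx : x ∈ k) : x ∈ M := M.algebraMap_mem ⟨x, hx⟩
  have hkconj (x : ℂ) (hx : x ∈ k) : conj x ∈ M := by
    obtain ⟨u, v, -, huv⟩ := IsFractionRing.div_surjective (A := 𝓞 k) (⟨x, hx⟩ : k)
    have : ((u : k) : ℂ) / ((v : k) : ℂ) = x := congrArg (algebraMap k ℂ) huv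
    rw [← this, map_div₀, hτ, hτ]
    exact M.div_mem (hkM _ (τ u : k).2) (hkM _ (τ v : k).2)
  have hle : (⨆ i, L i ⊔ conjField (L i) : IntermediateField ℚ ℂ) ≤ M.restrictScalars ℚ := by
    refine iSup_le fun i ↦ sup_le (fun x hx ↦ ?_) ?_
    · exact hL i M.toSubfield hkM (hmem (i, false)) x hx
    · rintro - ⟨x, hx, rfl⟩
      exact hL i (M.toSubfield.comap (starRingEnd ℂ)) hkconj (hmem (i, true)) x hx
  have : FiniteDimensional ℚ M := FiniteDimensional.trans ℚ k M
  have hfd' : FiniteDimensional ℚ (M.restrictScalars ℚ) := this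
  have h1 := Submodule.finrank_mono (R := ℚ) (M := ℂ)
    (s := Subalgebra.toSubmodule (⨆ i, L i ⊔ conjField (L i) : IntermediateField ℚ ℂ).toSubalgebra)
    (t := Subalgebra.toSubmodule (M.restrictScalars ℚ).toSubalgebra) hle
  have h2 : Module.finrank ℚ (M.restrictScalars ℚ) = Module.finrank ℚ k * Module.finrank k M :=
    (Module.finrank_mul_finrank ℚ k M).symm
  have h3 : 2 ^ (2 * Fintype.card ι) * Module.finrank ℚ k ≤
      Module.finrank ℚ k * Module.finrank k M := by rw [← hcompositum, ← h2]; exact h1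
  rw [mul_comm] at h3
  have h4 := (Nat.le_of_mul_le_mul_left h3 Module.finrank_pos).trans hfin
  rw [Finset.card_erase_of_mem (Finset.mem_univ i), Finset.card_univ, Fintype.card_prod,
    Fintype.card_bool, Nat.pow_le_pow_iff_right one_lt_two] at h4
  have : 0 < Fintype.card ι := Fintype.card_pos_iff.mpr ⟨i.1⟩
  omega

end SplitsIn

/-- Let `k ⊂ ℂ` be an imaginary quadratic field, `L₁, …, Lₙ` quadratic extensions of `k`
in `ℂ`, with conjugate fields `L₁', …, Lₙ'`, such that the compositum of all of them has
degree `2^(2n)` over `k`.  Let `𝒫` be the set of rational primes which split in `k` and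
such that every prime of `O_k` above them is nonsplit in every `L_i/k`.  Then the number
of squarefree positive integers `d ≤ X` all of whose prime factors lie in `𝒫` is
asymptotic to `C·X/(log X)^(1 - 1/2^(2n+1))` for some constant `C > 0`. -/
theorem count_squarefree_with_prime_factors_split_in_k_nonsplit_in_extensions
    (k : IntermediateField ℚ ℂ) [NumberField ↥k]
    (hquad : Module.finrank ℚ ↥k = 2)
    (himag : ¬ (k : Set ℂ) ⊆ Set.range (Complex.ofReal))
    (n : ℕ) (hn : 1 ≤ n)
    (L : Fin n → IntermediateField ℚ ℂ)
    (hkL : ∀ i, k ≤ L i)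
    (hLquad : ∀ i, Module.finrank ℚ ↥(L i) = 2 * Module.finrank ℚ ↥k)
    (hkL' : ∀ i, k ≤ conjField (L i))
    (hcompositum :
      Module.finrank ℚ ↥(⨆ i, L i ⊔ conjField (L i)) =
        2 ^ (2 * n) * Module.finrank ℚ ↥k) :
    ∃ C : ℝ, 0 < C ∧
      Tendsto
        (fun X : ℝ =>
          (({d : ℕ | 0 < d ∧ (d : ℝ) ≤ X ∧ Squarefree d ∧
              ∀ p : ℕ, p.Prime → p ∣ d →
                RatPrimeSplitsIn k p ∧
                  ∀ 𝔭 : Ideal (𝓞 ↥k), 𝔭.IsPrime → (p : 𝓞 ↥k) ∈ 𝔭 →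
                    ∀ i, ¬ SplitsIn k (L i) (hkL i) 𝔭}.ncard : ℝ)) /
            (C * X / Real.log X ^ (1 - 1 / 2 ^ (2 * n + 1) : ℝ)))
        atTop (nhds 1) := by
  obtain ⟨τ, hττ, ⟨r0, hr0, hτr⟩, hconj⟩ := SplitsIn.exists_conj hquad himag
  choose a r ha hr hL hsplit using fun i ↦ SplitsIn.exists_sqrt (hkL i) (hLquad i)
  let P : Set ℕ := {p | RatPrimeSplitsIn k p ∧ ∀ 𝔭 : Ideal (𝓞 k), 𝔭.IsPrime → (p : 𝓞 k) ∈ 𝔭 →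
    ∀ i, ¬ SplitsIn k (L i) (hkL i) 𝔭}
  have hP : ∀ᶠ p : ℕ in atTop, ∀ [Fact p.Prime], p ∈ P ↔
      Nonempty (𝓞 k →+* ZMod p) ∧ ∀ ψ : 𝓞 k →+* ZMod p, ∀ i, ¬ IsSquare (ψ (a i)) := by
    filter_upwards [QuadExt.eventually_map_ne_zero (mul_ne_zero two_ne_zero hr0),
      eventually_all.mpr hsplit] with p h2r hs _
    have hiff := QuadExt.exists_span_eq_mul_iff hquad hτr h2r
    constructor
    · rintro ⟨h1, h2⟩
      refine ⟨hiff.mp h1, fun ψ i hi ↦ ?_⟩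
      exact h2 _ (ResidueHom.isMaximal_ker ψ).isPrime
        (by rw [RingHom.mem_ker, map_natCast, ZMod.natCast_self]) i ((hs i ψ).mpr hi)
    · rintro ⟨h1, h2⟩
      refine ⟨hiff.mpr h1, fun 𝔭 h𝔭 hp i hi ↦ ?_⟩
      obtain ⟨Q, Q', -, hQ, hQ', h⟩ := hiff.mpr h1
      obtain ⟨ψ, rfl⟩ := QuadExt.exists_ker_eq_of_mem hquad hQ hQ' h h𝔭 hp
      exact h2 ψ i ((hs i ψ).mp hi)
  have hmean := QuadExt.hasPrimeMean_indicator hquad hττ hr0 hτr ha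
    (SplitsIn.prod_ne_sq hconj ha hr hL (by simpa using hcompositum)) hP
  rw [Fintype.card_fin] at hmean
  obtain ⟨C, hC, h⟩ := SquarefreeCount.tendsto_count_of_hasPrimeMean (by positivity) hmean
  refine ⟨C, hC, h.congr fun X ↦ ?_⟩
  rw [SquarefreeCount.count_eq_ncard]
  rfl
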